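/- Let n ≥ 1 and let w : [0,∞) → (−∞,∞] be an increasing function such that t ↦ w(e^t) is convex on ℝ. Let μ be the measure on ℝⁿ with density x ↦ e^{−w(|x|)} with respect to Lebesgue measure. Then for every pair of symmetric convex bodies K, L ⊆ ℝⁿ and every λ ∈ [0,1], one has μ((1−λ)K + λL)^{1/n} ≥ (1−λ) μ(K)^{1/n} + λ μ(L)^{1/n}. -/

import Mathlib

open MeasureTheory Set
open scoped ENNReal Pointwise

/-- Symmetric convex body: compact convex set with nonempty interior, `K = -K`. -/
def IsSymmetricConvexBody {n : ℕ} (K : Set (EuclideanSpace ℝ (Fin n))) : Prop :=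
  IsCompact K ∧ Convex ℝ K ∧ (interior K).Nonempty ∧ K = -K

noncomputable section SmoothAlgebra

open scoped ContDiff

/-- The algebra of smooth real functions on Euclidean space. -/
def smoothSubalgebra (n : ℕ) : Subalgebra ℝ (EuclideanSpace ℝ (Fin n) → ℝ) where
  carrier := {f | ContDiff ℝ ∞ f}
  mul_mem' hf hg := by
    rw [mem_ofPred_eq] at *
    exact ContDiff.mul hf hg
  add_mem' hf hg := by
    rw [mem_ofPred_eq] at *
    exact ContDiff.add hf hg
  algebraMap_mem' _ := by
    rw [mem_ofPred_eq]
    exact contDiff_const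

theorem mem_smoothSubalgebra {n : ℕ} {f : EuclideanSpace ℝ (Fin n) → ℝ} :
    f ∈ smoothSubalgebra n ↔ ContDiff ℝ ∞ f := Iff.of_eq mem_ofPred_eq

/-- Smooth real functions on Euclidean space. -/
abbrev SmoothFn (n : ℕ) : Type := smoothSubalgebra n

namespace SmoothFn

variable {n : ℕ}

instance : CoeFun (SmoothFn n) (fun _ => EuclideanSpace ℝ (Fin n) → ℝ) := ⟨Subtype.val⟩

theorem contDiff (f : SmoothFn n) : ContDiff ℝ ∞ f.1 := mem_smoothSubalgebra.1 f.2

theorem continuous (f : SmoothFn n) : Continuous f.1 := f.contDiff.continuous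

theorem differentiable (f : SmoothFn n) : Differentiable ℝ f.1 :=
  f.contDiff.differentiable (by simp)

@[ext] theorem ext {f g : SmoothFn n} (h : ∀ x, f x = g x) : f = g := Subtype.ext (funext h)

@[simp] theorem add_apply (f g : SmoothFn n) (x) : (f + g) x = f x + g x := rfl
@[simp] theorem sub_apply (f g : SmoothFn n) (x) : (f - g) x = f x - g x := rfl
@[simp] theorem neg_apply (f : SmoothFn n) (x) : (-f) x = - f x := rfl
@[simp] theorem mul_apply (f g : SmoothFn n) (x) : (f * g) x = f x * g x := rfl
@[simp] theorem smul_apply (c : ℝ) (f : SmoothFn n) (x) : (c • f) x = c * f x := rfl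
@[simp] theorem one_apply (x) : (1 : SmoothFn n) x = 1 := rfl
@[simp] theorem pow_apply (f : SmoothFn n) (k : ℕ) (x) : (f ^ k) x = f x ^ k := rfl
@[simp] theorem sum_apply {ι : Type*} (s : Finset ι) (f : ι → SmoothFn n) (x) :
    (∑ i ∈ s, f i) x = ∑ i ∈ s, f i x := by
  classical
  induction s using Finset.induction_on with
  | empty => rfl
  | insert a s ha ih => rw [Finset.sum_insert ha, Finset.sum_insert ha, ← ih]; rfl

/-- Constant functions. -/
def C (c : ℝ) : SmoothFn n := algebraMap ℝ _ c

@[simp] theorem C_apply (c : ℝ) (x) : (C c : SmoothFn n) x = c := rfl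

theorem C_mul_eq_smul (c : ℝ) (f : SmoothFn n) : C c * f = c • f := by ext x; simp

theorem C_one : (C 1 : SmoothFn n) = 1 := rfl

/-- Partial derivatives as derivations of the algebra of smooth functions. -/
def pd (i : Fin n) : Derivation ℝ (SmoothFn n) (SmoothFn n) :=
  Derivation.mk'
    { toFun := fun f => ⟨fun x => fderiv ℝ f.1 x (EuclideanSpace.single i 1),
        mem_smoothSubalgebra.2
          ((f.contDiff.fderiv_right (m := ∞) (by simp)).clm_apply contDiff_const)⟩
      map_add' := fun f g => by
        ext x
        change fderiv ℝ (f.1 + g.1) x _ = _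
        rw [fderiv_add (f.differentiable x) (g.differentiable x)]; rfl
      map_smul' := fun c f => by
        ext x
        change fderiv ℝ (c • f.1) x _ = _
        rw [fderiv_const_smul (f.differentiable x)]; rfl }
    (fun f g => by
      ext x
      change fderiv ℝ (f.1 * g.1) x _ = _
      rw [fderiv_mul (f.differentiable x) (g.differentiable x)]; rfl)

theorem pd_apply (i : Fin n) (f : SmoothFn n) (x) :
    pd i f x = fderiv ℝ f.1 x (EuclideanSpace.single i 1) := rfl

theorem pd_mul (i : Fin n) (f g : SmoothFn n) : pd i (f * g) = f * pd i g + g * pd i f := by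
  simp

@[simp] theorem pd_C (i : Fin n) (c : ℝ) : pd i (C c) = 0 := Derivation.map_algebraMap _ _

theorem pd_comm (i j : Fin n) (f : SmoothFn n) : pd i (pd j f) = pd j (pd i f) := by
  ext x
  have h2 : ContDiffAt ℝ ∞ f.1 x := f.contDiff.contDiffAt
  have hs := h2.isSymmSndFDerivAt (by simp; norm_cast)
  have hd : DifferentiableAt ℝ (fderiv ℝ f.1) x :=
    ((f.contDiff.fderiv_right (m := ∞) (by simp)).differentiable (by simp)) x
  have key : ∀ a b : Fin n, pd a (pd b f) x =
      fderiv ℝ (fderiv ℝ f.1) x (EuclideanSpace.single a 1) (EuclideanSpace.single b 1) := by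
    intro a b
    rw [pd_apply]
    change fderiv ℝ (fun y => fderiv ℝ f.1 y (EuclideanSpace.single b 1)) x _ = _
    rw [fderiv_clm_apply hd (by fun_prop)]
    simp
  rw [key, key]
  exact hs _ _

/-- Coordinate functions. -/
def X (i : Fin n) : SmoothFn n := ⟨fun x => x i, by
  rw [mem_smoothSubalgebra]
  change ContDiff ℝ ∞ (EuclideanSpace.proj (𝕜 := ℝ) i)
  exact ContinuousLinearMap.contDiff _⟩

@[simp] theorem X_apply (i : Fin n) (x) : X i x = x i := rfl

theorem pd_X (i j : Fin n) : pd i (X j) = if i = j then 1 else 0 := by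
  ext x
  rw [pd_apply]
  change fderiv ℝ (EuclideanSpace.proj (𝕜 := ℝ) j) x _ = _
  rw [ContinuousLinearMap.fderiv]
  by_cases h : i = j
  · subst h; simp
  · simp [h, Ne.symm h]

/-- The exponential of a smooth function. -/
def exp (f : SmoothFn n) : SmoothFn n :=
  ⟨fun x => Real.exp (f x), mem_smoothSubalgebra.2 f.contDiff.exp⟩

@[simp] theorem exp_apply (f : SmoothFn n) (x) : exp f x = Real.exp (f x) := rfl

theorem pd_exp (f : SmoothFn n) (i : Fin n) : pd i (exp f) = exp f * pd i f := by
  ext x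
  rw [pd_apply]
  change fderiv ℝ (fun x => Real.exp (f.1 x)) x _ = _
  rw [fderiv_exp (f.differentiable x)]
  rfl

theorem exp_mul_exp_neg (f : SmoothFn n) : exp f * exp (-f) = 1 := by
  ext x; simp [← Real.exp_add]

/-- The function `(ρ - |x|²) / 2`, positive exactly on the centered ball of squared radius `ρ`. -/
def bump (ρ : ℝ) : SmoothFn n := C (1 / 2) * (C ρ - ∑ i, X i ^ 2)

theorem bump_apply (ρ : ℝ) (x : EuclideanSpace ℝ (Fin n)) :
    bump ρ x = (ρ - ‖x‖ ^ 2) / 2 := by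
  simp [bump, EuclideanSpace.norm_sq_eq]; ring

theorem pd_bump (ρ : ℝ) (i : Fin n) : pd i (bump ρ) = - X i := by
  have h2 : (C (1 / 2) : SmoothFn n) * 2 = 1 := by ext x; change (1 / 2 : ℝ) * 2 = 1; norm_num
  have : pd i (∑ j, X j ^ 2 : SmoothFn n) = 2 * X i := by
    rw [map_sum, Finset.sum_eq_single i]
    · rw [pow_two, pd_mul, pd_X, if_pos rfl]; ring
    · intro j _ hj
      rw [pow_two, pd_mul, pd_X, if_neg (Ne.symm hj)]; ring
    · simp
  rw [bump, pd_mul, map_sub, this, pd_C, pd_C]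
  linear_combination (- X i) * h2

/-- Reflection through the origin. -/
def reflect : SmoothFn n →ₐ[ℝ] SmoothFn n where
  toFun f := ⟨fun x => f (-x), mem_smoothSubalgebra.2 (f.contDiff.comp contDiff_neg)⟩
  map_one' := rfl
  map_mul' _ _ := rfl
  map_zero' := rfl
  map_add' _ _ := rfl
  commutes' _ := rfl

@[simp] theorem reflect_apply (f : SmoothFn n) (x) : reflect f x = f (-x) := rfl

theorem pd_reflect (i : Fin n) (f : SmoothFn n) : pd i (reflect f) = - reflect (pd i f) := by
  ext x
  rw [pd_apply]
  change fderiv ℝ (fun x => f.1 (-x)) x _ = _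
  have h : HasFDerivAt (fun x => f.1 (-x))
      ((fderiv ℝ f.1 (-x)).comp (-ContinuousLinearMap.id ℝ _)) x :=
    (f.differentiable (-x)).hasFDerivAt.comp x (hasFDerivAt_id x).neg
  rw [h.fderiv]
  simp [pd_apply]

end SmoothFn

end SmoothAlgebra

noncomputable section BallIntegral

open SmoothFn
open scoped ContDiff

variable {n : ℕ}

/-- The centered open ball of squared radius `ρ`. -/
def sqBall (n : ℕ) (ρ : ℝ) : Set (EuclideanSpace ℝ (Fin n)) := {x | ‖x‖ ^ 2 < ρ}

theorem mem_sqBall {ρ : ℝ} {x : EuclideanSpace ℝ (Fin n)} : x ∈ sqBall n ρ ↔ ‖x‖ ^ 2 < ρ :=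
  Iff.of_eq mem_ofPred_eq

theorem sqBall_eq_ball (ρ : ℝ) : sqBall n ρ = Metric.ball 0 (√ρ) := by
  ext x
  rw [mem_sqBall, mem_ball_zero_iff, Real.lt_sqrt (norm_nonneg x)]

theorem isOpen_sqBall (ρ : ℝ) : IsOpen (sqBall n ρ) := by
  rw [sqBall_eq_ball]; exact Metric.isOpen_ball

theorem measurableSet_sqBall (ρ : ℝ) : MeasurableSet (sqBall n ρ) := (isOpen_sqBall ρ).measurableSet

theorem bump_pos_iff {ρ : ℝ} {x : EuclideanSpace ℝ (Fin n)} : 0 < bump ρ x ↔ x ∈ sqBall n ρ := by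
  rw [bump_apply, mem_sqBall]
  constructor <;> intro h <;> linarith

theorem integrableOn_rpow_const_sub {r a : ℝ} (ha : -1 < a) :
    IntegrableOn (fun y : ℝ => (r - y) ^ a) (Ioo 0 r) := by
  rcases le_or_gt r 0 with hr | hr
  · rw [Ioo_eq_empty (by linarith)]; exact integrableOn_empty
  have h := (intervalIntegral.intervalIntegrable_rpow' (a := 0) (b := r) ha).comp_sub_left r
  rw [sub_zero, sub_self] at h
  rw [← integrableOn_Ioc_iff_integrableOn_Ioo,
    ← intervalIntegrable_iff_integrableOn_Ioc_of_le hr.le]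
  exact h.symm

theorem integrableOn_bump_rpow {ρ a : ℝ} (ha : -1 < a) :
    IntegrableOn (fun x : EuclideanSpace ℝ (Fin n) => bump ρ x ^ a) (sqBall n ρ) := by
  rcases Nat.eq_zero_or_pos n with rfl | hn
  · have : (fun x : EuclideanSpace ℝ (Fin 0) => bump ρ x ^ a) = fun _ => bump (n := 0) ρ 0 ^ a := by
      funext x; rw [Subsingleton.elim x 0]
    rw [this, sqBall_eq_ball]
    exact integrableOn_const measure_ball_lt_top.ne
  rcases le_or_gt ρ 0 with hρ | hρ
  · have : sqBall n ρ = ∅ := by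
      rw [sqBall_eq_ball, Real.sqrt_eq_zero_of_nonpos hρ, Metric.ball_zero]
    rw [this]; exact integrableOn_empty
  have : Nonempty (Fin n) := ⟨⟨0, hn⟩⟩
  simp_rw [bump_apply]
  rw [sqBall_eq_ball]
  refine (integrableOn_fun_norm_addHaar (volume : Measure (EuclideanSpace ℝ (Fin n)))
    (f := fun y => ((ρ - y ^ 2) / 2) ^ a)).2 ?_
  have hr : 0 < √ρ := Real.sqrt_pos.2 hρ
  have h1 := (integrableOn_rpow_const_sub (r := √ρ) ha)
  rw [← integrableOn_Icc_iff_integrableOn_Ioo] at h1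
  have h2 : ContinuousOn (fun y : ℝ => y ^ (Module.finrank ℝ (EuclideanSpace ℝ (Fin n)) - 1) *
      ((√ρ + y) / 2) ^ a) (Icc 0 √ρ) := by
    refine ContinuousOn.mul (by fun_prop) (ContinuousOn.rpow_const (by fun_prop) ?_)
    intro y hy
    left
    have := hy.1
    positivity
  have h3 := (h1.mul_continuousOn h2 isCompact_Icc).mono_set Ioo_subset_Icc_self
  refine h3.congr_fun ?_ measurableSet_Ioo
  intro y hy
  have e : (ρ - y ^ 2) / 2 = (√ρ - y) * ((√ρ + y) / 2) := by
    have := Real.sq_sqrt hρ.le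
    linear_combination -this / 2
  simp only [smul_eq_mul]
  rw [e, Real.mul_rpow (by linarith [hy.2]) (by linarith [hy.1])]
  ring

/-- The measure with density `((ρ - |x|²) / 2) ^ a` on the ball of squared radius `ρ`. -/
def ballMeasure (n : ℕ) (ρ a : ℝ) : Measure (EuclideanSpace ℝ (Fin n)) :=
  (volume.restrict (sqBall n ρ)).withDensity fun x => ENNReal.ofReal (bump ρ x ^ a)

theorem measurable_bump_rpow (ρ a : ℝ) :
    Measurable fun x : EuclideanSpace ℝ (Fin n) => bump ρ x ^ a :=
  (bump ρ).continuous.measurable.pow_const a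

theorem isFiniteMeasure_ballMeasure {ρ a : ℝ} (ha : -1 < a) :
    IsFiniteMeasure (ballMeasure n ρ a) :=
  isFiniteMeasure_withDensity_ofReal (integrableOn_bump_rpow ha).2

theorem ae_ballMeasure_mem (ρ a : ℝ) : ∀ᵐ x ∂(ballMeasure n ρ a), x ∈ sqBall n ρ :=
  (withDensity_absolutelyContinuous _ _).ae_le (ae_restrict_mem (measurableSet_sqBall ρ))

theorem integral_ballMeasure (ρ a : ℝ) (f : EuclideanSpace ℝ (Fin n) → ℝ) :
    ∫ x, f x ∂(ballMeasure n ρ a) = ∫ x in sqBall n ρ, bump ρ x ^ a * f x := by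
  rw [ballMeasure, integral_withDensity_eq_integral_toReal_smul
    (measurable_bump_rpow ρ a).ennreal_ofReal (by simp)]
  refine setIntegral_congr_fun (measurableSet_sqBall ρ) ?_
  intro x hx
  have : 0 ≤ bump ρ x ^ a := Real.rpow_nonneg (bump_pos_iff.2 hx).le a
  simp only [smul_eq_mul]
  rw [ENNReal.toReal_ofReal this]

theorem integral_ballMeasure_add_one (ρ a : ℝ) (f : EuclideanSpace ℝ (Fin n) → ℝ) :
    ∫ x, f x ∂(ballMeasure n ρ (a + 1)) = ∫ x, bump ρ x * f x ∂(ballMeasure n ρ a) := by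
  rw [integral_ballMeasure, integral_ballMeasure]
  refine setIntegral_congr_fun (measurableSet_sqBall ρ) ?_
  intro x hx
  simp only
  rw [Real.rpow_add_one (bump_pos_iff.2 hx).ne']
  ring

theorem exists_bound_sqBall (ρ : ℝ) {f : EuclideanSpace ℝ (Fin n) → ℝ} (hf : Continuous f) :
    ∃ M, 0 < M ∧ ∀ x ∈ sqBall n ρ, |f x| ≤ M := by
  obtain ⟨M, hM⟩ :=
    (isCompact_closedBall (0 : EuclideanSpace ℝ (Fin n)) √ρ).exists_bound_of_continuousOn
    hf.continuousOn
  refine ⟨max M 1, by positivity, fun x hx => (hM x ?_).trans (le_max_left _ _)⟩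
  rw [sqBall_eq_ball] at hx
  exact Metric.ball_subset_closedBall hx

theorem integrable_ballMeasure {ρ a : ℝ} (ha : -1 < a) {f : EuclideanSpace ℝ (Fin n) → ℝ}
    (hf : Continuous f) : Integrable f (ballMeasure n ρ a) := by
  have := isFiniteMeasure_ballMeasure (n := n) (ρ := ρ) ha
  obtain ⟨M, -, hM⟩ := exists_bound_sqBall ρ hf
  refine Integrable.of_bound hf.aestronglyMeasurable M ?_
  filter_upwards [ae_ballMeasure_mem ρ a] with x hx using hM x hx

/-- Integration of smooth functions against `ballMeasure`. -/
def ballInt (ρ a : ℝ) (ha : -1 < a) : SmoothFn n →ₗ[ℝ] ℝ where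
  toFun f := ∫ x, f x ∂(ballMeasure n ρ a)
  map_add' f g := integral_add (integrable_ballMeasure ha f.continuous)
    (integrable_ballMeasure ha g.continuous)
  map_smul' c _ := integral_const_mul c _

theorem ballInt_apply (ρ a : ℝ) (ha : -1 < a) (f : SmoothFn n) :
    ballInt ρ a ha f = ∫ x, f x ∂(ballMeasure n ρ a) := rfl

theorem ballInt_C_mul {ρ a : ℝ} (ha : -1 < a) (c : ℝ) (f : SmoothFn n) :
    ballInt ρ a ha (C c * f) = c * ballInt ρ a ha f := by
  rw [C_mul_eq_smul, map_smul, smul_eq_mul]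

theorem ballInt_bump_mul {ρ a : ℝ} (ha : -1 < a) (f : SmoothFn n) :
    ballInt ρ a ha (bump ρ * f) = ballInt ρ (a + 1) (by linarith) f :=
  (integral_ballMeasure_add_one ρ a f).symm

theorem ballInt_mono {ρ a : ℝ} (ha : -1 < a) {f g : SmoothFn n}
    (h : ∀ x ∈ sqBall n ρ, f x ≤ g x) : ballInt ρ a ha f ≤ ballInt ρ a ha g :=
  integral_mono_ae (integrable_ballMeasure ha f.continuous) (integrable_ballMeasure ha g.continuous)
    (by filter_upwards [ae_ballMeasure_mem ρ a] with x hx using h x hx)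

theorem ballInt_nonneg {ρ a : ℝ} (ha : -1 < a) {f : SmoothFn n}
    (h : ∀ x ∈ sqBall n ρ, 0 ≤ f x) : 0 ≤ ballInt ρ a ha f := by
  rw [← map_zero (ballInt (n := n) ρ a ha)]
  exact ballInt_mono ha h

theorem abs_ballInt_mul_le {ρ a : ℝ} (ha : -1 < a) (f g : SmoothFn n) :
    (ballInt ρ a ha (f * g)) ^ 2 ≤ ballInt ρ a ha (f ^ 2) * ballInt ρ a ha (g ^ 2) := by
  have h : ∀ t : ℝ, 0 ≤ ballInt ρ a ha (f ^ 2) * (t * t) + (2 * ballInt ρ a ha (f * g)) * t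
      + ballInt ρ a ha (g ^ 2) := by
    intro t
    have h1 : 0 ≤ ballInt ρ a ha ((C t * f + g) ^ 2) :=
      ballInt_nonneg ha fun x _ => by simp only [pow_apply]; positivity
    have h2 : (C t * f + g) ^ 2 = C t * (C t * f ^ 2) + C t * (f * g) + C t * (f * g) + g ^ 2 := by
      ring
    rw [h2] at h1
    simp only [map_add, ballInt_C_mul] at h1
    linarith
  have := discrim_le_zero h
  rw [discrim] at this
  nlinarith

theorem ballInt_reflect {ρ a : ℝ} (ha : -1 < a) (f : SmoothFn n) :
    ballInt ρ a ha (reflect f) = ballInt ρ a ha f := by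
  simp only [ballInt_apply, integral_ballMeasure, reflect_apply]
  rw [← integral_indicator (measurableSet_sqBall ρ), ← integral_indicator (measurableSet_sqBall ρ),
    ← integral_neg_eq_self]
  congr 1
  funext x
  by_cases hx : x ∈ sqBall n ρ
  · have hx' : -x ∈ sqBall n ρ := by rw [mem_sqBall] at *; simpa using hx
    rw [indicator_of_mem hx, indicator_of_mem hx', neg_neg, bump_apply, bump_apply, norm_neg]
  · have hx' : -x ∉ sqBall n ρ := by rw [mem_sqBall] at *; simpa using hx
    rw [indicator_of_notMem hx, indicator_of_notMem hx']

end BallIntegral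

noncomputable section IntegrationByParts

open SmoothFn Filter Topology
open scoped ContDiff

variable {n : ℕ}

theorem hasDerivAt_max_zero_rpow {b : ℝ} (hb : 1 < b) (y : ℝ) :
    HasDerivAt (fun y : ℝ => max y 0 ^ b) (b * max y 0 ^ (b - 1)) y := by
  rcases lt_trichotomy y 0 with hy | rfl | hy
  · have h : (fun y : ℝ => max y 0 ^ b) =ᶠ[𝓝 y] fun _ => 0 := by
      filter_upwards [Iio_mem_nhds hy] with z hz
      rw [max_eq_right (le_of_lt hz), Real.zero_rpow (by linarith)]
    rw [max_eq_right hy.le, Real.zero_rpow (by linarith), mul_zero]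
    exact (hasDerivAt_const y 0).congr_of_eventuallyEq h
  · rw [max_self, Real.zero_rpow (by linarith), mul_zero]
    have h1 : HasDerivAt (fun y : ℝ => |y| ^ b) 0 0 :=
      (hasDerivAt_abs_rpow 0 hb).congr_deriv (by simp)
    have hb0 : b ≠ 0 := by linarith
    rw [hasDerivAt_iff_isLittleO] at h1 ⊢
    simp only [abs_zero, max_self, Real.zero_rpow hb0, sub_zero, smul_zero] at h1 ⊢
    refine (Asymptotics.IsBigO.of_bound 1 (Eventually.of_forall fun z => ?_)).trans_isLittleO h1
    rw [Real.norm_of_nonneg (by positivity), Real.norm_of_nonneg (by positivity), one_mul]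
    exact Real.rpow_le_rpow (le_max_right _ _) (max_le (le_abs_self z) (abs_nonneg z)) (by linarith)
  · have h : (fun y : ℝ => max y 0 ^ b) =ᶠ[𝓝 y] fun y => y ^ b := by
      filter_upwards [Ioi_mem_nhds hy] with z hz
      rw [max_eq_left (le_of_lt hz)]
    rw [max_eq_left hy.le]
    exact (Real.hasDerivAt_rpow_const (Or.inl hy.ne')).congr_of_eventuallyEq h

/-- A `C¹` regularization of `y ↦ max y 0 ^ a`. -/
def regPow (a ε y : ℝ) : ℝ := max y 0 ^ (a + 2) / (y ^ 2 + ε)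

/-- The derivative of `regPow`. -/
def regPowDeriv (a ε y : ℝ) : ℝ :=
  ((a + 2) * max y 0 ^ (a + 1) * (y ^ 2 + ε) - max y 0 ^ (a + 2) * (2 * y)) / (y ^ 2 + ε) ^ 2

theorem hasDerivAt_regPow {a ε : ℝ} (ha : 0 < a) (hε : 0 < ε) (y : ℝ) :
    HasDerivAt (regPow a ε) (regPowDeriv a ε y) y := by
  have h1 := hasDerivAt_max_zero_rpow (b := a + 2) (by linarith) y
  have h2 : HasDerivAt (fun y : ℝ => y ^ 2 + ε) (2 * y) y := by
    simpa using (hasDerivAt_pow 2 y).add_const ε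
  have h3 := h1.div h2 (by positivity)
  rw [show a + 2 - 1 = a + 1 by ring] at h3
  exact h3

theorem continuous_regPowDeriv {a ε : ℝ} (ha : 0 < a) (hε : 0 < ε) :
    Continuous (regPowDeriv a ε) := by
  have h : ∀ b : ℝ, 0 ≤ b → Continuous fun y : ℝ => max y 0 ^ b := fun b hb =>
    (continuous_id.max continuous_const).rpow_const fun _ => Or.inr hb
  have h1 := h (a + 1) (by linarith)
  have h2 := h (a + 2) (by linarith)
  unfold regPowDeriv
  exact Continuous.div (by fun_prop) (by fun_prop) fun y => by positivity

theorem regPow_of_nonpos {a ε y : ℝ} (ha : 0 < a) (hy : y ≤ 0) : regPow a ε y = 0 := by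
  rw [regPow, max_eq_right hy, Real.zero_rpow (by linarith), zero_div]

theorem regPowDeriv_of_nonpos {a ε y : ℝ} (ha : 0 < a) (hy : y ≤ 0) : regPowDeriv a ε y = 0 := by
  rw [regPowDeriv, max_eq_right hy, Real.zero_rpow (by linarith), Real.zero_rpow (by linarith)]
  simp

theorem regPow_eq {a ε y : ℝ} (hy : 0 < y) :
    regPow a ε y = y ^ a * (y ^ 2 / (y ^ 2 + ε)) := by
  rw [regPow, max_eq_left hy.le, Real.rpow_add hy, Real.rpow_two]; ring

theorem regPowDeriv_eq {a ε y : ℝ} (hy : 0 < y) (hε : 0 ≤ ε) :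
    regPowDeriv a ε y = y ^ (a - 1) *
      ((a + 2) * (y ^ 2 / (y ^ 2 + ε)) - 2 * (y ^ 2 / (y ^ 2 + ε)) ^ 2) := by
  have e1 : y ^ (a + 1) = y ^ (a - 1) * y ^ 2 := by
    rw [← Real.rpow_two, ← Real.rpow_add hy]; congr 1; ring
  have e2 : y ^ (a + 2) = y ^ (a - 1) * y ^ 3 := by
    rw [show y ^ 3 = y ^ (3 : ℝ) by norm_cast, ← Real.rpow_add hy]; congr 1; ring
  rw [regPowDeriv, max_eq_left hy.le, e1, e2]
  have : y ^ 2 + ε ≠ 0 := by positivity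
  field_simp

theorem integral_regPow_mul_pd {ρ a ε : ℝ} (ha : 0 < a) (hε : 0 < ε) (f : SmoothFn n) (i : Fin n) :
    ∫ x in sqBall n ρ, regPow a ε (bump ρ x) * pd i f x =
      ∫ x in sqBall n ρ, regPowDeriv a ε (bump ρ x) * (X i * f) x := by
  have hout : ∀ x, x ∉ sqBall n ρ → bump ρ x ≤ 0 := fun x hx => by
    rw [← bump_pos_iff] at hx; exact not_lt.1 hx
  have hd : ∀ x : EuclideanSpace ℝ (Fin n), HasFDerivAt (fun x => regPow a ε (bump ρ x))
      (regPowDeriv a ε (bump ρ x) • fderiv ℝ (bump ρ).1 x) x := fun x =>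
    (hasDerivAt_regPow ha hε _).comp_hasFDerivAt x ((bump ρ).differentiable x).hasFDerivAt
  have hc : Continuous fun x => regPow a ε (bump (n := n) ρ x) :=
    continuous_iff_continuousAt.2 fun x => (hd x).continuousAt
  have hc' : Continuous fun x => regPowDeriv a ε (bump (n := n) ρ x) :=
    (continuous_regPowDeriv ha hε).comp (bump ρ).continuous
  have hfd : ∀ x, fderiv ℝ (fun x => regPow a ε (bump ρ x)) x (EuclideanSpace.single i 1) =
      regPowDeriv a ε (bump ρ x) * (- x i) := fun x => by
    rw [(hd x).fderiv, _root_.smul_apply, ← pd_apply, pd_bump]; rfl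
  have hsupp : ∀ g : EuclideanSpace ℝ (Fin n) → ℝ, Continuous g → (∀ x ∉ sqBall n ρ, g x = 0) →
      Integrable g := fun g hg h0 => by
    refine hg.integrable_of_hasCompactSupport
      (HasCompactSupport.intro (isCompact_closedBall 0 √ρ) fun x hx => h0 x fun h => hx ?_)
    rw [sqBall_eq_ball] at h
    exact Metric.ball_subset_closedBall h
  have h := integral_mul_fderiv_eq_neg_fderiv_mul_of_integrable (μ := volume)
    (f := fun x => regPow a ε (bump ρ x)) (g := f.1) (v := EuclideanSpace.single i 1)
    (hsupp _ (by
        simp_rw [hfd]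
        exact (hc'.mul (X i).continuous.neg).mul f.continuous)
      fun x hx => by rw [hfd, regPowDeriv_of_nonpos ha (hout x hx)]; simp)
    (hsupp _ (hc.mul (pd i f).continuous)
      fun x hx => by rw [regPow_of_nonpos ha (hout x hx)]; simp)
    (hsupp _ (hc.mul f.continuous)
      fun x hx => by rw [regPow_of_nonpos ha (hout x hx)]; simp)
    (fun x _ => (hd x).differentiableAt) (fun x _ => f.differentiable x)
  rw [setIntegral_eq_integral_of_forall_compl_eq_zero
      fun x hx => by rw [regPow_of_nonpos ha (hout x hx)]; simp,
    setIntegral_eq_integral_of_forall_compl_eq_zero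
      fun x hx => by rw [regPowDeriv_of_nonpos ha (hout x hx)]; simp]
  simp_rw [hfd] at h
  refine h.trans ?_
  rw [← integral_neg]
  congr 1
  funext x
  simp; ring

theorem tendsto_sq_div_sq_add {y : ℝ} (hy : 0 < y) :
    Tendsto (fun k : ℕ => y ^ 2 / (y ^ 2 + 1 / ((k : ℝ) + 1))) atTop (𝓝 1) := by
  have h1 : Tendsto (fun k : ℕ => y ^ 2 + 1 / ((k : ℝ) + 1)) atTop (𝓝 (y ^ 2)) := by
    simpa using (tendsto_const_nhds (x := y ^ 2)).add tendsto_one_div_add_atTop_nhds_zero_nat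
  have h2 := (tendsto_const_nhds (x := y ^ 2)).div h1 (by positivity)
  rwa [div_self (by positivity)] at h2

theorem ballInt_pd {ρ a : ℝ} (ha : 0 < a) (f : SmoothFn n) (i : Fin n) :
    ballInt ρ a (by linarith) (pd i f) = a * ballInt ρ (a - 1) (by linarith) (X i * f) := by
  have hq : ∀ (k : ℕ) (y : ℝ), 0 < y → 0 ≤ y ^ 2 / (y ^ 2 + 1 / ((k : ℝ) + 1)) ∧
      y ^ 2 / (y ^ 2 + 1 / ((k : ℝ) + 1)) ≤ 1 := fun k y hy => by
    have : (0 : ℝ) < 1 / ((k : ℝ) + 1) := by positivity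
    exact ⟨by positivity, (div_le_one (by positivity)).2 (by linarith)⟩
  have hint : ∀ b : ℝ, -1 < b → ∀ g : SmoothFn n,
      IntegrableOn (fun x => bump ρ x ^ b * |g x|) (sqBall n ρ) := fun b hb g => by
    obtain ⟨M, -, hM⟩ := exists_bound_sqBall ρ g.continuous
    refine Integrable.mul_bdd (c := M) (integrableOn_bump_rpow hb)
      g.continuous.abs.aestronglyMeasurable ?_
    filter_upwards [ae_restrict_mem (measurableSet_sqBall ρ)] with x hx
    simpa using hM x hx
  have hin : ∀ᵐ x ∂(volume.restrict (sqBall n ρ)), 0 < bump ρ x := by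
    filter_upwards [ae_restrict_mem (measurableSet_sqBall ρ)] with x hx using bump_pos_iff.2 hx
  have hmeas : ∀ (g : ℝ → ℝ), Measurable g → ∀ h : SmoothFn n,
      AEStronglyMeasurable (fun x => g (bump ρ x) * h x) (volume.restrict (sqBall n ρ)) :=
    fun g hg h => ((hg.comp (bump ρ).continuous.measurable).mul
      h.continuous.measurable).aestronglyMeasurable
  have hL : Tendsto (fun k : ℕ => ∫ x in sqBall n ρ,
      regPow a (1 / ((k : ℝ) + 1)) (bump ρ x) * pd i f x) atTop
      (𝓝 (∫ x in sqBall n ρ, bump ρ x ^ a * pd i f x)) := by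
    refine tendsto_integral_of_dominated_convergence (fun x => bump ρ x ^ a * |pd i f x|) ?_
      (hint a (by linarith) _) ?_ ?_
    · intro k
      refine hmeas _ (Continuous.measurable ?_) _
      exact continuous_iff_continuousAt.2 fun y =>
        (hasDerivAt_regPow ha (by positivity) y).continuousAt
    · intro k
      filter_upwards [hin] with x hx
      rw [norm_mul, Real.norm_eq_abs, Real.norm_eq_abs, regPow_eq hx, abs_mul,
        abs_of_nonneg (hq k _ hx).1, abs_of_nonneg (Real.rpow_nonneg hx.le a)]
      have := (hq k _ hx).2
      have h0 : 0 ≤ bump ρ x ^ a := Real.rpow_nonneg hx.le a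
      gcongr
      exact mul_le_of_le_one_right h0 this
    · filter_upwards [hin] with x hx
      simp_rw [regPow_eq hx]
      have := ((tendsto_sq_div_sq_add hx).const_mul (bump ρ x ^ a)).mul_const (pd i f x)
      simpa using this
  have hR : Tendsto (fun k : ℕ => ∫ x in sqBall n ρ,
      regPowDeriv a (1 / ((k : ℝ) + 1)) (bump ρ x) * (X i * f) x) atTop
      (𝓝 (∫ x in sqBall n ρ, a * (bump ρ x ^ (a - 1) * (X i * f) x))) := by
    refine tendsto_integral_of_dominated_convergence
      (fun x => (a + 4) * (bump ρ x ^ (a - 1) * |(X i * f) x|)) ?_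
      ((hint (a - 1) (by linarith) _).const_mul _) ?_ ?_
    · intro k
      exact hmeas _ (continuous_regPowDeriv ha (by positivity)).measurable _
    · intro k
      filter_upwards [hin] with x hx
      rw [norm_mul, Real.norm_eq_abs, Real.norm_eq_abs, regPowDeriv_eq hx (by positivity), abs_mul,
        abs_of_nonneg (Real.rpow_nonneg hx.le _)]
      obtain ⟨h1, h2⟩ := hq k _ hx
      have h0 : 0 ≤ bump ρ x ^ (a - 1) := Real.rpow_nonneg hx.le _
      set q := bump ρ x ^ 2 / (bump ρ x ^ 2 + 1 / ((k : ℝ) + 1))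
      have h3 : |(a + 2) * q - 2 * q ^ 2| ≤ a + 4 := by
        rw [abs_le]; constructor <;> nlinarith
      calc _ = |(a + 2) * q - 2 * q ^ 2| * (bump ρ x ^ (a - 1) * |(X i * f) x|) := by ring
        _ ≤ _ := by gcongr
    · filter_upwards [hin] with x hx
      have h1 := tendsto_sq_div_sq_add hx
      have h2 := (((h1.const_mul (a + 2)).sub ((h1.pow 2).const_mul 2)).const_mul
        (bump ρ x ^ (a - 1))).mul_const ((X i * f) x)
      have h3 := h2.congr fun k => by rw [← regPowDeriv_eq hx (by positivity)]
      convert h3 using 2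
      ring
  have := tendsto_nhds_unique (hL.congr fun k => integral_regPow_mul_pd ha (by positivity) f i) hR
  rw [ballInt_apply, ballInt_apply, integral_ballMeasure, integral_ballMeasure, this,
    integral_const_mul]

end IntegrationByParts

noncomputable section WeightedOperator

open SmoothFn
open scoped ContDiff

variable {n : ℕ}

namespace SmoothFn

/-- The pointwise inner product of two gradients. -/
def gdot (f g : SmoothFn n) : SmoothFn n := ∑ i, pd i f * pd i g

/-- The Laplacian. -/
def lap (f : SmoothFn n) : SmoothFn n := ∑ i, pd i (pd i f)

/-- The derivative in the radial direction `x`. -/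
def euler (f : SmoothFn n) : SmoothFn n := ∑ i, X i * pd i f

/-- The quadratic form `⟨D²φ ∇u, ∇u⟩`. -/
def hessGrad (φ u : SmoothFn n) : SmoothFn n := ∑ j, ∑ i, pd j (pd i φ) * pd i u * pd j u

/-- The squared Hilbert–Schmidt norm of the Hessian. -/
def hessSq (u : SmoothFn n) : SmoothFn n := ∑ j, gdot (pd j u) (pd j u)

/-- The function `∑ ∂ⱼu ⟨x, ∇∂ⱼu⟩`. -/
def gradEuler (u : SmoothFn n) : SmoothFn n := ∑ j, pd j u * euler (pd j u)

/-- The drift Laplacian `Δu - ⟨∇φ, ∇u⟩`. -/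
def drift (φ u : SmoothFn n) : SmoothFn n := lap u - gdot φ u

/-- The degenerate elliptic operator `v (Δu - ⟨∇φ, ∇u⟩) - s ⟨x, ∇u⟩` with `v = bump ρ`. -/
def degOp (ρ s : ℝ) (φ u : SmoothFn n) : SmoothFn n := bump ρ * drift φ u - C s * euler u

/-- Nonnegativity of the Hessian. -/
def HessNonneg (φ : SmoothFn n) : Prop :=
  ∀ x (ξ : Fin n → ℝ), 0 ≤ ∑ j, ∑ i, pd j (pd i φ) x * ξ i * ξ j

theorem gdot_mul_left (f g h : SmoothFn n) : gdot (f * g) h = f * gdot g h + g * gdot f h := by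
  simp only [gdot, pd_mul, Finset.mul_sum, ← Finset.sum_add_distrib]
  exact Finset.sum_congr rfl fun i _ => by ring

theorem gdot_comm (f g : SmoothFn n) : gdot f g = gdot g f := by
  simp only [gdot, mul_comm]

theorem gdot_add_left (f g h : SmoothFn n) : gdot (f + g) h = gdot f h + gdot g h := by
  simp only [gdot, map_add, add_mul, Finset.sum_add_distrib]

theorem gdot_sub_left (f g h : SmoothFn n) : gdot (f - g) h = gdot f h - gdot g h := by
  simp only [gdot, map_sub, sub_mul, Finset.sum_sub_distrib]

theorem gdot_add_right (f g h : SmoothFn n) : gdot f (g + h) = gdot f g + gdot f h := by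
  rw [gdot_comm, gdot_add_left, gdot_comm g, gdot_comm h]

theorem gdot_sub_right (f g h : SmoothFn n) : gdot f (g - h) = gdot f g - gdot f h := by
  rw [gdot_comm, gdot_sub_left, gdot_comm g, gdot_comm h]

theorem gdot_self_apply (f : SmoothFn n) (x) : gdot f f x = ∑ i, pd i f x ^ 2 := by
  simp [gdot, pow_two]

theorem gdot_self_nonneg (f : SmoothFn n) (x) : 0 ≤ gdot f f x := by
  rw [gdot_self_apply]; positivity

theorem gdot_apply_sq_le (f g : SmoothFn n) (x) : gdot f g x ^ 2 ≤ gdot f f x * gdot g g x := by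
  rw [gdot_self_apply, gdot_self_apply]
  simp only [gdot, sum_apply, mul_apply]
  exact Finset.sum_mul_sq_le_sq_mul_sq _ _ _

theorem gdot_bump_left (ρ : ℝ) (f : SmoothFn n) : gdot (bump ρ) f = - euler f := by
  simp only [gdot, pd_bump, euler]
  rw [← Finset.sum_neg_distrib]
  exact Finset.sum_congr rfl fun i _ => by ring

theorem pd_euler (j : Fin n) (f : SmoothFn n) : pd j (euler f) = pd j f + euler (pd j f) := by
  simp only [euler, map_sum, pd_mul, pd_X, Finset.sum_add_distrib, mul_ite, mul_one, mul_zero,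
    Finset.sum_ite_eq, Finset.mem_univ, if_true]
  rw [add_comm]
  congr 1
  exact Finset.sum_congr rfl fun i _ => by rw [pd_comm]

theorem gdot_euler_self (f : SmoothFn n) : gdot (euler f) f = gdot f f + gradEuler f := by
  simp only [gradEuler, gdot, pd_euler, add_mul, Finset.sum_add_distrib]
  congr 1
  exact Finset.sum_congr rfl fun i _ => by ring

theorem pd_drift (j : Fin n) (φ u : SmoothFn n) :
    pd j (drift φ u) = drift φ (pd j u) - ∑ i, pd j (pd i φ) * pd i u := by
  have h1 : pd j (lap u) = lap (pd j u) := by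
    simp only [lap, map_sum]
    exact Finset.sum_congr rfl fun i _ => by rw [pd_comm j i, pd_comm j i]
  have h2 : pd j (gdot φ u) = gdot φ (pd j u) + ∑ i, pd j (pd i φ) * pd i u := by
    simp only [gdot, map_sum, pd_mul, ← Finset.sum_add_distrib]
    exact Finset.sum_congr rfl fun i _ => by rw [pd_comm j i u]; ring
  rw [drift, map_sub, h1, h2, drift]; ring

theorem gdot_drift_self (φ u : SmoothFn n) :
    gdot (drift φ u) u = ∑ j, pd j u * drift φ (pd j u) - hessGrad φ u := by
  simp only [gdot, hessGrad, pd_drift, ← Finset.sum_sub_distrib, sub_mul, Finset.sum_mul]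
  exact Finset.sum_congr rfl fun i _ => by ring

end SmoothFn

/-- Integration against the measure with density `v ^ a * exp (-φ)`, with `v = bump ρ`. -/
def wInt (ρ a : ℝ) (ha : -1 < a) (φ : SmoothFn n) : SmoothFn n →ₗ[ℝ] ℝ :=
  (ballInt ρ a ha).comp (LinearMap.mulRight ℝ (SmoothFn.exp (-φ)))

theorem wInt_apply {ρ a : ℝ} (ha : -1 < a) (φ f : SmoothFn n) :
    wInt ρ a ha φ f = ballInt ρ a ha (f * SmoothFn.exp (-φ)) := rfl

theorem wInt_C_mul {ρ a : ℝ} (ha : -1 < a) (φ : SmoothFn n) (c : ℝ) (f : SmoothFn n) :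
    wInt ρ a ha φ (C c * f) = c * wInt ρ a ha φ f := by
  rw [C_mul_eq_smul, map_smul, smul_eq_mul]

theorem wInt_bump_mul {ρ a : ℝ} (ha : -1 < a) (φ f : SmoothFn n) :
    wInt ρ a ha φ (bump ρ * f) = wInt ρ (a + 1) (by linarith) φ f := by
  rw [wInt_apply, wInt_apply, mul_assoc, ballInt_bump_mul]

theorem wInt_mono {ρ a : ℝ} (ha : -1 < a) (φ : SmoothFn n) {f g : SmoothFn n}
    (h : ∀ x ∈ sqBall n ρ, f x ≤ g x) : wInt ρ a ha φ f ≤ wInt ρ a ha φ g :=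
  ballInt_mono ha fun x hx => mul_le_mul_of_nonneg_right (h x hx) (Real.exp_nonneg _)

theorem wInt_nonneg {ρ a : ℝ} (ha : -1 < a) (φ : SmoothFn n) {f : SmoothFn n}
    (h : ∀ x ∈ sqBall n ρ, 0 ≤ f x) : 0 ≤ wInt ρ a ha φ f := by
  rw [← map_zero (wInt (n := n) ρ a ha φ)]
  exact wInt_mono ha φ h

theorem wInt_bump_mul_pd {ρ a : ℝ} (ha : -1 < a) (φ f : SmoothFn n) (i : Fin n) :
    wInt ρ a ha φ (bump ρ * pd i f) =
      (a + 1) * wInt ρ a ha φ (X i * f) + wInt ρ a ha φ (bump ρ * (pd i φ * f)) := by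
  have h := ballInt_pd (ρ := ρ) (a := a + 1) (by linarith) (f * SmoothFn.exp (-φ)) i
  have e : a + 1 - 1 = a := by ring
  simp only [e, pd_mul, pd_exp, map_neg] at h
  rw [wInt_bump_mul, wInt_bump_mul, wInt_apply, wInt_apply, wInt_apply, mul_assoc, ← h, ← map_add]
  congr 1; ring

/-- Green's formula for `degOp`. -/
theorem wInt_mul_degOp {ρ s a : ℝ} (ha : -1 < a) (hs : s = a + 1) (φ g u : SmoothFn n) :
    wInt ρ a ha φ (g * degOp ρ s φ u) = - wInt ρ a ha φ (bump ρ * gdot g u) := by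
  have h : g * degOp ρ s φ u = ∑ i, (bump ρ * pd i (g * pd i u) - C s * (X i * (g * pd i u))
      - bump ρ * (pd i φ * (g * pd i u))) - bump ρ * gdot g u := by
    simp only [degOp, drift, lap, gdot, euler, pd_mul, Finset.mul_sum, ← Finset.sum_sub_distrib]
    exact Finset.sum_congr rfl fun i _ => by ring
  rw [h, map_sub, map_sum, Finset.sum_eq_zero, zero_sub]
  intro i _
  rw [map_sub, map_sub, wInt_C_mul, wInt_bump_mul_pd, hs]
  ring

theorem gdot_degOp_self (ρ s : ℝ) (φ u : SmoothFn n) :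
    bump ρ * gdot (degOp ρ s φ u) u =
      ∑ j, (bump ρ * pd j u) * degOp ρ s φ (pd j u) - euler u * (degOp ρ s φ u + C s * euler u)
        - C s * (bump ρ * gdot u u) - bump ρ ^ 2 * hessGrad φ u := by
  have h1 : gdot (degOp ρ s φ u) u = bump ρ * gdot (drift φ u) u - drift φ u * euler u
      - C s * (gdot u u + gradEuler u) := by
    rw [degOp, gdot_sub_left, gdot_mul_left, gdot_mul_left, gdot_bump_left, gdot_euler_self]
    have : gdot (C s) u = 0 := by simp [gdot]
    rw [this]; ring
  have h2 : ∑ j, (bump ρ * pd j u) * degOp ρ s φ (pd j u) =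
      bump ρ ^ 2 * ∑ j, pd j u * drift φ (pd j u) - bump ρ * (C s * gradEuler u) := by
    simp only [degOp, gradEuler, Finset.mul_sum, ← Finset.sum_sub_distrib]
    exact Finset.sum_congr rfl fun i _ => by ring
  rw [h1, h2, gdot_drift_self, degOp]
  ring

theorem wInt_sum_bump_pd_mul_degOp {ρ s a : ℝ} (ha : -1 < a) (hs : s = a + 1) (φ u : SmoothFn n) :
    wInt ρ a ha φ (∑ j, (bump ρ * pd j u) * degOp ρ s φ (pd j u)) =
      wInt ρ a ha φ (bump ρ * gradEuler u) - wInt ρ a ha φ (bump ρ ^ 2 * hessSq u) := by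
  have : ∀ j, bump ρ * gdot (bump ρ * pd j u) (pd j u) =
      bump ρ ^ 2 * gdot (pd j u) (pd j u) - bump ρ * (pd j u * euler (pd j u)) := fun j => by
    rw [gdot_mul_left, gdot_bump_left]; ring
  rw [map_sum]
  simp only [wInt_mul_degOp ha hs, this, map_sub, gradEuler, hessSq, Finset.mul_sum, map_sum,
    Finset.sum_neg_distrib, Finset.sum_sub_distrib]
  ring

theorem wInt_degOp_sq {ρ s a : ℝ} (ha : -1 < a) (hs : s = a + 1) (φ u : SmoothFn n) :
    wInt ρ a ha φ (degOp ρ s φ u ^ 2) = wInt ρ a ha φ (bump ρ ^ 2 * hessSq u)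
      + 2 * wInt ρ a ha φ (euler u * degOp ρ s φ u) + s * wInt ρ a ha φ (euler u ^ 2)
      + (1 + s) * wInt ρ a ha φ (bump ρ * gdot u u)
      + wInt ρ a ha φ (bump ρ ^ 2 * hessGrad φ u) := by
  have h1 := wInt_mul_degOp (ρ := ρ) ha hs φ (degOp ρ s φ u) u
  have h2 := wInt_mul_degOp (ρ := ρ) ha hs φ (euler u) u
  have h3 := wInt_sum_bump_pd_mul_degOp (ρ := ρ) ha hs φ u
  have e : euler u * (degOp ρ s φ u + C s * euler u) =
      euler u * degOp ρ s φ u + C s * euler u ^ 2 := by ring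
  rw [gdot_degOp_self, map_sub, map_sub, map_sub, h3, e, map_add, wInt_C_mul, wInt_C_mul,
    ← pow_two] at h1
  rw [gdot_euler_self, mul_add, map_add] at h2
  rw [h1]
  linear_combination -h2

theorem wInt_gdot_le_degOp_sq {ρ s a : ℝ} (ha : -1 < a) (hs : s = a + 1) {φ : SmoothFn n}
    (hφ : HessNonneg φ) (u : SmoothFn n) :
    s * wInt ρ a ha φ (bump ρ * gdot u u) ≤ wInt ρ a ha φ (degOp ρ s φ u ^ 2) := by
  have hs0 : 0 < s := by linarith
  have h := wInt_degOp_sq (ρ := ρ) ha hs φ u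
  have h1 : 0 ≤ wInt ρ a ha φ (bump ρ ^ 2 * hessSq u) := wInt_nonneg ha φ fun x _ => by
    simp only [mul_apply, pow_apply, hessSq, sum_apply]
    exact mul_nonneg (sq_nonneg _) (Finset.sum_nonneg fun j _ => gdot_self_nonneg _ x)
  have h2 : 0 ≤ wInt ρ a ha φ (bump ρ ^ 2 * hessGrad φ u) := wInt_nonneg ha φ fun x _ => by
    simp only [mul_apply, pow_apply, hessGrad, sum_apply]
    exact mul_nonneg (sq_nonneg _) (hφ x fun i => pd i u x)
  have h3 : 0 ≤ wInt ρ a ha φ ((degOp ρ s φ u + C s * euler u) ^ 2) :=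
    wInt_nonneg ha φ fun x _ => by
    simp only [pow_apply]; positivity
  have e : (degOp ρ s φ u + C s * euler u) ^ 2 = degOp ρ s φ u ^ 2
      + C s * (euler u * degOp ρ s φ u) + C s * (euler u * degOp ρ s φ u)
      + C s * (C s * euler u ^ 2) := by ring
  rw [e] at h3
  simp only [map_add, wInt_C_mul] at h3
  refine le_of_mul_le_mul_left ?_ (show 0 < 1 + s by linarith)
  nlinarith

/-- The Bochner formula for the weight `v ^ 2 * exp (-φ)`. -/
theorem wInt_zero_degOp_two_sq (ρ : ℝ) (φ u : SmoothFn n) :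
    wInt ρ 0 (by norm_num) φ (degOp ρ 2 φ u ^ 2) =
      wInt ρ 0 (by norm_num) φ (bump ρ ^ 2 * hessSq u)
      + 2 * wInt ρ 0 (by norm_num) φ (bump ρ * gdot u u)
      + 2 * wInt ρ 0 (by norm_num) φ (euler u ^ 2)
      + wInt ρ 0 (by norm_num) φ (bump ρ ^ 2 * hessGrad φ u) := by
  have ha : (-1 : ℝ) < 0 := by norm_num
  have ha1 : (-1 : ℝ) < 0 + 1 := by norm_num
  have hb : ∀ f : SmoothFn n, wInt ρ (0 + 1) ha1 φ f = wInt ρ 0 ha φ (bump ρ * f) :=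
    fun f => (wInt_bump_mul ha φ f).symm
  have two : ∀ f : SmoothFn n, wInt ρ 0 ha φ (2 * f) = 2 * wInt ρ 0 ha φ f := fun f =>
    wInt_C_mul ha φ 2 f
  have C1 : (C 1 : SmoothFn n) = 1 := rfl
  have C2 : (C 2 : SmoothFn n) = 2 := rfl
  have h1 := wInt_mul_degOp (ρ := ρ) (s := 2) ha1 (by norm_num) φ (drift φ u) u
  have h2 : wInt ρ (0 + 1) ha1 φ (∑ j, pd j u * degOp ρ 2 φ (pd j u)) =
      - wInt ρ (0 + 1) ha1 φ (bump ρ * hessSq u) := by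
    simp only [map_sum, wInt_mul_degOp ha1 (show (2 : ℝ) = 0 + 1 + 1 by norm_num), hessSq,
      Finset.mul_sum, Finset.sum_neg_distrib]
  have h3 := wInt_mul_degOp (ρ := ρ) (s := 1) ha (by norm_num) φ (euler u) u
  have e1 : bump ρ * ∑ j, pd j u * drift φ (pd j u) =
      ∑ j, pd j u * degOp ρ 2 φ (pd j u) + 2 * gradEuler u := by
    simp only [degOp, C2, gradEuler, Finset.mul_sum, ← Finset.sum_add_distrib]
    exact Finset.sum_congr rfl fun i _ => by ring
  have e2 : euler u * degOp ρ 1 φ u = bump ρ * (drift φ u * euler u) - euler u ^ 2 := by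
    rw [degOp, C1]; ring
  have e3 : degOp ρ 2 φ u ^ 2 = bump ρ * (drift φ u * degOp ρ 2 φ u)
      - 2 * (bump ρ * (drift φ u * euler u)) + 2 * (2 * euler u ^ 2) := by
    rw [degOp, C2]; ring
  have e4 : bump ρ * (2 * gradEuler u) = 2 * (bump ρ * gradEuler u) := by ring
  have e5 : bump ρ * (bump ρ * hessGrad φ u) = bump ρ ^ 2 * hessGrad φ u := by ring
  have e6 : bump ρ * (bump ρ * hessSq u) = bump ρ ^ 2 * hessSq u := by ring
  rw [gdot_drift_self, mul_sub, e1, map_sub, map_add, h2] at h1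
  simp only [hb, e4, e5, e6, two] at h1
  rw [e2, map_sub, gdot_euler_self, mul_add, map_add] at h3
  rw [e3, map_add, map_sub, two, two, two, h1]
  linear_combination (-2) * h3

end WeightedOperator

noncomputable section Polynomials

open SmoothFn
open scoped ContDiff

variable {n : ℕ}

/-- Polynomial functions of degree at most `d`. -/
def polyFn (n : ℕ) : ℕ → Submodule ℝ (SmoothFn n)
  | 0 => Submodule.span ℝ {1}
  | d + 1 => polyFn n d ⊔ ⨆ i, (polyFn n d).map (LinearMap.mulLeft ℝ (X i))

theorem finiteDimensional_polyFn (d : ℕ) : FiniteDimensional ℝ (polyFn n d) := by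
  induction d with
  | zero => exact FiniteDimensional.span_singleton ℝ _
  | succ d ih => rw [polyFn]; infer_instance

theorem polyFn_le_succ (d : ℕ) : polyFn n d ≤ polyFn n (d + 1) := by
  rw [polyFn]; exact le_sup_left

theorem polyFn_mono : Monotone (polyFn n) := monotone_nat_of_le_succ polyFn_le_succ

theorem X_mul_mem_polyFn {d : ℕ} {f : SmoothFn n} (hf : f ∈ polyFn n d) (i : Fin n) :
    X i * f ∈ polyFn n (d + 1) := by
  rw [polyFn]
  exact Submodule.mem_sup_right (Submodule.mem_iSup_of_mem i ⟨f, hf, rfl⟩)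

theorem C_mem_polyFn (c : ℝ) (d : ℕ) : C c ∈ polyFn n d := by
  refine polyFn_mono (Nat.zero_le d) ?_
  rw [polyFn, Submodule.mem_span_singleton]
  exact ⟨c, by ext x; simp⟩

theorem eq_C_of_mem_polyFn_zero {f : SmoothFn n} (hf : f ∈ polyFn n 0) : ∃ c, f = C c := by
  rw [polyFn, Submodule.mem_span_singleton] at hf
  obtain ⟨c, rfl⟩ := hf
  exact ⟨c, by ext x; simp⟩

theorem C_mul_mem_polyFn {d : ℕ} {f : SmoothFn n} (hf : f ∈ polyFn n d) (c : ℝ) :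
    C c * f ∈ polyFn n d := by
  rw [C_mul_eq_smul]; exact Submodule.smul_mem _ _ hf

theorem bump_mul_mem_polyFn {d : ℕ} {f : SmoothFn n} (hf : f ∈ polyFn n d) (ρ : ℝ) :
    bump ρ * f ∈ polyFn n (d + 2) := by
  rw [bump, mul_assoc, sub_mul, Finset.sum_mul]
  refine C_mul_mem_polyFn (Submodule.sub_mem _ ?_ (Submodule.sum_mem _ fun i _ => ?_)) _
  · exact polyFn_mono (by omega) (C_mul_mem_polyFn hf ρ)
  · rw [pow_two, mul_assoc]
    exact X_mul_mem_polyFn (X_mul_mem_polyFn hf i) i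

theorem polyFn_succ_le {d : ℕ} {Q : Submodule ℝ (SmoothFn n)} (h : polyFn n d ≤ Q)
    (hX : ∀ i, ∀ f ∈ polyFn n d, X i * f ∈ Q) : polyFn n (d + 1) ≤ Q := by
  rw [polyFn]
  refine sup_le h (iSup_le fun i => ?_)
  rintro _ ⟨f, hf, rfl⟩
  exact hX i f hf

theorem pd_mem_polyFn {d : ℕ} {f : SmoothFn n} (hf : f ∈ polyFn n (d + 1)) (j : Fin n) :
    pd j f ∈ polyFn n d := by
  induction d generalizing f with
  | zero =>
    have key : polyFn n (0 + 1) ≤ (polyFn n 0).comap (pd j).toLinearMap := by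
      refine polyFn_succ_le (fun g hg => ?_) (fun i g hg => ?_)
      · obtain ⟨c, rfl⟩ := eq_C_of_mem_polyFn_zero hg
        have : pd j (C c : SmoothFn n) ∈ polyFn n 0 := by rw [pd_C]; exact Submodule.zero_mem _
        exact this
      · obtain ⟨c, rfl⟩ := eq_C_of_mem_polyFn_zero hg
        have : pd j (X i * C c : SmoothFn n) ∈ polyFn n 0 := by
          rw [pd_mul, pd_C, mul_zero, zero_add, pd_X]
          split_ifs
          · rw [mul_one]; exact C_mem_polyFn _ _
          · rw [mul_zero]; exact Submodule.zero_mem _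
        exact this
    exact key hf
  | succ d ih =>
    have key : polyFn n (d + 1 + 1) ≤ (polyFn n (d + 1)).comap (pd j).toLinearMap := by
      refine polyFn_succ_le (fun g hg => polyFn_le_succ d (ih hg)) (fun i g hg => ?_)
      have : pd j (X i * g) ∈ polyFn n (d + 1) := by
        rw [pd_mul, pd_X]
        refine Submodule.add_mem _ (X_mul_mem_polyFn (ih hg) i) ?_
        split_ifs
        · rw [mul_one]; exact hg
        · rw [mul_zero]; exact Submodule.zero_mem _
      exact this
    exact key hf

theorem fderiv_apply_eq_sum (f : SmoothFn n) (x y : EuclideanSpace ℝ (Fin n)) :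
    fderiv ℝ f.1 x y = ∑ i, y i * pd i f x := by
  have hy : y = ∑ i, y i • EuclideanSpace.single i (1 : ℝ) := by
    ext j; simp [Finset.sum_apply, Pi.single_apply]
  conv_lhs => rw [hy]
  simp only [map_sum, map_smul, smul_eq_mul, pd_apply]

theorem eq_C_of_pd_eq_zero {f : SmoothFn n} (h : ∀ i, pd i f = 0) : f = C (f 0) := by
  have hd : ∀ x, fderiv ℝ f.1 x = 0 := fun x => by
    ext y; rw [fderiv_apply_eq_sum]; simp [h]
  ext x
  exact is_const_of_fderiv_eq_zero f.differentiable hd x 0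

theorem pd_eq_zero_on_sqBall {ρ : ℝ} {f : SmoothFn n} (h : ∀ x ∈ sqBall n ρ, f x = 0) (i : Fin n) :
    ∀ x ∈ sqBall n ρ, pd i f x = 0 := by
  intro x hx
  have : f.1 =ᶠ[nhds x] fun _ => 0 := by
    filter_upwards [(isOpen_sqBall ρ).mem_nhds hx] with y hy using h y hy
  rw [pd_apply, this.fderiv_eq]; simp

theorem zero_mem_sqBall {ρ : ℝ} (hρ : 0 < ρ) : (0 : EuclideanSpace ℝ (Fin n)) ∈ sqBall n ρ := by
  rw [mem_sqBall]; simpa using hρ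

theorem eq_zero_of_mem_polyFn {ρ : ℝ} (hρ : 0 < ρ) {d : ℕ} {f : SmoothFn n} (hf : f ∈ polyFn n d)
    (h : ∀ x ∈ sqBall n ρ, f x = 0) : f = 0 := by
  induction d generalizing f with
  | zero =>
    obtain ⟨c, rfl⟩ := eq_C_of_mem_polyFn_zero hf
    have : c = 0 := h 0 (zero_mem_sqBall hρ)
    ext x; simp [this]
  | succ d ih =>
    have h1 := eq_C_of_pd_eq_zero fun i => ih (pd_mem_polyFn hf i) (pd_eq_zero_on_sqBall h i)
    rw [h1, h 0 (zero_mem_sqBall hρ)]; ext x; simp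

theorem eq_zero_of_ballInt_eq_zero {ρ a : ℝ} (ha : -1 < a) {f : SmoothFn n}
    (hf : ∀ x ∈ sqBall n ρ, 0 ≤ f x) (h : ballInt ρ a ha f = 0) : ∀ x ∈ sqBall n ρ, f x = 0 := by
  have hpos : ∀ x ∈ sqBall n ρ, 0 < bump ρ x ^ a := fun x hx =>
    Real.rpow_pos_of_pos (bump_pos_iff.2 hx) a
  have hint : Integrable (fun x => bump ρ x ^ a * f x) (volume.restrict (sqBall n ρ)) := by
    obtain ⟨M, -, hM⟩ := exists_bound_sqBall ρ f.continuous
    refine Integrable.mul_bdd (c := M) (integrableOn_bump_rpow ha)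
      f.continuous.aestronglyMeasurable ?_
    filter_upwards [ae_restrict_mem (measurableSet_sqBall ρ)] with x hx using hM x hx
  rw [ballInt_apply, integral_ballMeasure, integral_eq_zero_iff_of_nonneg_ae _ hint] at h
  · have hc : ContinuousOn (fun x => bump ρ x ^ a * f x) (sqBall n ρ) :=
      ((bump ρ).continuous.continuousOn.rpow_const fun x hx =>
        Or.inl (bump_pos_iff.2 hx).ne').mul f.continuous.continuousOn
    have := Measure.eqOn_open_of_ae_eq h (isOpen_sqBall ρ) hc continuousOn_const
    intro x hx
    exact (mul_eq_zero.1 (this hx)).resolve_left (hpos x hx).ne'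
  · filter_upwards [ae_restrict_mem (measurableSet_sqBall ρ)] with x hx
    exact mul_nonneg (hpos x hx).le (hf x hx)

theorem ballInt_one_pos {ρ a : ℝ} (hρ : 0 < ρ) (ha : -1 < a) : 0 < ballInt (n := n) ρ a ha 1 := by
  have h0 : 0 ≤ ballInt (n := n) ρ a ha 1 := ballInt_nonneg ha fun x _ => by simp
  refine h0.lt_of_ne fun h => ?_
  have := eq_zero_of_ballInt_eq_zero ha (f := (1 : SmoothFn n)) (fun x _ => by simp) h.symm 0
    (zero_mem_sqBall hρ)
  simp at this

theorem wInt_zero_weight {ρ a : ℝ} (ha : -1 < a) (f : SmoothFn n) :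
    wInt ρ a ha 0 f = ballInt ρ a ha f := by
  rw [wInt_apply]; congr 1; ext x; simp

theorem hessNonneg_zero : HessNonneg (0 : SmoothFn n) := fun x ξ => by simp

/-- `degOp` as a linear map. -/
def degOpLin (ρ s : ℝ) (φ : SmoothFn n) : SmoothFn n →ₗ[ℝ] SmoothFn n where
  toFun := degOp ρ s φ
  map_add' f g := by
    simp only [degOp, drift, lap, gdot, euler, map_add, mul_add, Finset.sum_add_distrib]
    ring
  map_smul' c f := by
    have h : c • f = C c * f := (C_mul_eq_smul c f).symm
    rw [RingHom.id_apply, h, ← C_mul_eq_smul]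
    simp only [degOp, drift, lap, gdot, euler, pd_mul, pd_C, mul_zero, add_zero, Finset.mul_sum,
      ← Finset.sum_sub_distrib]
    exact Finset.sum_congr rfl fun i _ => by ring

theorem degOp_zero_mem_polyFn {d : ℕ} {f : SmoothFn n} (hf : f ∈ polyFn n (d + 2)) (ρ s : ℝ) :
    degOp ρ s 0 f ∈ polyFn n (d + 2) := by
  have : gdot 0 f = 0 := by simp [gdot]
  rw [degOp, drift, this, sub_zero]
  refine Submodule.sub_mem _ (bump_mul_mem_polyFn (Submodule.sum_mem _ fun i _ => ?_) ρ)
    (C_mul_mem_polyFn (Submodule.sum_mem _ fun i _ => ?_) s)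
  · exact pd_mem_polyFn (pd_mem_polyFn hf i) i
  · exact X_mul_mem_polyFn (pd_mem_polyFn hf i) i

theorem wInt_degOp {ρ s a : ℝ} (ha : -1 < a) (hs : s = a + 1) (φ u : SmoothFn n) :
    wInt ρ a ha φ (degOp ρ s φ u) = 0 := by
  have h := wInt_mul_degOp (ρ := ρ) ha hs φ 1 u
  have : gdot (1 : SmoothFn n) u = 0 := by simp [gdot]
  rw [one_mul, this, mul_zero, map_zero, neg_zero] at h
  exact h

theorem Submodule.exists_eq_of_injOn {V : Type*} [AddCommGroup V] [Module ℝ V]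
    (P : Submodule ℝ V) [FiniteDimensional ℝ P] (T : V →ₗ[ℝ] V) (hT : ∀ f ∈ P, T f ∈ P)
    (hinj : ∀ f ∈ P, T f = 0 → f = 0) {p : V} (hp : p ∈ P) : ∃ u ∈ P, T u = p := by
  have h : Function.Injective (T.restrict hT) := by
    rw [injective_iff_map_eq_zero]
    exact fun f hf => Subtype.ext (hinj f.1 f.2 (congrArg Subtype.val hf))
  obtain ⟨u, hu⟩ := LinearMap.injective_iff_surjective.1 h ⟨p, hp⟩
  exact ⟨u.1, u.2, congrArg Subtype.val hu⟩

theorem Submodule.exists_riesz {V : Type*} [AddCommGroup V] [Module ℝ V]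
    (P : Submodule ℝ V) [FiniteDimensional ℝ P] (B : V →ₗ[ℝ] V →ₗ[ℝ] ℝ)
    (hB : ∀ f ∈ P, B f f = 0 → f = 0) (L : V →ₗ[ℝ] ℝ) : ∃ q ∈ P, ∀ p ∈ P, B q p = L p := by
  let T : P →ₗ[ℝ] Module.Dual ℝ P := B.compl₁₂ P.subtype P.subtype
  have h : Function.Injective T := by
    rw [injective_iff_map_eq_zero]
    exact fun f hf => Subtype.ext (hB f.1 f.2 (congrArg (fun g => g f) hf))
  obtain ⟨q, hq⟩ := (LinearMap.injective_iff_surjective_of_finrank_eq_finrank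
    Subspace.dual_finrank_eq.symm).1 h (L.comp P.subtype)
  exact ⟨q.1, q.2, fun p hp => congrArg (fun f => f ⟨p, hp⟩) hq⟩

theorem exists_degOp_eq_of_mem_polyFn {ρ s a : ℝ} (hρ : 0 < ρ) (ha : -1 < a) (hs : s = a + 1)
    {d : ℕ} {p : SmoothFn n} (hp : p ∈ polyFn n (d + 2)) (h0 : ballInt ρ a ha p = 0) :
    ∃ u ∈ polyFn n (d + 2), degOp ρ s 0 u = p := by
  have := finiteDimensional_polyFn (n := n) (d + 2)
  let T : SmoothFn n →ₗ[ℝ] SmoothFn n :=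
    degOpLin ρ s 0 + (ballInt ρ a ha).smulRight 1
  have hT : ∀ f, T f = degOp ρ s 0 f + ballInt ρ a ha f • 1 := fun f => rfl
  have hmem : ∀ f ∈ polyFn n (d + 2), T f ∈ polyFn n (d + 2) := fun f hf => by
    rw [hT]
    exact Submodule.add_mem _ (degOp_zero_mem_polyFn hf ρ s)
      (Submodule.smul_mem _ _ (C_mem_polyFn 1 _))
  have hJ : ∀ f, ballInt ρ a ha (T f) = ballInt ρ a ha f * ballInt (n := n) ρ a ha 1 := fun f => by
    have := wInt_degOp (ρ := ρ) ha hs 0 f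
    rw [wInt_zero_weight] at this
    rw [hT, map_add, map_smul, this, smul_eq_mul, zero_add]
  have h1 := ballInt_one_pos (n := n) hρ ha
  have hinj : ∀ f ∈ polyFn n (d + 2), T f = 0 → f = 0 := by
    intro f hf hTf
    have hJf : ballInt ρ a ha f = 0 := by
      have := hJ f
      rw [hTf, map_zero] at this
      exact (mul_eq_zero.1 this.symm).resolve_right h1.ne'
    have hdeg : degOp ρ s 0 f = 0 := by
      have := hT f
      rw [hTf, hJf, zero_smul, add_zero] at this
      exact this.symm
    have hG := wInt_mul_degOp (ρ := ρ) ha hs 0 f f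
    rw [hdeg, mul_zero, map_zero, wInt_zero_weight] at hG
    have hv := eq_zero_of_ballInt_eq_zero ha (f := bump ρ * gdot f f) (fun x hx =>
      mul_nonneg (bump_pos_iff.2 hx).le (gdot_self_nonneg f x)) (by linarith)
    have hpd : ∀ i, pd i f = 0 := fun i => by
      refine eq_zero_of_mem_polyFn hρ (pd_mem_polyFn hf i) fun x hx => ?_
      have h2 := (mul_eq_zero.1 (hv x hx)).resolve_left (bump_pos_iff.2 hx).ne'
      rw [gdot_self_apply, Finset.sum_eq_zero_iff_of_nonneg fun i _ => sq_nonneg _] at h2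
      exact pow_eq_zero_iff (two_ne_zero) |>.1 (h2 i (Finset.mem_univ i))
    have hc := eq_C_of_pd_eq_zero hpd
    have : ballInt ρ a ha f = f 0 * ballInt (n := n) ρ a ha 1 := by
      conv_lhs => rw [hc, ← mul_one (C _), ballInt_C_mul]
    rw [hJf] at this
    have hf0' := (mul_eq_zero.1 this.symm).resolve_right h1.ne'
    rw [hc, hf0']; ext x; simp
  obtain ⟨u, hu, hTu⟩ := Submodule.exists_eq_of_injOn _ T hmem hinj hp
  refine ⟨u, hu, ?_⟩
  have hJu := hJ u
  rw [hTu, h0] at hJu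
  have := (mul_eq_zero.1 hJu.symm).resolve_right h1.ne'
  rw [← hTu, hT, this, zero_smul, add_zero]

theorem wInt_gdot_sq_le {ρ a : ℝ} (ha : -1 < a) (φ f g : SmoothFn n) :
    (wInt ρ a ha φ (bump ρ * gdot f g)) ^ 2 ≤
      wInt ρ a ha φ (bump ρ * gdot f f) * wInt ρ a ha φ (bump ρ * gdot g g) := by
  have h : ∀ t : ℝ, 0 ≤ wInt ρ a ha φ (bump ρ * gdot f f) * (t * t)
      + (2 * wInt ρ a ha φ (bump ρ * gdot f g)) * t + wInt ρ a ha φ (bump ρ * gdot g g) := by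
    intro t
    have h1 : 0 ≤ wInt ρ a ha φ (bump ρ * gdot (C t * f + g) (C t * f + g)) :=
      wInt_nonneg ha φ fun x hx => mul_nonneg (bump_pos_iff.2 hx).le (gdot_self_nonneg _ x)
    have hC : ∀ h k : SmoothFn n, gdot (C t * h) k = C t * gdot h k := fun h k => by
      rw [gdot_mul_left]; simp [gdot]
    have h2 : bump ρ * gdot (C t * f + g) (C t * f + g) = C t * (C t * (bump ρ * gdot f f))
        + C t * (bump ρ * gdot f g) + C t * (bump ρ * gdot f g) + bump ρ * gdot g g := by
      simp only [gdot_add_left, gdot_add_right, hC, gdot_comm _ (C t * f)]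
      ring
    rw [h2] at h1
    simp only [map_add, wInt_C_mul] at h1
    linarith
  have := discrim_le_zero h
  rw [discrim] at this
  nlinarith

theorem poincare_polyFn {ρ s a : ℝ} (hρ : 0 < ρ) (ha : -1 < a) (hs : s = a + 1)
    {d : ℕ} {p : SmoothFn n} (hp : p ∈ polyFn n (d + 2)) (h0 : ballInt ρ a ha p = 0) :
    s * ballInt ρ a ha (p ^ 2) ≤ ballInt ρ a ha (bump ρ * gdot p p) := by
  obtain ⟨u, -, rfl⟩ := exists_degOp_eq_of_mem_polyFn hρ ha hs hp h0
  set p := degOp ρ s 0 u with hpdef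
  have h1 := wInt_mul_degOp (ρ := ρ) ha hs 0 p u
  have h2 := wInt_gdot_sq_le (ρ := ρ) ha 0 p u
  have h3 := wInt_gdot_le_degOp_sq (ρ := ρ) ha hs hessNonneg_zero u
  have h4 : 0 ≤ ballInt ρ a ha (p ^ 2) := ballInt_nonneg ha fun x _ => by
    simp only [pow_apply]; positivity
  have h5 : 0 ≤ ballInt ρ a ha (bump ρ * gdot p p) := ballInt_nonneg ha fun x hx =>
    mul_nonneg (bump_pos_iff.2 hx).le (gdot_self_nonneg _ x)
  rw [← hpdef, ← pow_two] at h1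
  simp only [wInt_zero_weight, ← hpdef] at h1 h2 h3
  have hs0 : 0 < s := by linarith
  rcases h4.eq_or_lt with h4 | h4
  · rw [← h4, mul_zero]; exact h5
  · refine le_of_mul_le_mul_right ?_ h4
    have h6 := mul_le_mul_of_nonneg_left h3 h5
    have h7 := mul_le_mul_of_nonneg_left h2 hs0.le
    rw [show ballInt ρ a ha (bump ρ * gdot p u) = -ballInt ρ a ha (p ^ 2) by linarith] at h7
    linarith

theorem exists_polyFn_riesz {ρ a : ℝ} (hρ : 0 < ρ) (ha : -1 < a) (L : SmoothFn n →ₗ[ℝ] ℝ) (d : ℕ) :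
    ∃ q ∈ polyFn n d, ∀ p ∈ polyFn n d, ballInt ρ a ha (q * p) = L p := by
  have := finiteDimensional_polyFn (n := n) d
  refine Submodule.exists_riesz _ ((LinearMap.mul ℝ (SmoothFn n)).compr₂ (ballInt ρ a ha))
    (fun f hf h1 => ?_) L
  have h2 := eq_zero_of_ballInt_eq_zero ha (f := f * f) (fun x _ => mul_self_nonneg _) h1
  exact eq_zero_of_mem_polyFn hρ hf fun x hx => mul_self_eq_zero.1 (h2 x hx)

end Polynomials

noncomputable section PolynomialApproximation

open SmoothFn

variable {n : ℕ}

theorem mul_mem_polyFn {d e : ℕ} {f g : SmoothFn n} (hf : f ∈ polyFn n d) (hg : g ∈ polyFn n e) :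
    f * g ∈ polyFn n (d + e) := by
  induction d generalizing f with
  | zero =>
    obtain ⟨c, rfl⟩ := eq_C_of_mem_polyFn_zero hf
    rw [zero_add]; exact C_mul_mem_polyFn hg c
  | succ d ih =>
    have key : polyFn n (d + 1) ≤ (polyFn n (d + 1 + e)).comap (LinearMap.mulRight ℝ g) := by
      refine polyFn_succ_le (fun k hk => polyFn_mono (by omega) (ih hk)) (fun i k hk => ?_)
      have : X i * k * g ∈ polyFn n (d + 1 + e) := by
        rw [mul_assoc, add_right_comm]
        exact X_mul_mem_polyFn (ih hk) i
      exact this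
    exact key hf

/-- Restrictions of polynomials to a compact set. -/
def polySubalgebra (n : ℕ) (S : Set (EuclideanSpace ℝ (Fin n))) : Subalgebra ℝ C(S, ℝ) where
  carrier := {g | ∃ d, ∃ p ∈ polyFn n d, ∀ x, g x = p x.1}
  mul_mem' := by
    rintro f g ⟨d, p, hp, hfp⟩ ⟨e, q, hq, hgq⟩
    exact ⟨d + e, p * q, mul_mem_polyFn hp hq, fun x => by simp [hfp, hgq]⟩
  add_mem' := by
    rintro f g ⟨d, p, hp, hfp⟩ ⟨e, q, hq, hgq⟩
    exact ⟨d + e, p + q, Submodule.add_mem _ (polyFn_mono (by omega) hp)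
      (polyFn_mono (by omega) hq), fun x => by simp [hfp, hgq]⟩
  algebraMap_mem' c := ⟨0, C c, C_mem_polyFn c 0, fun x => by simp⟩

theorem exists_polyFn_approx (ρ : ℝ) (f : SmoothFn n) {ε : ℝ} (hε : 0 < ε) :
    ∃ d, ∃ p ∈ polyFn n d, ∀ x ∈ sqBall n ρ, |f x - p x| ≤ ε := by
  set S := Metric.closedBall (0 : EuclideanSpace ℝ (Fin n)) (Real.sqrt ρ)
  have : CompactSpace S := isCompact_iff_compactSpace.1 (isCompact_closedBall _ _)
  have hsep : (polySubalgebra n S).SeparatesPoints := by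
    intro x y hxy
    have : ∃ i, x.1 i ≠ y.1 i := by
      by_contra! h
      exact hxy (Subtype.ext (by ext i; exact h i))
    obtain ⟨i, hi⟩ := this
    let g : C(S, ℝ) := ⟨fun z => (X i * 1 : SmoothFn n) z.1,
      ((X i * 1 : SmoothFn n).continuous).comp continuous_subtype_val⟩
    refine ⟨g, ⟨g, ⟨1, X i * 1, ?_, fun x => rfl⟩, rfl⟩, ?_⟩
    · exact X_mul_mem_polyFn (C_mem_polyFn 1 0) i
    · simpa [g] using hi
  have htop := ContinuousMap.subalgebra_topologicalClosure_eq_top_of_separatesPoints _ hsep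
  let F : C(S, ℝ) := ⟨fun z => f z.1, f.continuous.comp continuous_subtype_val⟩
  have hF : F ∈ closure (polySubalgebra n S : Set C(S, ℝ)) := by
    rw [← Subalgebra.topologicalClosure_coe, htop]; trivial
  obtain ⟨G, ⟨d, p, hp, hGp⟩, hG⟩ := Metric.mem_closure_iff.1 hF ε hε
  refine ⟨d, p, hp, fun x hx => ?_⟩
  have hxS : x ∈ S := by
    rw [sqBall_eq_ball] at hx; exact Metric.ball_subset_closedBall hx
  have h := (ContinuousMap.dist_apply_le_dist (f := F) (g := G) ⟨x, hxS⟩).trans hG.le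
  rw [hGp, Real.dist_eq] at h
  exact h

end PolynomialApproximation

noncomputable section Density

open SmoothFn Filter Topology

variable {n : ℕ}

theorem wInt_gdot_sub_self {ρ a : ℝ} (ha : -1 < a) (φ f g : SmoothFn n) :
    wInt ρ a ha φ (bump ρ * gdot (f - g) (f - g)) = wInt ρ a ha φ (bump ρ * gdot f f)
      - 2 * wInt ρ a ha φ (bump ρ * gdot f g) + wInt ρ a ha φ (bump ρ * gdot g g) := by
  have : bump ρ * gdot (f - g) (f - g) = bump ρ * gdot f f - bump ρ * gdot f g
      - bump ρ * gdot f g + bump ρ * gdot g g := by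
    simp only [gdot_sub_left, gdot_sub_right, gdot_comm g f]; ring
  rw [this]; simp only [map_add, map_sub]; ring

theorem wInt_gdot_nonneg {ρ a : ℝ} (ha : -1 < a) (φ f : SmoothFn n) :
    0 ≤ wInt ρ a ha φ (bump ρ * gdot f f) :=
  wInt_nonneg ha φ fun _ hx => mul_nonneg (bump_pos_iff.2 hx).le (gdot_self_nonneg _ _)

theorem ballInt_sq_nonneg {ρ a : ℝ} (ha : -1 < a) (f : SmoothFn n) : 0 ≤ ballInt ρ a ha (f ^ 2) :=
  ballInt_nonneg ha fun x _ => by simp only [pow_apply]; positivity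

theorem degOp_eq_sub (ρ s : ℝ) (φ u : SmoothFn n) :
    degOp ρ s φ u = degOp ρ s 0 u - bump ρ * gdot φ u := by
  have : gdot 0 u = 0 := by simp [gdot]
  simp only [degOp, drift, this]; ring

theorem ballInt_sub_sq_le {ρ a : ℝ} (ha : -1 < a) (f g : SmoothFn n) :
    ballInt ρ a ha (f ^ 2) ≤ 2 * ballInt ρ a ha (g ^ 2) + 2 * ballInt ρ a ha ((f - g) ^ 2) := by
  rw [← ballInt_C_mul ha 2, ← ballInt_C_mul ha 2, ← map_add]
  refine ballInt_mono ha fun x _ => ?_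
  simp only [pow_apply, add_apply, mul_apply, C_apply, sub_apply]
  nlinarith [sq_nonneg (f x - 2 * g x)]

/-- Galerkin approximations of the density of a functional annihilating the range of `degOp`. -/
theorem exists_galerkin {ρ s a : ℝ} (hρ : 0 < ρ) (ha : -1 < a) (hs : s = a + 1) (φ : SmoothFn n)
    (L : SmoothFn n →ₗ[ℝ] ℝ) (K : ℝ)
    (hL1 : ∀ f ε, (∀ x ∈ sqBall n ρ, |f x| ≤ ε) → |L f| ≤ K * ε)
    (hL2 : ∀ f, L (bump ρ * f) ^ 2 ≤ K * ballInt ρ a ha (bump ρ * f ^ 2))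
    (hL : ∀ u, L (degOp ρ s φ u) = 0) :
    ∃ A : ℕ → SmoothFn n, (∀ f, Tendsto (fun d => ballInt ρ a ha (A d * f)) atTop (𝓝 (L f))) ∧
      ∀ ε > 0, ∃ N, ∀ c ≥ N, ∀ d ≥ c, ballInt ρ a ha ((A d - A c) ^ 2) ≤ ε ∧
        ballInt ρ a ha (bump ρ * gdot (A d - A c) (A d - A c)) ≤ ε := by
  have hs0 : 0 < s := by linarith
  choose A hA hAL using fun d => exists_polyFn_riesz (n := n) hρ ha L (d + 2)
  let E : SmoothFn n → ℝ := fun f => ballInt ρ a ha (bump ρ * gdot f f)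
  have hE0 : ∀ f, 0 ≤ E f := fun f => by
    simpa only [wInt_zero_weight] using wInt_gdot_nonneg (ρ := ρ) ha 0 f
  have hAu : ∀ d, ∀ u ∈ polyFn n (d + 2),
      ballInt ρ a ha (bump ρ * gdot (A d) u) = -L (bump ρ * gdot φ u) := by
    intro d u hu
    have h1 := wInt_mul_degOp (ρ := ρ) ha hs 0 (A d) u
    rw [wInt_zero_weight, wInt_zero_weight, hAL d _ (degOp_zero_mem_polyFn hu ρ s)] at h1
    have h2 := hL u
    rw [degOp_eq_sub, map_sub] at h2
    linarith
  obtain ⟨M, hM0, hM⟩ := exists_bound_sqBall ρ (gdot φ φ).continuous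
  have hK0 : 0 ≤ K := by
    have := (abs_nonneg _).trans (hL1 (0 : SmoothFn n) 1 fun x _ => by simp)
    linarith
  have hLE : ∀ u, L (bump ρ * gdot φ u) ^ 2 ≤ K * M * E u := by
    intro u
    refine (hL2 _).trans ?_
    rw [mul_assoc]
    refine mul_le_mul_of_nonneg_left ?_ hK0
    rw [← ballInt_C_mul]
    refine ballInt_mono ha fun x hx => ?_
    simp only [mul_apply, pow_apply, C_apply]
    have h1 := gdot_apply_sq_le φ u x
    have h2 := (le_abs_self _).trans (hM x hx)
    have h3 := gdot_self_nonneg u x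
    calc bump ρ x * gdot φ u x ^ 2 ≤ bump ρ x * (M * gdot u u x) :=
          mul_le_mul_of_nonneg_left (h1.trans (mul_le_mul_of_nonneg_right h2 h3))
            (bump_pos_iff.2 hx).le
      _ = _ := by ring
  have hEb : ∀ d, E (A d) ≤ K * M := by
    intro d
    have h1 := hAu d _ (hA d)
    have h2 := hLE (A d)
    have h3 : E (A d) = -L (bump ρ * gdot φ (A d)) := h1
    rcases (hE0 (A d)).eq_or_lt with h | h
    · rw [← h]; positivity
    · refine le_of_mul_le_mul_right ?_ h
      calc E (A d) * E (A d) = L (bump ρ * gdot φ (A d)) ^ 2 := by rw [h3]; ring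
        _ ≤ _ := h2
  have hsub : ∀ c d, c ≤ d → E (A d - A c) = E (A d) - E (A c) := by
    intro c d hcd
    have h1 := wInt_gdot_sub_self (ρ := ρ) ha 0 (A d) (A c)
    simp only [wInt_zero_weight] at h1
    have h2 := hAu d _ (polyFn_mono (by omega) (hA c))
    have h3 := hAu c _ (hA c)
    change E (A d - A c) = E (A d) - _ + E (A c) at h1
    have h4 : E (A c) = -L (bump ρ * gdot φ (A c)) := h3
    rw [h2] at h1
    linarith
  have hpoin : ∀ c d, c ≤ d → s * ballInt ρ a ha ((A d - A c) ^ 2) ≤ E (A d - A c) := by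
    intro c d hcd
    refine poincare_polyFn (d := d) hρ ha hs (Submodule.sub_mem _ (hA d)
      (polyFn_mono (by omega) (hA c))) ?_
    have h1 := hAL d 1 (C_mem_polyFn 1 _)
    have h2 := hAL c 1 (C_mem_polyFn 1 _)
    rw [mul_one] at h1 h2
    rw [map_sub, h1, h2, sub_self]
  have hcau : ∀ ε > 0, ∃ N, ∀ c ≥ N, ∀ d ≥ c, E (A d - A c) ≤ ε := by
    intro ε hε
    have hbdd : BddAbove (range fun d => E (A d)) := ⟨K * M, by rintro _ ⟨d, rfl⟩; exact hEb d⟩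
    have hmono : Monotone fun d => E (A d) := fun c d hcd => by
      have := hsub c d hcd
      have := hE0 (A d - A c)
      simp only; linarith
    obtain ⟨N, hN⟩ := exists_lt_of_lt_ciSup (show (⨆ d, E (A d)) - ε < ⨆ d, E (A d) by linarith)
    refine ⟨N, fun c hc d hd => ?_⟩
    have h1 := hmono hc
    have h2 := le_ciSup hbdd d
    rw [hsub c d hd]
    simp only at h1 h2
    linarith
  refine ⟨A, fun f => ?_, fun ε hε => ?_⟩
  · have hbd : ∀ d, ballInt ρ a ha (A d ^ 2) ≤ 2 * ballInt ρ a ha (A 0 ^ 2) + 2 * (K * M / s) := by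
      intro d
      have h1 := ballInt_sub_sq_le (ρ := ρ) ha (A d) (A 0)
      have h2 := hpoin 0 d (Nat.zero_le _)
      have h3 := hsub 0 d (Nat.zero_le _)
      have h4 : ballInt ρ a ha ((A d - A 0) ^ 2) ≤ K * M / s := by
        rw [le_div_iff₀ hs0]
        have := hE0 (A 0)
        have := hEb d
        linarith
      linarith
    set K2 := 2 * ballInt ρ a ha (A 0 ^ 2) + 2 * (K * M / s)
    have hJ1 := (ballInt_one_pos (n := n) hρ ha).le
    have hK2 : 0 ≤ K2 := (ballInt_sq_nonneg ha _).trans (hbd 0)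
    set R := Real.sqrt (K2 * ballInt (n := n) ρ a ha 1) + K
    have hR : 0 ≤ R := by positivity
    rw [Metric.tendsto_atTop]
    intro ε hε
    obtain ⟨D, p, hp, hfp⟩ := exists_polyFn_approx ρ f (ε := ε / (R + 1)) (by positivity)
    set δ := ε / (R + 1)
    have hδ : 0 < δ := by positivity
    refine ⟨D, fun d hd => ?_⟩
    have h1 : ballInt ρ a ha (A d * f) - L f = ballInt ρ a ha (A d * (f - p)) - L (f - p) := by
      have := hAL d p (polyFn_mono (by omega) hp)
      rw [mul_sub, map_sub, map_sub, this]; ring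
    have h2 : |L (f - p)| ≤ K * δ := hL1 _ _ fun x hx => by simpa using hfp x hx
    have h3 : |ballInt ρ a ha (A d * (f - p))| ≤
        Real.sqrt (K2 * ballInt (n := n) ρ a ha 1) * δ := by
      refine abs_le_of_sq_le_sq ?_ (by positivity)
      rw [mul_pow, Real.sq_sqrt (by positivity)]
      refine (abs_ballInt_mul_le ha _ _).trans ?_
      have h4 : ballInt ρ a ha ((f - p) ^ 2) ≤ δ ^ 2 * ballInt (n := n) ρ a ha 1 := by
        rw [← ballInt_C_mul]
        refine ballInt_mono ha fun x hx => ?_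
        simp only [pow_apply, sub_apply, C_apply, mul_one]
        exact sq_le_sq.2 ((hfp x hx).trans (le_abs_self _))
      calc _ ≤ K2 * (δ ^ 2 * ballInt (n := n) ρ a ha 1) :=
            mul_le_mul (hbd d) h4 (ballInt_sq_nonneg ha _) hK2
        _ = _ := by ring
    rw [Real.dist_eq, h1]
    calc _ ≤ |ballInt ρ a ha (A d * (f - p))| + |L (f - p)| := abs_sub _ _
      _ ≤ R * δ := by simp only [R]; linarith
      _ < (R + 1) * δ := by linarith
      _ = ε := by simp only [δ]; field_simp
  · obtain ⟨N, hN⟩ := hcau (min ε (s * ε)) (by positivity)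
    refine ⟨N, fun c hc d hd => ⟨?_, (hN c hc d hd).trans (min_le_left _ _)⟩⟩
    exact le_of_mul_le_mul_left ((hpoin c d hd).trans ((hN c hc d hd).trans (min_le_right _ _))) hs0

/-- Energy of `exp φ * q` in terms of `q`. -/
theorem exists_wInt_gdot_exp_mul_le {ρ a : ℝ} (ha : -1 < a) (φ : SmoothFn n) :
    ∃ M, 0 < M ∧ ∀ q, wInt ρ a ha φ (bump ρ * gdot (SmoothFn.exp φ * q) (SmoothFn.exp φ * q)) ≤
      M * (ballInt ρ a ha (q ^ 2) + ballInt ρ a ha (bump ρ * gdot q q)) := by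
  obtain ⟨M1, hM10, hM1⟩ := exists_bound_sqBall ρ (SmoothFn.exp φ).continuous
  obtain ⟨M2, hM20, hM2⟩ := exists_bound_sqBall ρ (bump ρ * gdot φ φ : SmoothFn n).continuous
  refine ⟨2 * M1 * (M2 + 1), by positivity, fun q => ?_⟩
  have hg : gdot (SmoothFn.exp φ * q) (SmoothFn.exp φ * q) * SmoothFn.exp (-φ) =
      SmoothFn.exp φ * (q ^ 2 * gdot φ φ + q * gdot φ q + q * gdot φ q + gdot q q) := by
    have he : ∀ k, gdot (SmoothFn.exp φ) k = SmoothFn.exp φ * gdot φ k := fun k => by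
      simp only [gdot, pd_exp, Finset.mul_sum, mul_assoc]
    have h1 : ∀ k, gdot (SmoothFn.exp φ * q) k =
        SmoothFn.exp φ * (gdot q k + q * gdot φ k) := fun k => by
      rw [gdot_mul_left, he]; ring
    rw [h1, gdot_comm q, gdot_comm φ, h1, h1, gdot_comm q φ]
    linear_combination (SmoothFn.exp φ * (q ^ 2 * gdot φ φ + q * gdot φ q + q * gdot φ q
      + gdot q q)) * exp_mul_exp_neg φ
  rw [wInt_apply, mul_assoc, hg, ← map_add, ← ballInt_C_mul]
  refine ballInt_mono ha fun x hx => ?_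
  simp only [mul_apply, add_apply, pow_apply, C_apply]
  have hv := (bump_pos_iff.2 hx).le
  have h1 := (le_abs_self _).trans (hM1 x hx)
  have h2 := (le_abs_self _).trans (hM2 x hx)
  simp only [mul_apply] at h2
  have h3 := gdot_apply_sq_le φ q x
  have h4 := gdot_self_nonneg φ x
  have h5 := gdot_self_nonneg q x
  have he0 : 0 ≤ SmoothFn.exp φ x := by rw [exp_apply]; positivity
  have h6 : 2 * (q x * gdot φ q x) ≤ q x ^ 2 * gdot φ φ x + gdot q q x := by
    refine le_of_sq_le_sq ?_ (by positivity)
    nlinarith [mul_le_mul_of_nonneg_left h3 (sq_nonneg (q x)),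
      sq_nonneg (q x ^ 2 * gdot φ φ x - gdot q q x)]
  calc _ = SmoothFn.exp φ x * (bump ρ x * (q x ^ 2 * gdot φ φ x + 2 * (q x * gdot φ q x)
        + gdot q q x)) := by ring
    _ ≤ SmoothFn.exp φ x * (bump ρ x * (2 * (q x ^ 2 * gdot φ φ x + gdot q q x))) := by
        gcongr; linarith
    _ = SmoothFn.exp φ x * (2 * (q x ^ 2 * (bump ρ x * gdot φ φ x) + bump ρ x * gdot q q x)) := by
        ring
    _ ≤ M1 * (2 * ((M2 + 1) * (q x ^ 2 + bump ρ x * gdot q q x))) := by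
        gcongr
        nlinarith [sq_nonneg (q x), mul_nonneg hv h5,
          mul_le_mul_of_nonneg_left h2 (sq_nonneg (q x)), mul_nonneg hM20.le (mul_nonneg hv h5)]
    _ = _ := by ring

theorem galerkin_energy_tendsto {ρ s a : ℝ} (ha : -1 < a) (hs : s = a + 1) (φ : SmoothFn n)
    {L : SmoothFn n →ₗ[ℝ] ℝ} (hL : ∀ u, L (degOp ρ s φ u) = 0) {A : ℕ → SmoothFn n}
    (hA : ∀ f, Tendsto (fun d => ballInt ρ a ha (A d * f)) atTop (𝓝 (L f)))
    (hA2 : ∀ ε > 0, ∃ N, ∀ c ≥ N, ∀ d ≥ c, ballInt ρ a ha ((A d - A c) ^ 2) ≤ ε ∧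
        ballInt ρ a ha (bump ρ * gdot (A d - A c) (A d - A c)) ≤ ε) {ε : ℝ} (hε : 0 < ε) :
    ∃ N, ∀ c ≥ N, wInt ρ a ha φ
      (bump ρ * gdot (SmoothFn.exp φ * A c) (SmoothFn.exp φ * A c)) ≤ ε := by
  obtain ⟨M, hM0, hM⟩ := exists_wInt_gdot_exp_mul_le (ρ := ρ) ha φ
  obtain ⟨N, hN⟩ := hA2 (ε / (2 * M)) (by positivity)
  refine ⟨N, fun c hc => ?_⟩
  set g : ℕ → SmoothFn n := fun d => SmoothFn.exp φ * A d with hg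
  set F := wInt ρ a ha φ (bump ρ * gdot (g c) (g c)) with hF
  have hF0 : 0 ≤ F := wInt_gdot_nonneg ha φ _
  have hlim : Tendsto (fun d => wInt ρ a ha φ (bump ρ * gdot (g d) (g c))) atTop (𝓝 0) := by
    have h1 := (hA (degOp ρ s φ (g c))).neg
    rw [hL, neg_zero] at h1
    refine h1.congr fun d => ?_
    have h2 := wInt_mul_degOp (ρ := ρ) ha hs φ (g d) (g c)
    have h3 : g d * degOp ρ s φ (g c) * SmoothFn.exp (-φ) = A d * degOp ρ s φ (g c) := by
      simp only [hg]
      linear_combination (A d * degOp ρ s φ (SmoothFn.exp φ * A c)) * exp_mul_exp_neg φ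
    rw [wInt_apply, h3] at h2
    rw [h2, neg_neg]
  have hbd : ∀ d ≥ c, (wInt ρ a ha φ (bump ρ * gdot (g d) (g c)) - F) ^ 2 ≤ ε * F := by
    intro d hd
    have h1 := wInt_gdot_sq_le (ρ := ρ) ha φ (g d - g c) (g c)
    have h2 : wInt ρ a ha φ (bump ρ * gdot (g d - g c) (g c)) =
        wInt ρ a ha φ (bump ρ * gdot (g d) (g c)) - F := by
      rw [gdot_sub_left, mul_sub, map_sub]
    rw [h2] at h1
    refine h1.trans (mul_le_mul_of_nonneg_right ?_ hF0)
    have h3 : g d - g c = SmoothFn.exp φ * (A d - A c) := by simp only [hg]; ring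
    rw [h3]
    refine (hM _).trans ?_
    obtain ⟨h4, h5⟩ := hN c hc d hd
    calc _ ≤ M * (ε / (2 * M) + ε / (2 * M)) := by gcongr
      _ = ε := by field_simp; ring
  have hfin : (0 - F) ^ 2 ≤ ε * F :=
    le_of_tendsto ((hlim.sub_const F).pow 2) (eventually_atTop.2 ⟨c, hbd⟩)
  rcases hF0.eq_or_lt with h | h
  · rw [← h]; exact hε.le
  · exact le_of_mul_le_mul_right
      (by linarith [hfin, sq F, sq_nonneg F, (by ring : (0 - F) ^ 2 = F * F)]) h

theorem eq_zero_of_annihilates_degOp {ρ s a : ℝ} (hρ : 0 < ρ) (ha : -1 < a) (hs : s = a + 1)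
    (φ : SmoothFn n) (L : SmoothFn n →ₗ[ℝ] ℝ) (K : ℝ)
    (hL1 : ∀ f ε, (∀ x ∈ sqBall n ρ, |f x| ≤ ε) → |L f| ≤ K * ε)
    (hL2 : ∀ f, L (bump ρ * f) ^ 2 ≤ K * ballInt ρ a ha (bump ρ * f ^ 2))
    (hL : ∀ u, L (degOp ρ s φ u) = 0) {f : SmoothFn n} (hf : wInt ρ a ha φ f = 0) : L f = 0 := by
  obtain ⟨A, hA, hA2⟩ := exists_galerkin hρ ha hs φ L K hL1 hL2 hL
  obtain ⟨M, hM0, hM⟩ := exists_bound_sqBall ρ (SmoothFn.exp φ).continuous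
  have hK0 : 0 ≤ K := by
    have := (abs_nonneg _).trans (hL1 (0 : SmoothFn n) 1 fun x _ => by simp)
    linarith
  have hJ1 := ballInt_one_pos (n := n) hρ ha
  have hpoly : ∀ d, ∀ p ∈ polyFn n (d + 2), ballInt ρ a ha p = 0 → L (SmoothFn.exp φ * p) = 0 := by
    intro d p hp hp0
    obtain ⟨w, -, hw⟩ := exists_degOp_eq_of_mem_polyFn hρ ha hs hp hp0
    set E := ballInt ρ a ha (bump ρ * gdot w w)
    have hE0 : 0 ≤ E := by
      simpa only [wInt_zero_weight] using wInt_gdot_nonneg (ρ := ρ) ha 0 w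
    have key : ∀ ε > 0, L (SmoothFn.exp φ * p) ^ 2 ≤ M * ε * E := by
      intro ε hε
      obtain ⟨N, hN⟩ := galerkin_energy_tendsto ha hs φ hL hA hA2 hε
      refine le_of_tendsto ((hA (SmoothFn.exp φ * p)).pow 2)
        (eventually_atTop.2 ⟨N, fun c hc => ?_⟩)
      have h1 := wInt_mul_degOp (ρ := ρ) ha hs 0 (SmoothFn.exp φ * A c) w
      have h2 := wInt_gdot_sq_le (ρ := ρ) ha 0 (SmoothFn.exp φ * A c) w
      simp only [wInt_zero_weight] at h1 h2
      have h3 : A c * (SmoothFn.exp φ * p) = SmoothFn.exp φ * A c * degOp ρ s 0 w := by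
        rw [hw]; ring
      rw [h3, h1, neg_sq]
      refine h2.trans (mul_le_mul_of_nonneg_right ?_ hE0)
      refine le_trans ?_ (mul_le_mul_of_nonneg_left (hN c hc) hM0.le)
      rw [wInt_apply, ← ballInt_C_mul]
      refine ballInt_mono ha fun x hx => ?_
      have h4 := (le_abs_self _).trans (hM x hx)
      have h5 : (1 : ℝ) ≤ M * SmoothFn.exp (-φ) x := by
        have h6 : SmoothFn.exp φ x * SmoothFn.exp (-φ) x = 1 := by
          rw [← mul_apply, exp_mul_exp_neg, one_apply]
        rw [← h6]
        refine mul_le_mul_of_nonneg_right h4 ?_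
        rw [exp_apply]; positivity
      have h7 : 0 ≤ (bump ρ * gdot (SmoothFn.exp φ * A c) (SmoothFn.exp φ * A c) : SmoothFn n) x :=
        mul_nonneg (bump_pos_iff.2 hx).le (gdot_self_nonneg _ x)
      rw [mul_apply (C M), C_apply, mul_apply (bump ρ * _)]
      nlinarith
    have hz : L (SmoothFn.exp φ * p) ^ 2 ≤ 0 := by
      refine le_of_forall_pos_le_add fun δ hδ => ?_
      have := key (δ / (M * (E + 1))) (by positivity)
      calc _ ≤ _ := this
        _ = δ * (E / (E + 1)) := by field_simp
        _ ≤ δ * 1 := by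
          gcongr; rw [div_le_one (by positivity)]; linarith
        _ = 0 + δ := by ring
    exact pow_eq_zero_iff two_ne_zero |>.1 (le_antisymm hz (sq_nonneg _))
  have hfq : f = SmoothFn.exp φ * (SmoothFn.exp (-φ) * f) := by
    rw [← mul_assoc, exp_mul_exp_neg, one_mul]
  set q := SmoothFn.exp (-φ) * f with hq
  have hq0 : ballInt ρ a ha q = 0 := by rw [hq, mul_comm, ← wInt_apply, hf]
  have hsmall : ∀ ε > 0, |L f| ≤ K * (M * (2 * ε)) := by
    intro ε hε
    obtain ⟨d, p, hp, hpq⟩ := exists_polyFn_approx ρ q hε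
    set J1 := ballInt (n := n) ρ a ha 1
    set m := ballInt ρ a ha p / J1 with hm
    have hCm : ballInt (n := n) ρ a ha (C m) = m * J1 := by
      rw [← mul_one (C m), ballInt_C_mul]
    have h1 := hpoly d (p - C m) (Submodule.sub_mem _ (polyFn_mono (by omega) hp)
      (C_mem_polyFn m _)) (by rw [map_sub, hCm, hm]; field_simp; ring)
    have hm1 : |m| ≤ ε := by
      rw [hm, abs_div, abs_of_pos hJ1, div_le_iff₀ hJ1]
      have h2 : ballInt ρ a ha p = ballInt ρ a ha (p - q) := by rw [map_sub, hq0, sub_zero]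
      have h3 : ε * J1 = ballInt (n := n) ρ a ha (C ε * 1) := by rw [ballInt_C_mul]
      rw [h2, h3, abs_le]
      constructor
      · rw [← map_neg]
        refine ballInt_mono ha fun x hx => ?_
        have := abs_le.1 (hpq x hx)
        simp; linarith
      · refine ballInt_mono ha fun x hx => ?_
        have := abs_le.1 (hpq x hx)
        simp; linarith
    have h2 : L f = L (SmoothFn.exp φ * (q - p + C m)) := by
      conv_lhs => rw [hfq]
      rw [← sub_eq_zero, ← map_sub]
      rw [← h1]; congr 1; ring
    rw [h2]
    refine hL1 _ _ fun x hx => ?_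
    rw [mul_apply, abs_mul]
    refine mul_le_mul (hM x hx) ?_ (abs_nonneg _) hM0.le
    simp only [add_apply, sub_apply, C_apply]
    calc _ ≤ |q x - p x| + |m| := abs_add_le _ _
      _ ≤ _ := by linarith [hpq x hx]
  have hz : |L f| ≤ 0 := by
    refine le_of_forall_pos_le_add fun δ hδ => ?_
    have := hsmall (δ / (2 * M * (K + 1))) (by positivity)
    calc _ ≤ _ := this
      _ = δ * (K / (K + 1)) := by field_simp
      _ ≤ δ * 1 := by gcongr; rw [div_le_one (by positivity)]; linarith
      _ = 0 + δ := by ring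
  exact abs_nonpos_iff.1 hz

end Density

noncomputable section DensityL2

open SmoothFn Filter Topology
open scoped InnerProductSpace

variable {n : ℕ}

theorem memLp_ballMeasure {ρ b : ℝ} (hb : -1 < b) (f : SmoothFn n) :
    MemLp f.1 2 (ballMeasure n ρ b) := by
  have := isFiniteMeasure_ballMeasure (n := n) (ρ := ρ) hb
  obtain ⟨M, -, hM⟩ := exists_bound_sqBall ρ f.continuous
  refine MemLp.of_bound f.continuous.aestronglyMeasurable M ?_
  filter_upwards [ae_ballMeasure_mem ρ b] with x hx using hM x hx

/-- The class of a smooth function in the weighted `L²` space of a ball. -/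
def toL2 (ρ b : ℝ) (hb : -1 < b) : SmoothFn n →ₗ[ℝ] Lp ℝ 2 (ballMeasure n ρ b) where
  toFun f := (memLp_ballMeasure hb f).toLp f.1
  map_add' _ _ := rfl
  map_smul' _ _ := rfl

theorem inner_toL2 {ρ b : ℝ} (hb : -1 < b) (f g : SmoothFn n) :
    ⟪toL2 ρ b hb f, toL2 ρ b hb g⟫_ℝ = ballInt ρ b hb (f * g) := by
  rw [L2.inner_def, ballInt_apply]
  refine integral_congr_ae ?_
  filter_upwards [(memLp_ballMeasure (ρ := ρ) hb f).coeFn_toLp,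
    (memLp_ballMeasure (ρ := ρ) hb g).coeFn_toLp] with x hf hg
  have hf' : toL2 ρ b hb f x = f x := hf
  have hg' : toL2 ρ b hb g x = g x := hg
  rw [hf', hg', mul_apply]
  simp [mul_comm]

theorem norm_toL2_sq {ρ b : ℝ} (hb : -1 < b) (f : SmoothFn n) :
    ‖toL2 ρ b hb f‖ ^ 2 = ballInt ρ b hb (f ^ 2) := by
  rw [← real_inner_self_eq_norm_sq, inner_toL2, pow_two]

theorem exists_degOp_approx {ρ s a b : ℝ} (hρ : 0 < ρ) (ha : -1 < a) (hs : s = a + 1) (hb : -1 < b)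
    {K₀ : ℝ} (hK₀ : 0 ≤ K₀) (hab : ∀ f : SmoothFn n,
      ballInt ρ b hb ((bump ρ * f) ^ 2) ≤ K₀ * ballInt ρ a ha (bump ρ * f ^ 2))
    (φ : SmoothFn n) {f : SmoothFn n} (hf : wInt ρ a ha φ f = 0) {δ : ℝ} (hδ : 0 < δ) :
    ∃ u, ballInt ρ b hb ((degOp ρ s φ u - f) ^ 2) ≤ δ := by
  let T : SmoothFn n →ₗ[ℝ] Lp ℝ 2 (ballMeasure n ρ b) := (toL2 ρ b hb).comp (degOpLin ρ s φ)
  have hmem : toL2 ρ b hb f ∈ T.rangeᗮᗮ := by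
    rw [Submodule.mem_orthogonal]
    intro G hG
    let L : SmoothFn n →ₗ[ℝ] ℝ := (innerₗ _ G).comp (toL2 ρ b hb)
    have hLdef : ∀ g, L g = ⟪G, toL2 ρ b hb g⟫_ℝ := fun g => rfl
    have hLsq : ∀ g, L g ^ 2 ≤ ‖G‖ ^ 2 * ballInt ρ b hb (g ^ 2) := fun g => by
      rw [← norm_toL2_sq, ← mul_pow, hLdef]
      exact sq_le_sq.2 ((abs_real_inner_le_norm _ _).trans (le_abs_self _))
    have hJ1 := (ballInt_one_pos (n := n) hρ hb).le
    have hJ : ∀ g, 0 ≤ ballInt ρ a ha (bump ρ * g ^ 2 : SmoothFn n) := fun g =>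
      ballInt_nonneg ha fun x hx => mul_nonneg (bump_pos_iff.2 hx).le (by
        simp only [pow_apply]; positivity)
    set K := ‖G‖ * Real.sqrt (ballInt (n := n) ρ b hb 1) + ‖G‖ ^ 2 * K₀ with hK
    refine eq_zero_of_annihilates_degOp hρ ha hs φ L K (fun g ε hg => ?_) (fun g => ?_)
      (fun u => ?_) hf
    · have hε : 0 ≤ ε := (abs_nonneg _).trans (hg 0 (zero_mem_sqBall hρ))
      have h1 : |L g| ≤ ‖G‖ * Real.sqrt (ballInt (n := n) ρ b hb 1) * ε := by
        refine abs_le_of_sq_le_sq ?_ (by positivity)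
        rw [mul_pow, mul_pow, Real.sq_sqrt hJ1]
        refine (hLsq g).trans ?_
        rw [mul_assoc]
        refine mul_le_mul_of_nonneg_left ?_ (sq_nonneg _)
        rw [mul_comm, ← ballInt_C_mul]
        refine ballInt_mono hb fun x hx => ?_
        simp only [pow_apply, C_apply, mul_one]
        exact sq_le_sq.2 ((hg x hx).trans (le_abs_self _))
      refine h1.trans (mul_le_mul_of_nonneg_right ?_ hε)
      rw [hK]; exact le_add_of_nonneg_right (by positivity)
    · refine (hLsq _).trans ((mul_le_mul_of_nonneg_left (hab g) (sq_nonneg _)).trans ?_)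
      rw [← mul_assoc]
      refine mul_le_mul_of_nonneg_right ?_ (hJ g)
      rw [hK]; exact le_add_of_nonneg_left (by positivity)
    · have := (Submodule.mem_orthogonal _ _).1 hG (T u) ⟨u, rfl⟩
      rw [hLdef, real_inner_comm]; exact this
  rw [Submodule.orthogonal_orthogonal_eq_closure, ← SetLike.mem_coe,
    Submodule.topologicalClosure_coe] at hmem
  obtain ⟨_, ⟨u, rfl⟩, hu⟩ := Metric.mem_closure_iff.1 hmem (Real.sqrt δ) (by positivity)
  refine ⟨u, ?_⟩
  have h1 : T u = toL2 ρ b hb (degOp ρ s φ u) := rfl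
  rw [← norm_toL2_sq, map_sub, ← h1, ← dist_eq_norm, dist_comm]
  calc _ ≤ Real.sqrt δ ^ 2 := by gcongr
    _ = δ := Real.sq_sqrt hδ.le

end DensityL2

noncomputable section BallPoincare

open SmoothFn Filter Topology

variable {n : ℕ}

theorem bump_le_half (ρ : ℝ) (x : EuclideanSpace ℝ (Fin n)) : bump ρ x ≤ ρ / 2 := by
  rw [bump_apply]; nlinarith [sq_nonneg ‖x‖]

/-- Poincaré inequality on a ball for the weight `bump ^ (s - 1) * exp (-φ)` with `φ` convex. -/
theorem wInt_sq_le_gdot {ρ s a : ℝ} (hρ : 0 < ρ) (ha : -1 < a) (hs : s = a + 1) {φ : SmoothFn n}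
    (hφ : HessNonneg φ) {h : SmoothFn n} (hh : wInt ρ a ha φ h = 0) :
    s * wInt ρ a ha φ (h ^ 2) ≤ wInt ρ a ha φ (bump ρ * gdot h h) := by
  have hs0 : 0 < s := by linarith
  obtain ⟨M, hM0, hM⟩ := exists_bound_sqBall ρ (SmoothFn.exp (-φ)).continuous
  suffices H : ∀ δ > 0, wInt ρ a ha φ (h ^ 2) ≤ wInt ρ a ha φ (bump ρ * gdot h h) / s + M * δ by
    have : wInt ρ a ha φ (h ^ 2) ≤ wInt ρ a ha φ (bump ρ * gdot h h) / s := by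
      refine le_of_forall_pos_le_add fun ε hε => ?_
      have := H (ε / M) (by positivity)
      rwa [mul_div_cancel₀ _ hM0.ne'] at this
    rwa [le_div_iff₀ hs0, mul_comm] at this
  intro δ hδ
  obtain ⟨u, hu⟩ := exists_degOp_approx hρ ha hs ha (K₀ := ρ / 2) (by positivity) (fun f => by
    rw [← ballInt_C_mul]
    refine ballInt_mono ha fun x hx => ?_
    simp only [pow_apply, mul_apply, C_apply]
    have h1 := bump_le_half ρ x
    have h2 := (bump_pos_iff.2 hx).le
    nlinarith [mul_nonneg (mul_nonneg h2 (sq_nonneg (f x))) (sub_nonneg.2 h1)]) φ hh hδ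
  set D := degOp ρ s φ u with hD
  have h1 : wInt ρ a ha φ ((D - h) ^ 2) ≤ M * δ := by
    refine le_trans ?_ (mul_le_mul_of_nonneg_left hu hM0.le)
    rw [wInt_apply, ← ballInt_C_mul]
    refine ballInt_mono ha fun x hx => ?_
    rw [mul_apply, mul_apply, C_apply, mul_comm]
    refine mul_le_mul_of_nonneg_right ((le_abs_self _).trans (hM x hx)) ?_
    rw [pow_apply]; positivity
  have h2 := wInt_mul_degOp (ρ := ρ) ha hs φ h u
  have h3 := wInt_gdot_sq_le (ρ := ρ) ha φ h u
  have h4 := wInt_gdot_le_degOp_sq (ρ := ρ) ha hs hφ u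
  have h5 := wInt_gdot_nonneg (ρ := ρ) ha φ h
  have h6 := wInt_gdot_nonneg (ρ := ρ) ha φ u
  rw [← hD] at h2 h4
  have h7 : wInt ρ a ha φ ((D - h) ^ 2) = wInt ρ a ha φ (D ^ 2) - 2 * wInt ρ a ha φ (h * D)
      + wInt ρ a ha φ (h ^ 2) := by
    have : (D - h) ^ 2 = D ^ 2 - h * D - h * D + h ^ 2 := by ring
    rw [this]; simp only [map_add, map_sub]; ring
  set X' := wInt ρ a ha φ (bump ρ * gdot h h)
  set U := wInt ρ a ha φ (bump ρ * gdot u u)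
  set G := wInt ρ a ha φ (bump ρ * gdot h u)
  have h8 : -(2 * G) ≤ X' / s + s * U := by
    refine (neg_le_abs _).trans (abs_le_of_sq_le_sq ?_ (by positivity))
    have : (X' / s + s * U) ^ 2 = (X' / s - s * U) ^ 2 + 4 * (X' * U) := by field_simp; ring
    rw [this]
    nlinarith [sq_nonneg (X' / s - s * U)]
  linarith

theorem integrableOn_bump_rpow_mul {ρ a : ℝ} (ha : -1 < a) (f : SmoothFn n) :
    IntegrableOn (fun x => bump ρ x ^ a * f x) (sqBall n ρ) := by
  obtain ⟨M, -, hM⟩ := exists_bound_sqBall ρ f.continuous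
  refine Integrable.mul_bdd (c := M) (integrableOn_bump_rpow ha)
    f.continuous.aestronglyMeasurable ?_
  filter_upwards [ae_restrict_mem (measurableSet_sqBall ρ)] with x hx using hM x hx

theorem lintegral_bump_rpow_mul {ρ a : ℝ} (ha : -1 < a) {f : SmoothFn n} (hf : ∀ x, 0 ≤ f x) :
    ∫⁻ x in sqBall n ρ, ENNReal.ofReal (bump ρ x ^ a * f x) =
      ENNReal.ofReal (ballInt ρ a ha f) := by
  rw [ballInt_apply, integral_ballMeasure, ofReal_integral_eq_lintegral_ofReal
    (integrableOn_bump_rpow_mul ha f)]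
  filter_upwards [ae_restrict_mem (measurableSet_sqBall ρ)] with x hx
  exact mul_nonneg (Real.rpow_nonneg (bump_pos_iff.2 hx).le _) (hf x)

theorem le_lintegral_rpow_kernel {ρ₀ y s C : ℝ} (hs : 0 < s) (hs1 : s ≤ 1)
    (hy : 0 ≤ y) (hyρ : y < ρ₀)
    (hC0 : 0 ≤ C) {G : ℝ → ℝ} (hG : Continuous G) (hG0 : ∀ z ∈ Icc 0 ρ₀, 0 ≤ G z)
    (hC : ∀ y ∈ Icc 0 ρ₀, ∀ z ∈ Icc 0 ρ₀, y ≤ z → G y - C * (z - y) ≤ G z)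
    (hC2 : G y ≤ C * ((ρ₀ - y) / 2)) :
    ENNReal.ofReal (2 * G y - s * (2 * C + 4 * C * (1 + ρ₀) ^ 2)) ≤
      ∫⁻ z in Ioo y ρ₀, ENNReal.ofReal (G z * (s * ((z - y) / 2) ^ (s - 1))) := by
  have hint : IntegrableOn (fun z => G z * (s * ((z - y) / 2) ^ (s - 1))) (Icc y ρ₀) := by
    have h1 : IntervalIntegrable (fun z : ℝ => (z - y) ^ (s - 1)) volume y ρ₀ := by
      have := (intervalIntegral.intervalIntegrable_rpow' (a := 0) (b := ρ₀ - y)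
        (show -1 < s - 1 by linarith)).comp_sub_right y
      simpa using this
    rw [intervalIntegrable_iff_integrableOn_Icc_of_le hyρ.le] at h1
    have h2 : IntegrableOn (fun z : ℝ => (s * (1 / 2) ^ (s - 1)) * (G z * (z - y) ^ (s - 1)))
        (Icc y ρ₀) := by
      exact (h1.continuousOn_mul hG.continuousOn isCompact_Icc).const_mul _
    refine h2.congr_fun (fun z hz => ?_) measurableSet_Icc
    have : (z - y) / 2 = (1 / 2) * (z - y) := by ring
    simp only [this]
    rw [Real.mul_rpow (by norm_num) (by linarith [hz.1])]; ring
  set τ := (ρ₀ - y) / 2 with hτ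
  have hτ0 : 0 < τ := by simp only [hτ]; linarith
  let H : ℝ → ℝ := fun z => 2 * G y * ((z - y) / 2) ^ s
    - 4 * C * s / (s + 1) * ((z - y) / 2) ^ (s + 1)
  have hHc : ContinuousOn H (Icc y ρ₀) := by
    have : Continuous fun z : ℝ => (z - y) / 2 := by fun_prop
    exact ((this.rpow_const fun _ => Or.inr hs.le).const_mul _ |>.sub
      ((this.rpow_const fun _ => Or.inr (by linarith)).const_mul _)).continuousOn
  have hHd : ∀ z ∈ Ioo y ρ₀, HasDerivAt H (G y * (s * ((z - y) / 2) ^ (s - 1))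
      - 2 * C * s * ((z - y) / 2) ^ s) z := by
    intro z hz
    have hpos : 0 < (z - y) / 2 := by linarith [hz.1]
    have h0 : HasDerivAt (fun z : ℝ => (z - y) / 2) (1 / 2) z :=
      ((hasDerivAt_id z).sub_const y).div_const 2
    have h1 := (h0.rpow_const (p := s) (Or.inl hpos.ne')).const_mul (2 * G y)
    have h2 := (h0.rpow_const (p := s + 1) (Or.inl hpos.ne')).const_mul (4 * C * s / (s + 1))
    refine (h1.sub h2).congr_deriv ?_
    rw [add_sub_cancel_right]
    field_simp
    ring
  have hle := intervalIntegral.sub_le_integral_of_hasDeriv_right_of_le hyρ.le hHc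
    (fun z hz => (hHd z hz).hasDerivWithinAt) hint (fun z hz => by
      have hpos : 0 < (z - y) / 2 := by linarith [hz.1]
      have h1 := hC y ⟨hy, hyρ.le⟩ z ⟨hy.trans hz.1.le, hz.2.le⟩ hz.1.le
      have h2 : ((z - y) / 2) ^ s = ((z - y) / 2) * ((z - y) / 2) ^ (s - 1) := by
        rw [← Real.rpow_one_add' hpos.le (by linarith)]; congr 1; ring
      rw [h2]
      have h3 : 0 ≤ s * ((z - y) / 2) ^ (s - 1) := by positivity
      nlinarith [mul_le_mul_of_nonneg_right h1 h3])
  have hHy : H y = 0 := by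
    simp only [H, sub_self, zero_div]
    rw [Real.zero_rpow hs.ne', Real.zero_rpow (by linarith)]; ring
  have hHρ : 2 * G y - s * (2 * C + 4 * C * (1 + ρ₀) ^ 2) ≤ H ρ₀ := by
    have hGy := hG0 y ⟨hy, hyρ.le⟩
    have h1 : 1 - s / τ ≤ τ ^ s := by
      rw [Real.rpow_def_of_pos hτ0]
      have h2 := Real.add_one_le_exp (Real.log τ * s)
      have h3 := Real.one_sub_inv_le_log_of_pos hτ0
      have h4 := mul_le_mul_of_nonneg_right h3 hs.le
      have : s / τ = τ⁻¹ * s := by ring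
      nlinarith
    have h2 : τ ^ (s + 1) ≤ (1 + ρ₀) ^ 2 := by
      calc τ ^ (s + 1) ≤ (1 + ρ₀) ^ (s + 1) :=
            Real.rpow_le_rpow hτ0.le (by simp only [hτ]; linarith) (by linarith)
        _ ≤ (1 + ρ₀) ^ (2 : ℝ) := Real.rpow_le_rpow_of_exponent_le (by linarith) (by linarith)
        _ = _ := by norm_num
    have h3 : 4 * C * s / (s + 1) * τ ^ (s + 1) ≤ 4 * C * s * (1 + ρ₀) ^ 2 := by
      refine mul_le_mul ?_ h2 (by positivity) (by positivity)
      exact div_le_self (by positivity) (by linarith)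
    have h4 : 2 * G y * (s / τ) ≤ 2 * C * s := by
      have : 2 * G y * (s / τ) ≤ 2 * (C * τ) * (s / τ) := by gcongr
      refine this.trans_eq ?_
      field_simp
    have h5 := mul_le_mul_of_nonneg_left h1 (mul_nonneg zero_le_two hGy)
    change _ ≤ 2 * G y * τ ^ s - 4 * C * s / (s + 1) * τ ^ (s + 1)
    nlinarith
  have hfin : 2 * G y - s * (2 * C + 4 * C * (1 + ρ₀) ^ 2) ≤
      ∫ z in Ioo y ρ₀, G z * (s * ((z - y) / 2) ^ (s - 1)) := by
    rw [← integral_Ioc_eq_integral_Ioo, ← intervalIntegral.integral_of_le hyρ.le]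
    linarith
  refine (ENNReal.ofReal_le_ofReal hfin).trans_eq ?_
  refine ofReal_integral_eq_lintegral_ofReal (hint.mono_set Ioo_subset_Icc_self) ?_
  filter_upwards [ae_restrict_mem measurableSet_Ioo] with z hz
  have h1 := hG0 z ⟨hy.trans hz.1.le, hz.2.le⟩
  have h2 : 0 ≤ (z - y) / 2 := by linarith [hz.1]
  show 0 ≤ G z * (s * ((z - y) / 2) ^ (s - 1))
  positivity

theorem lintegral_rpow_kernel_le {ρ₀ y s : ℝ} (hs : 0 < s) (hy : 0 ≤ y) (hyρ : y < ρ₀)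
    {F G : ℝ → ℝ} (hF : Continuous F) (hG : Continuous G)
    (hFG : ∀ z ∈ Ioo 0 ρ₀, HasDerivAt F (-G z) z) (hF0 : F ρ₀ = 0)
    (hG0 : ∀ z ∈ Icc 0 ρ₀, 0 ≤ G z) :
    ∫⁻ z in Ioo y ρ₀, ENNReal.ofReal (G z * ((z - y) / 2) ^ s) ≤
      ENNReal.ofReal ((ρ₀ / 2) ^ s * F y) := by
  have h1 : ∫ z in Ioo y ρ₀, (ρ₀ / 2) ^ s * G z = (ρ₀ / 2) ^ s * F y := by
    rw [← integral_Ioc_eq_integral_Ioo, ← intervalIntegral.integral_of_le hyρ.le,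
      intervalIntegral.integral_const_mul]
    have := intervalIntegral.integral_eq_sub_of_hasDerivAt_of_le hyρ.le
      (f := fun z => -F z) (f' := G) hF.neg.continuousOn
      (fun z hz => (hFG z ⟨hy.trans_lt hz.1, hz.2⟩).neg.congr_deriv (neg_neg _))
      (hG.intervalIntegrable _ _)
    rw [this, hF0]; ring
  have hρ : 0 ≤ ρ₀ / 2 := by linarith
  rw [← h1, ofReal_integral_eq_lintegral_ofReal]
  · refine setLIntegral_mono' measurableSet_Ioo fun z hz => ENNReal.ofReal_le_ofReal ?_
    rw [mul_comm]
    refine mul_le_mul_of_nonneg_right ?_ (hG0 z ⟨hy.trans hz.1.le, hz.2.le⟩)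
    exact Real.rpow_le_rpow (by linarith [hz.1]) (by linarith [hz.2]) hs.le
  · exact ((hG.const_mul _).integrableOn_Icc (a := y) (b := ρ₀)).mono_set Ioo_subset_Icc_self
  · filter_upwards [ae_restrict_mem measurableSet_Ioo] with z hz
    exact mul_nonneg (Real.rpow_nonneg hρ _) (hG0 z ⟨hy.trans hz.1.le, hz.2.le⟩)

end BallPoincare

noncomputable section LayerCake

open SmoothFn Filter Topology

variable {n : ℕ}

/-- Integrating over the radius: the inner integral is over the radii exceeding `‖x‖ ^ 2`. -/
theorem lintegral_radius_swap {ρ₀ : ℝ} {k : ℝ → EuclideanSpace ℝ (Fin n) → ℝ≥0∞}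
    (hk : Measurable (Function.uncurry k)) :
    ∫⁻ ρ in Ioo 0 ρ₀, ∫⁻ x in sqBall n ρ, k ρ x =
      ∫⁻ x in sqBall n ρ₀, ∫⁻ ρ in Ioo (‖x‖ ^ 2) ρ₀, k ρ x := by
  set S : Set (ℝ × EuclideanSpace ℝ (Fin n)) := {p | ‖p.2‖ ^ 2 < p.1} with hS
  have hSm : MeasurableSet S := by
    refine measurableSet_lt ?_ ?_ <;> fun_prop
  have hSmem : ∀ ρ x, (ρ, x) ∈ S ↔ ‖x‖ ^ 2 < ρ := fun ρ x => Iff.rfl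
  have h1 : ∀ ρ, ∫⁻ x in sqBall n ρ, k ρ x =
      ∫⁻ x, S.indicator (Function.uncurry k) (ρ, x) := fun ρ => by
    rw [← lintegral_indicator (measurableSet_sqBall ρ)]
    refine lintegral_congr fun x => ?_
    by_cases hx : x ∈ sqBall n ρ
    · rw [indicator_of_mem hx, indicator_of_mem ((hSmem ρ x).2 (mem_sqBall.1 hx))]; rfl
    · rw [indicator_of_notMem hx,
        indicator_of_notMem fun h => hx (mem_sqBall.2 ((hSmem ρ x).1 h))]
  simp only [h1]
  rw [lintegral_lintegral_swap (f := fun ρ x => S.indicator (Function.uncurry k) (ρ, x))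
      (hk.indicator hSm).aemeasurable,
    ← lintegral_indicator (measurableSet_sqBall ρ₀)]
  refine lintegral_congr fun x => ?_
  have h2 : ∀ ρ, S.indicator (Function.uncurry k) (ρ, x) =
      (Ioi (‖x‖ ^ 2)).indicator (fun ρ => k ρ x) ρ := fun ρ => by
    by_cases h : ‖x‖ ^ 2 < ρ
    · rw [indicator_of_mem ((hSmem ρ x).2 h), indicator_of_mem (mem_Ioi.2 h)]; rfl
    · rw [indicator_of_notMem fun h' => h ((hSmem ρ x).1 h'),
        indicator_of_notMem fun h' => h (mem_Ioi.1 h')]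
  simp only [h2]
  rw [lintegral_indicator measurableSet_Ioi, Measure.restrict_restrict measurableSet_Ioi]
  by_cases hx : x ∈ sqBall n ρ₀
  · rw [indicator_of_mem hx]
    congr 2
    ext ρ
    simp only [mem_inter_iff, mem_Ioi, mem_Ioo]
    constructor
    · rintro ⟨h1, h2, h3⟩; exact ⟨h1, h3⟩
    · rintro ⟨h1, h3⟩; exact ⟨h1, (sq_nonneg _).trans_lt h1, h3⟩
  · rw [indicator_of_notMem hx]
    have : Ioi (‖x‖ ^ 2) ∩ Ioo 0 ρ₀ = ∅ := by
      ext ρ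
      simp only [mem_inter_iff, mem_Ioi, mem_Ioo, mem_empty_iff_false, iff_false]
      rintro ⟨h1, -, h3⟩
      exact hx (mem_sqBall.2 (h1.trans h3))
    rw [this]; simp

theorem integrableOn_sqBall_of_continuous {ρ : ℝ} {f : EuclideanSpace ℝ (Fin n) → ℝ}
    (hf : Continuous f) : IntegrableOn f (sqBall n ρ) := by
  rw [sqBall_eq_ball]
  exact (hf.continuousOn.integrableOn_compact (isCompact_closedBall 0 _)).mono_set
    Metric.ball_subset_closedBall

theorem integral_layer_le {ρ₀ C : ℝ} (hC0 : 0 ≤ C) {F G : ℝ → ℝ}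
    (hF : Continuous F) (hG : Continuous G)
    (hFG : ∀ z ∈ Ioo 0 ρ₀, HasDerivAt F (-G z) z) (hF0 : F ρ₀ = 0)
    (hFnn : ∀ z ∈ Icc 0 ρ₀, 0 ≤ F z) (hG0 : ∀ z ∈ Icc 0 ρ₀, 0 ≤ G z)
    (hC : ∀ y ∈ Icc 0 ρ₀, ∀ z ∈ Icc 0 ρ₀, y ≤ z → G y - C * (z - y) ≤ G z)
    (hC2 : ∀ y ∈ Icc 0 ρ₀, G y ≤ C * ((ρ₀ - y) / 2)) {A B : SmoothFn n} (hA : ∀ x, 0 ≤ A x)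
    (hB : ∀ x, 0 ≤ B x)
    (h : ∀ ρ ∈ Ioo 0 ρ₀, ∀ s (hs : 0 < s), s ≤ 1 →
      s * ballInt ρ (s - 1) (by linarith) A ≤ ballInt ρ s (by linarith) B) :
    ∫ x in sqBall n ρ₀, 2 * G (‖x‖ ^ 2) * A x ≤ ∫ x in sqBall n ρ₀, F (‖x‖ ^ 2) * B x := by
  have hmemIcc : ∀ x ∈ sqBall n ρ₀, ‖x‖ ^ 2 ∈ Icc 0 ρ₀ := fun x hx =>
    ⟨sq_nonneg _, (mem_sqBall.1 hx).le⟩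
  set C' := 2 * C + 4 * C * (1 + ρ₀) ^ 2 with hC'
  have hint1 : IntegrableOn (fun x => 2 * G (‖x‖ ^ 2) * A x) (sqBall n ρ₀) :=
    integrableOn_sqBall_of_continuous
      ((continuous_const.mul (hG.comp (continuous_norm.pow 2))).mul A.continuous)
  have hint2 : IntegrableOn (fun x => C' * A x) (sqBall n ρ₀) :=
    integrableOn_sqBall_of_continuous (continuous_const.mul A.continuous)
  have hint3 : IntegrableOn (fun x => F (‖x‖ ^ 2) * B x) (sqBall n ρ₀) :=
    integrableOn_sqBall_of_continuous ((hF.comp (continuous_norm.pow 2)).mul B.continuous)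
  set I1 := ∫ x in sqBall n ρ₀, 2 * G (‖x‖ ^ 2) * A x
  set I2 := ∫ x in sqBall n ρ₀, C' * A x
  set I3 := ∫ x in sqBall n ρ₀, F (‖x‖ ^ 2) * B x
  have hI3 : 0 ≤ I3 := setIntegral_nonneg (measurableSet_sqBall ρ₀) fun x hx =>
    mul_nonneg (hFnn _ (hmemIcc x hx)) (hB x)
  have key : ∀ s, 0 < s → s ≤ 1 → I1 - s * I2 ≤ (ρ₀ / 2) ^ s * I3 := by
    intro s hs hs1
    rcases (sqBall n ρ₀).eq_empty_or_nonempty with he | ⟨x₀, hx₀⟩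
    · simp [I1, I2, I3, he]
    have hρ₀ : 0 < ρ₀ := (sq_nonneg _).trans_lt (mem_sqBall.1 hx₀)
    have hE : I1 - s * I2 = ∫ x in sqBall n ρ₀, (2 * G (‖x‖ ^ 2) - s * C') * A x := by
      rw [← integral_const_mul, ← integral_sub hint1 (hint2.const_mul s)]
      exact integral_congr_ae (.of_forall fun x => by ring)
    have hR0 : 0 ≤ (ρ₀ / 2) ^ s * I3 := by positivity
    rw [← ENNReal.ofReal_le_ofReal_iff hR0, hE]
    have hL : ENNReal.ofReal (∫ x in sqBall n ρ₀, (2 * G (‖x‖ ^ 2) - s * C') * A x) ≤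
        ∫⁻ x in sqBall n ρ₀, ENNReal.ofReal ((2 * G (‖x‖ ^ 2) - s * C') * A x) := by
      have hi : Integrable (fun x => (2 * G (‖x‖ ^ 2) - s * C') * A x)
          (volume.restrict (sqBall n ρ₀)) := by
        refine (hint1.sub (hint2.const_mul s)).congr (.of_forall fun x => ?_)
        simp only [Pi.sub_apply]; ring
      rw [integral_eq_lintegral_pos_part_sub_lintegral_neg_part hi]
      refine (ENNReal.ofReal_le_ofReal (sub_le_self _ ENNReal.toReal_nonneg)).trans ?_
      exact ENNReal.ofReal_toReal_le
    refine hL.trans ?_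
    have hRR : ENNReal.ofReal ((ρ₀ / 2) ^ s * I3) =
        ∫⁻ x in sqBall n ρ₀, ENNReal.ofReal ((ρ₀ / 2) ^ s * F (‖x‖ ^ 2) * B x) := by
      rw [← integral_const_mul, ofReal_integral_eq_lintegral_ofReal (hint3.const_mul _)]
      · simp only [mul_assoc]
      · filter_upwards [ae_restrict_mem (measurableSet_sqBall ρ₀)] with x hx
        exact mul_nonneg (by positivity) (mul_nonneg (hFnn _ (hmemIcc x hx)) (hB x))
    rw [hRR]
    have hk1 : ∫⁻ x in sqBall n ρ₀, ENNReal.ofReal ((2 * G (‖x‖ ^ 2) - s * C') * A x) ≤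
        ∫⁻ x in sqBall n ρ₀, ∫⁻ ρ in Ioo (‖x‖ ^ 2) ρ₀,
          ENNReal.ofReal (G ρ * (s * ((ρ - ‖x‖ ^ 2) / 2) ^ (s - 1))) * ENNReal.ofReal (A x) := by
      refine setLIntegral_mono' (measurableSet_sqBall ρ₀) fun x hx => ?_
      rw [lintegral_mul_const' _ _ ENNReal.ofReal_ne_top, ENNReal.ofReal_mul' (hA x)]
      gcongr
      exact le_lintegral_rpow_kernel hs hs1 (sq_nonneg _) (mem_sqBall.1 hx) hC0 hG hG0 hC
        (hC2 _ (hmemIcc x hx))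
    have hk2 : ∫⁻ x in sqBall n ρ₀, ∫⁻ ρ in Ioo (‖x‖ ^ 2) ρ₀,
          ENNReal.ofReal (G ρ * ((ρ - ‖x‖ ^ 2) / 2) ^ s) * ENNReal.ofReal (B x) ≤
        ∫⁻ x in sqBall n ρ₀, ENNReal.ofReal ((ρ₀ / 2) ^ s * F (‖x‖ ^ 2) * B x) := by
      refine setLIntegral_mono' (measurableSet_sqBall ρ₀) fun x hx => ?_
      rw [lintegral_mul_const' _ _ ENNReal.ofReal_ne_top, ENNReal.ofReal_mul' (hB x)]
      gcongr
      exact lintegral_rpow_kernel_le hs (sq_nonneg _) (mem_sqBall.1 hx) hF hG hFG hF0 hG0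
    refine hk1.trans (le_trans ?_ hk2)
    have hAm := A.continuous.measurable
    have hBm := B.continuous.measurable
    have hGm := hG.measurable
    rw [← lintegral_radius_swap, ← lintegral_radius_swap]
    · refine setLIntegral_mono' measurableSet_Ioo fun ρ hρ => ?_
      have hGρ := hG0 ρ ⟨hρ.1.le, hρ.2.le⟩
      have e1 : ∀ x, ENNReal.ofReal (G ρ * (s * ((ρ - ‖x‖ ^ 2) / 2) ^ (s - 1))) *
          ENNReal.ofReal (A x) =
          ENNReal.ofReal (G ρ * s) * ENNReal.ofReal (bump ρ x ^ (s - 1) * A x) := fun x => by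
        rw [← ENNReal.ofReal_mul' (hA x), ← ENNReal.ofReal_mul (by positivity), bump_apply]
        congr 1; ring
      have e2 : ∀ x, ENNReal.ofReal (G ρ * ((ρ - ‖x‖ ^ 2) / 2) ^ s) *
          ENNReal.ofReal (B x) =
          ENNReal.ofReal (G ρ) * ENNReal.ofReal (bump ρ x ^ s * B x) := fun x => by
        rw [← ENNReal.ofReal_mul' (hB x), ← ENNReal.ofReal_mul (by positivity), bump_apply]
        congr 1; ring
      simp only [e1, e2]
      rw [lintegral_const_mul' _ _ ENNReal.ofReal_ne_top,
        lintegral_const_mul' _ _ ENNReal.ofReal_ne_top, lintegral_bump_rpow_mul (by linarith) hA,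
        lintegral_bump_rpow_mul (by linarith) hB, ENNReal.ofReal_mul hGρ, mul_assoc,
        ← ENNReal.ofReal_mul hs.le]
      gcongr
      exact h ρ hρ s hs hs1
    · unfold Function.uncurry; fun_prop
    · unfold Function.uncurry; fun_prop
  have hlim1 : Tendsto (fun s : ℝ => I1 - s * I2) (𝓝[>] 0) (𝓝 (I1 - 0 * I2)) := by
    refine (Continuous.tendsto ?_ 0).mono_left nhdsWithin_le_nhds
    fun_prop
  by_cases hρ₀ : 0 < ρ₀
  · have hlim2 : Tendsto (fun s : ℝ => (ρ₀ / 2) ^ s * I3) (𝓝[>] 0)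
        (𝓝 ((ρ₀ / 2) ^ (0 : ℝ) * I3)) := by
      refine (Continuous.tendsto ?_ 0).mono_left nhdsWithin_le_nhds
      exact (Real.continuous_const_rpow (by positivity)).mul_const _
    have := le_of_tendsto_of_tendsto hlim1 hlim2 (by
      filter_upwards [Ioc_mem_nhdsGT (show (0 : ℝ) < 1 by norm_num)] with s hs
      exact key s hs.1 hs.2)
    simpa using this
  · have he : sqBall n ρ₀ = ∅ := by
      ext x
      simp only [mem_sqBall, mem_empty_iff_false, iff_false, not_lt]
      linarith [sq_nonneg ‖x‖]
    simp [I1, I3, he]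

end LayerCake

noncomputable section OddPoincare

open SmoothFn Filter Topology

variable {n : ℕ}

/-- A smooth radial function `x ↦ ϖ (‖x‖ ^ 2)` for which `t ↦ ϖ (exp t)` is increasing and convex,
together with the first two derivatives of the profile. -/
structure RadialWeight (n : ℕ) where
  /-- the profile -/
  prof : ℝ → ℝ
  /-- the derivative of the profile -/
  prof' : ℝ → ℝ
  /-- the second derivative of the profile -/
  prof'' : ℝ → ℝ
  /-- the radial function -/
  V : SmoothFn n
  /-- the radial function with the derivative of the profile -/
  V' : SmoothFn n
  /-- the radial function with the second derivative of the profile -/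
  V'' : SmoothFn n
  V_apply : ∀ x, V x = prof (‖x‖ ^ 2)
  V'_apply : ∀ x, V' x = prof' (‖x‖ ^ 2)
  V''_apply : ∀ x, V'' x = prof'' (‖x‖ ^ 2)
  hasDerivAt : ∀ y, 0 ≤ y → HasDerivAt prof (prof' y) y
  hasDerivAt' : ∀ y, 0 ≤ y → HasDerivAt prof' (prof'' y) y
  continuousOn'' : ContinuousOn prof'' (Ici 0)
  nonneg' : ∀ y, 0 ≤ y → 0 ≤ prof' y
  convex' : ∀ y, 0 ≤ y → 0 ≤ prof' y + y * prof'' y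

variable (R : RadialWeight n)

theorem wInt_zero_eq_integral (ρ : ℝ) (φ f : SmoothFn n) :
    wInt ρ 0 (by norm_num) φ f = ∫ x in sqBall n ρ, f x * Real.exp (-φ x) := by
  rw [wInt_apply, ballInt_apply, integral_ballMeasure]
  simp only [Real.rpow_zero, one_mul, mul_apply, exp_apply, neg_apply]

theorem wInt_eq_zero_of_odd {ρ a : ℝ} (ha : -1 < a) {φ h : SmoothFn n} (hφ : reflect φ = φ)
    (hh : reflect h = -h) : wInt ρ a ha φ h = 0 := by
  have h1 := ballInt_reflect (ρ := ρ) ha (h * SmoothFn.exp (-φ))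
  have h2 : reflect (h * SmoothFn.exp (-φ)) = -(h * SmoothFn.exp (-φ)) := by
    ext x
    have e1 := congrArg (fun f : SmoothFn n => f x) hφ
    have e2 := congrArg (fun f : SmoothFn n => f x) hh
    simp only [reflect_apply, neg_apply] at e1 e2
    simp only [reflect_apply, mul_apply, neg_apply, exp_apply, e1, e2]
    ring
  rw [h2, map_neg, ← wInt_apply] at h1
  linarith

/-- Minus the derivative of `y ↦ exp (-ϖ y) * ((ρ - y) / 2) ^ 2`. -/
def RadialWeight.slope (ρ y : ℝ) : ℝ :=
  Real.exp (-R.prof y) * (R.prof' y * ((ρ - y) / 2) ^ 2 + (ρ - y) / 2)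

theorem RadialWeight.continuousOn_prof : ContinuousOn R.prof (Ici 0) := fun y hy =>
  (R.hasDerivAt y hy).continuousAt.continuousWithinAt

theorem RadialWeight.continuousOn_prof' : ContinuousOn R.prof' (Ici 0) := fun y hy =>
  (R.hasDerivAt' y hy).continuousAt.continuousWithinAt

theorem RadialWeight.exists_lipschitz_slope {ρ : ℝ} :
    ∃ C, 0 ≤ C ∧ ∀ y ∈ Icc 0 ρ, ∀ z ∈ Icc 0 ρ, |R.slope ρ z - R.slope ρ y| ≤ C * |z - y| := by
  let g : ℝ → ℝ := fun y => Real.exp (-R.prof y) * (-R.prof' y) *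
      (R.prof' y * ((ρ - y) / 2) ^ 2 + (ρ - y) / 2) + Real.exp (-R.prof y) *
      (R.prof'' y * ((ρ - y) / 2) ^ 2 + R.prof' y * (-((ρ - y) / 2)) + (-1 / 2))
  have hd : ∀ y ∈ Icc 0 ρ, HasDerivWithinAt (R.slope ρ) (g y) (Icc 0 ρ) y := by
    intro y hy
    have h0 := R.hasDerivAt y hy.1
    have h1 := R.hasDerivAt' y hy.1
    have h2 : HasDerivAt (fun y : ℝ => (ρ - y) / 2) (-1 / 2) y :=
      ((hasDerivAt_id y).const_sub ρ).div_const 2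
    have h3 := h0.neg.exp.mul ((h1.mul (h2.pow 2)).add h2)
    refine (h3.congr_deriv ?_).hasDerivWithinAt
    simp only [g, Pi.pow_apply, Pi.mul_apply, Pi.add_apply, Pi.neg_apply]
    push_cast
    ring
  have hg : ContinuousOn g (Icc 0 ρ) := by
    have s : Icc 0 ρ ⊆ Ici (0 : ℝ) := Icc_subset_Ici_self
    have c0 := R.continuousOn_prof.mono s
    have c1 := R.continuousOn_prof'.mono s
    have c2 := R.continuousOn''.mono s
    fun_prop
  obtain ⟨C, hC⟩ := isCompact_Icc.exists_bound_of_continuousOn hg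
  refine ⟨max C 0, le_max_right _ _, fun y hy z hz => ?_⟩
  exact (convex_Icc 0 ρ).norm_image_sub_le_of_norm_hasDerivWithin_le hd
    (fun y hy => (hC y hy).trans (le_max_left _ _)) hy hz

/-- Weighted Poincaré inequality for odd functions; the radial part of the weight need not be
log-concave. -/
theorem odd_poincare {ρ : ℝ} {Φ h : SmoothFn n} (hΦ : HessNonneg Φ)
    (hΦe : reflect Φ = Φ) (hh : reflect h = -h) :
    wInt ρ 0 (by norm_num) (R.V + Φ) ((C 2 * R.V' * bump ρ ^ 2 + C 2 * bump ρ) * h ^ 2) ≤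
      wInt ρ 0 (by norm_num) (R.V + Φ) (bump ρ ^ 2 * gdot h h) := by
  obtain ⟨K, hK0, hK⟩ := R.exists_lipschitz_slope (ρ := ρ)
  let F : ℝ → ℝ := fun y => Real.exp (-R.prof (max y 0)) * ((ρ - y) / 2) ^ 2
  let G : ℝ → ℝ := fun y => R.slope ρ (max y 0)
  have hmax : Continuous fun y : ℝ => max y 0 := continuous_id.max continuous_const
  have hp : Continuous fun y => R.prof (max y 0) :=
    R.continuousOn_prof.comp_continuous hmax fun y => mem_Ici.2 (le_max_right _ _)
  have hp' : Continuous fun y => R.prof' (max y 0) :=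
    R.continuousOn_prof'.comp_continuous hmax fun y => mem_Ici.2 (le_max_right _ _)
  have hF : Continuous F := by simp only [F]; fun_prop
  have hG : Continuous G := by simp only [G, RadialWeight.slope]; fun_prop
  have hGeq : ∀ y, 0 ≤ y → G y = R.slope ρ y := fun y hy => by simp only [G, max_eq_left hy]
  have hFeq : ∀ y, 0 ≤ y → F y = Real.exp (-R.prof y) * ((ρ - y) / 2) ^ 2 := fun y hy => by
    simp only [F, max_eq_left hy]
  have hFG : ∀ z ∈ Ioo 0 ρ, HasDerivAt F (-G z) z := by
    intro z hz
    have h0 := R.hasDerivAt z hz.1.le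
    have h2 : HasDerivAt (fun y : ℝ => (ρ - y) / 2) (-1 / 2) z :=
      ((hasDerivAt_id z).const_sub ρ).div_const 2
    have h3 := h0.neg.exp.mul (h2.pow 2)
    refine (h3.congr_deriv ?_).congr_of_eventuallyEq ?_
    · simp only [hGeq z hz.1.le, RadialWeight.slope, Pi.pow_apply, Pi.neg_apply]
      push_cast
      ring
    · filter_upwards [Ioi_mem_nhds hz.1] with y hy
      rw [hFeq y (le_of_lt hy)]; rfl
  have hG0 : ∀ z ∈ Icc 0 ρ, 0 ≤ G z := fun z hz => by
    rw [hGeq z hz.1, RadialWeight.slope]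
    have h1 := R.nonneg' z hz.1
    have h2 : 0 ≤ (ρ - z) / 2 := by linarith [hz.2]
    positivity
  have hnorm : ∀ x, 0 ≤ gdot h h x := gdot_self_nonneg h
  have key := integral_layer_le (n := n) (ρ₀ := ρ) (C := 2 * K) (by positivity) hF hG hFG
    (by simp [F]) (fun z hz => by simp only [F]; positivity) hG0
    (fun y hy z hz hyz => by
      rw [hGeq y hy.1, hGeq z hz.1]
      have h1 := abs_le.1 (hK y hy z hz)
      rw [abs_of_nonneg (sub_nonneg.2 hyz)] at h1
      nlinarith [mul_nonneg hK0 (sub_nonneg.2 hyz)])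
    (fun y hy => by
      rw [hGeq y hy.1]
      have h1 := abs_le.1 (hK y hy ρ ⟨hy.1.trans hy.2, le_rfl⟩)
      have h2 : R.slope ρ ρ = 0 := by simp [RadialWeight.slope]
      rw [abs_of_nonneg (sub_nonneg.2 hy.2), h2] at h1
      linarith)
    (A := h ^ 2 * SmoothFn.exp (-Φ)) (B := gdot h h * SmoothFn.exp (-Φ))
    (fun x => by simp only [mul_apply, pow_apply, exp_apply]; positivity)
    (fun x => by
      rw [mul_apply, exp_apply]; exact mul_nonneg (hnorm x) (Real.exp_pos _).le)
    (fun r hr s hs hs1 => by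
      have h1 := wInt_sq_le_gdot hr.1 (a := s - 1) (s := s) (by linarith) (by ring) hΦ
        (wInt_eq_zero_of_odd (ρ := r) (by linarith) hΦe hh)
      have h2 : s - 1 + 1 = s := by ring
      rw [wInt_apply, wInt_apply, mul_assoc, ballInt_bump_mul] at h1
      simpa only [h2] using h1)
  rw [wInt_zero_eq_integral, wInt_zero_eq_integral]
  refine (Eq.trans_le ?_ key).trans_eq ?_
  · refine setIntegral_congr_fun (measurableSet_sqBall ρ) fun x _ => ?_
    simp only [hGeq _ (sq_nonneg ‖x‖), RadialWeight.slope, mul_apply, add_apply, C_apply,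
      pow_apply, R.V'_apply, R.V_apply, bump_apply, exp_apply, neg_apply, neg_add, Real.exp_add]
    ring
  · refine setIntegral_congr_fun (measurableSet_sqBall ρ) fun x _ => ?_
    simp only [hFeq _ (sq_nonneg ‖x‖), mul_apply, add_apply,
      pow_apply, R.V_apply, bump_apply, exp_apply, neg_apply, neg_add, Real.exp_add]
    ring

end OddPoincare

noncomputable section LocalInequality

open SmoothFn Filter Topology

variable {n : ℕ} (R : RadialWeight n)

theorem SmoothFn.pd_radial {p p' : ℝ → ℝ} {f f' : SmoothFn n} (hf : ∀ x, f x = p (‖x‖ ^ 2))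
    (hf' : ∀ x, f' x = p' (‖x‖ ^ 2)) (hp : ∀ y, 0 ≤ y → HasDerivAt p (p' y) y) (i : Fin n) :
    pd i f = C 2 * X i * f' := by
  ext x
  have h1 := (hp (‖x‖ ^ 2) (by positivity)).comp_hasFDerivAt x
    (hasStrictFDerivAt_norm_sq x).hasFDerivAt
  have h2 : HasFDerivAt f.1 (p' (‖x‖ ^ 2) • (2 • innerSL ℝ x)) x :=
    h1.congr_of_eventuallyEq (Eventually.of_forall fun y => hf y)
  rw [pd_apply, h2.fderiv]
  have hi : inner ℝ x (EuclideanSpace.single i (1 : ℝ)) = x i := by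
    rw [EuclideanSpace.inner_single_right]; simp
  simp [hf', hi]
  ring

theorem RadialWeight.pd_V (i : Fin n) : pd i R.V = C 2 * X i * R.V' :=
  pd_radial R.V_apply R.V'_apply R.hasDerivAt i

theorem RadialWeight.pd_V' (i : Fin n) : pd i R.V' = C 2 * X i * R.V'' :=
  pd_radial R.V'_apply R.V''_apply R.hasDerivAt' i

theorem RadialWeight.reflect_V : reflect R.V = R.V := by
  ext x; simp [R.V_apply]

theorem RadialWeight.gdot_V (u : SmoothFn n) : gdot R.V u = C 2 * R.V' * euler u := by
  simp only [gdot, euler, R.pd_V, Finset.mul_sum]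
  exact Finset.sum_congr rfl fun i _ => by ring

theorem SmoothFn.hessGrad_eq (φ u : SmoothFn n) :
    hessGrad φ u = ∑ j, pd j u * ∑ i, pd j (pd i φ) * pd i u := by
  simp only [hessGrad, Finset.mul_sum]
  exact Finset.sum_congr rfl fun j _ => Finset.sum_congr rfl fun i _ => by ring

theorem SmoothFn.hessGrad_add (φ ψ u : SmoothFn n) :
    hessGrad (φ + ψ) u = hessGrad φ u + hessGrad ψ u := by
  simp only [hessGrad, map_add, add_mul, Finset.sum_add_distrib]

theorem RadialWeight.hessGrad_V (u : SmoothFn n) :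
    hessGrad R.V u = C 2 * R.V' * gdot u u + C 4 * R.V'' * euler u ^ 2 := by
  have h : ∀ j, ∑ i, pd j (pd i R.V) * pd i u =
      C 4 * R.V'' * (X j * euler u) + C 2 * R.V' * pd j u := by
    intro j
    have : ∀ i, pd j (pd i R.V) * pd i u = C 4 * R.V'' * (X j * (X i * pd i u)) +
        C 2 * R.V' * (if i = j then pd i u else 0) := by
      intro i
      have hC : (C 4 : SmoothFn n) = C 2 * C 2 := by ext x; norm_num
      rw [R.pd_V, pd_mul, pd_mul, R.pd_V', pd_C, pd_X, hC]
      by_cases hij : i = j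
      · subst hij; simp only [if_true]; ring
      · simp only [hij, Ne.symm hij, if_false]; ring
    simp only [this, Finset.sum_add_distrib, ← Finset.mul_sum, euler, Finset.sum_ite_eq',
      Finset.mem_univ, if_true]
  rw [hessGrad_eq]
  simp only [h, mul_add, Finset.sum_add_distrib]
  have e1 : ∑ j, pd j u * (C 4 * R.V'' * (X j * euler u)) = C 4 * R.V'' * euler u ^ 2 := by
    rw [pow_two]
    nth_rw 2 [euler]
    simp only [Finset.mul_sum, Finset.sum_mul]
    exact Finset.sum_congr rfl fun i _ => by ring
  have e2 : ∑ j, pd j u * (C 2 * R.V' * pd j u) = C 2 * R.V' * gdot u u := by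
    simp only [gdot, Finset.mul_sum]
    exact Finset.sum_congr rfl fun i _ => by ring
  rw [e1, e2]; ring

theorem SmoothFn.norm_sq_eq_sum (x : EuclideanSpace ℝ (Fin n)) : ‖x‖ ^ 2 = ∑ i, x i ^ 2 := by
  rw [EuclideanSpace.norm_sq_eq]; simp

theorem SmoothFn.euler_apply_sq_le (u : SmoothFn n) (x) :
    euler u x ^ 2 ≤ ‖x‖ ^ 2 * gdot u u x := by
  rw [gdot_self_apply, norm_sq_eq_sum]
  simp only [euler, SmoothFn.sum_apply, mul_apply, X_apply]
  exact Finset.sum_mul_sq_le_sq_mul_sq _ _ _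

theorem RadialWeight.hess_nonneg (u : SmoothFn n) (x) :
    0 ≤ R.V' x * gdot u u x + R.V'' x * euler u x ^ 2 := by
  have h1 := euler_apply_sq_le u x
  have h2 := R.convex' (‖x‖ ^ 2) (by positivity)
  have h3 := R.nonneg' (‖x‖ ^ 2) (by positivity)
  have h4 := gdot_self_nonneg u x
  rw [R.V'_apply, R.V''_apply]
  rcases le_total 0 (R.prof'' (‖x‖ ^ 2)) with h | h
  · positivity
  · nlinarith [mul_nonneg h2 h4]

/-- The `L²` estimate behind the local form of the inequality. -/
theorem wInt_degOp_sq_ge {ρ : ℝ} {Φ u : SmoothFn n} (hΦ : HessNonneg Φ)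
    (hΦe : reflect Φ = Φ) (hu : reflect u = u) (c : ℝ) :
    wInt ρ 0 (by norm_num) (R.V + Φ) (bump ρ ^ 2 * hessGrad Φ u)
      + 2 * c * wInt ρ 0 (by norm_num) (R.V + Φ) (bump ρ ^ 2 * gdot Φ u)
      - c ^ 2 * n * wInt ρ 0 (by norm_num) (R.V + Φ) (bump ρ ^ 2) ≤
    wInt ρ 0 (by norm_num) (R.V + Φ) (degOp ρ 2 (R.V + Φ) u ^ 2) := by
  have ha : (-1 : ℝ) < 0 := by norm_num
  set W := wInt (n := n) ρ 0 ha (R.V + Φ) with hW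
  set v := bump (n := n) ρ with hv
  have hWC : ∀ (r : ℝ) (f : SmoothFn n), W (C r * f) = r * W f := wInt_C_mul ha _
  have h1 := wInt_zero_degOp_two_sq ρ (R.V + Φ) u
  rw [← hW, ← hv] at h1
  have hodd : ∀ i, reflect (pd i u - C c * X i) = -(pd i u - C c * X i) := by
    intro i
    have e := pd_reflect i u
    rw [hu] at e
    ext x
    have e' := congrArg (fun f : SmoothFn n => f x) e
    simp only [neg_apply, reflect_apply] at e'
    simp only [reflect_apply, sub_apply, mul_apply, C_apply, X_apply, neg_apply, PiLp.neg_apply, e']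
    ring
  have h2 : ∑ i, W ((C 2 * R.V' * v ^ 2 + C 2 * v) * (pd i u - C c * X i) ^ 2) ≤
      ∑ i, W (v ^ 2 * gdot (pd i u - C c * X i) (pd i u - C c * X i)) :=
    Finset.sum_le_sum fun i _ => odd_poincare R hΦ hΦe (hodd i)
  rw [← map_sum, ← map_sum] at h2
  have e1 : ∑ i, v ^ 2 * gdot (pd i u - C c * X i) (pd i u - C c * X i) =
      v ^ 2 * hessSq u - C (2 * c) * (v ^ 2 * lap u) + C (c ^ 2 * n) * v ^ 2 := by
    have hx : ∀ i, gdot (pd i u - C c * X i) (pd i u - C c * X i) =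
        gdot (pd i u) (pd i u) - C (2 * c) * pd i (pd i u) + C (c ^ 2) := by
      intro i
      have hp : ∀ j, pd j (pd i u - C c * X i) = pd j (pd i u) - if j = i then C c else 0 := by
        intro j
        rw [map_sub, pd_mul, pd_C, pd_X]
        split_ifs <;> ring
      have hs : ∀ j, (pd j (pd i u) - if j = i then C c else 0) *
          (pd j (pd i u) - if j = i then C c else 0) = pd j (pd i u) * pd j (pd i u) -
          (if j = i then C (2 * c) * pd j (pd i u) else 0) + if j = i then C (c ^ 2) else 0 := by
        intro j
        have a1 : (C (2 * c) : SmoothFn n) = 2 * C c := map_mul (algebraMap ℝ _) _ _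
        have a2 : (C (c ^ 2) : SmoothFn n) = C c ^ 2 := by ext x; simp
        rw [a1, a2]
        split_ifs <;> ring
      simp only [gdot, hp, hs, Finset.sum_add_distrib, Finset.sum_sub_distrib, Finset.sum_ite_eq',
        Finset.mem_univ, if_true]
    simp only [hx, hessSq, lap, ← Finset.mul_sum, Finset.sum_add_distrib, Finset.sum_sub_distrib]
    rw [Finset.sum_const, Finset.card_univ, Fintype.card_fin]
    have a3 : (n • C (c ^ 2) : SmoothFn n) = C (c ^ 2 * n) := by
      rw [nsmul_eq_mul, mul_comm]
      exact ((map_mul (algebraMap ℝ _) _ _).trans (by rw [map_natCast]; rfl)).symm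
    rw [a3]; ring
  have e2 : ∑ i, (C 2 * R.V' * v ^ 2 + C 2 * v) * (pd i u - C c * X i) ^ 2 =
      (C 2 * R.V' * v ^ 2 + C 2 * v) * gdot u u
      - C (2 * c) * ((C 2 * R.V' * v ^ 2 + C 2 * v) * euler u)
      + (C 2 * R.V' * v ^ 2 + C 2 * v) * (C c ^ 2 * ∑ i, X i ^ 2) := by
    have a1 : (C (2 * c) : SmoothFn n) = 2 * C c := map_mul (algebraMap ℝ _) _ _
    rw [a1]
    simp only [gdot, euler, Finset.mul_sum, ← Finset.sum_add_distrib, ← Finset.sum_sub_distrib]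
    exact Finset.sum_congr rfl fun i _ => by ring
  rw [e1, e2] at h2
  simp only [map_add, map_sub, hWC] at h2
  have hD : W (v * degOp ρ 2 (R.V + Φ) u) = 0 := by
    rw [hW, hv, wInt_bump_mul]
    exact wInt_degOp _ (by norm_num) _ _
  have e3 : v * degOp ρ 2 (R.V + Φ) u = v ^ 2 * lap u - v ^ 2 * gdot Φ u
      - (C 2 * R.V' * v ^ 2 + C 2 * v) * euler u := by
    rw [degOp, drift, gdot_add_left, R.gdot_V]; ring
  rw [e3, map_sub, map_sub] at hD
  have e4 : v ^ 2 * hessGrad (R.V + Φ) u =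
      v ^ 2 * (C 2 * R.V' * gdot u u + C 4 * R.V'' * euler u ^ 2)
      + v ^ 2 * hessGrad Φ u := by rw [hessGrad_add, R.hessGrad_V]; ring
  rw [e4, map_add] at h1
  have hq : 0 ≤ W ((C 2 * R.V' * v ^ 2 + C 2 * v) * (C c ^ 2 * ∑ i, X i ^ 2)) :=
    wInt_nonneg ha _ fun x hx => by
      have := R.nonneg' (‖x‖ ^ 2) (by positivity)
      have hvx : 0 ≤ v x := (bump_pos_iff.2 hx).le
      simp only [mul_apply, SmoothFn.add_apply, C_apply, pow_apply, SmoothFn.sum_apply, X_apply,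
        R.V'_apply]
      positivity
  have hr : 0 ≤ W ((C 2 * R.V' * v ^ 2 + C 2 * v) * gdot u u + C 2 * (v * gdot u u)
      + C 2 * euler u ^ 2 + v ^ 2 * (C 2 * R.V' * gdot u u + C 4 * R.V'' * euler u ^ 2)) :=
    wInt_nonneg ha _ fun x hx => by
      have h3 := R.hess_nonneg u x
      have hvx : 0 ≤ v x := (bump_pos_iff.2 hx).le
      have h4 := gdot_self_nonneg u x
      simp only [mul_apply, SmoothFn.add_apply, C_apply, pow_apply]
      have h5 : 0 ≤ 4 * v x ^ 2 * (R.V' x * gdot u u x + R.V'' x * euler u x ^ 2) := by positivity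
      have h6 : 0 ≤ 4 * (v x * gdot u u x) + 2 * euler u x ^ 2 := by positivity
      linarith
  simp only [map_add, hWC] at hr
  rw [h1]
  have hD' : 2 * c * W (v ^ 2 * lap u) = 2 * c * W (v ^ 2 * gdot Φ u)
      + 2 * c * W ((C 2 * R.V' * v ^ 2 + C 2 * v) * euler u) := by
    linear_combination (2 * c) * hD
  linarith

end LocalInequality

noncomputable section ExponentialSums

open SmoothFn Filter Topology

variable {n : ℕ} (R : RadialWeight n)

theorem degOp_reflect (ρ s : ℝ) {φ : SmoothFn n} (hφ : reflect φ = φ) (u : SmoothFn n) :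
    degOp ρ s φ (reflect u) = reflect (degOp ρ s φ u) := by
  have h1 : ∀ i, pd i φ = -reflect (pd i φ) := fun i => by rw [← pd_reflect, hφ]
  have h2 : ∀ i : Fin n, reflect (X i) = -X i := fun i => by ext x; simp
  have h3 : reflect (bump (n := n) ρ) = bump ρ := by ext x; simp [bump_apply]
  have h4 : reflect (C (n := n) s) = C s := by ext x; simp
  have hl : lap (reflect u) = reflect (lap u) := by
    simp only [lap, map_sum, pd_reflect, map_neg, neg_neg]
  have hg : gdot φ (reflect u) = reflect (gdot φ u) := by
    simp only [gdot, map_sum, map_mul, pd_reflect]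
    exact Finset.sum_congr rfl fun i _ => by
      have h := congrArg reflect (h1 i)
      have hrr : reflect (reflect (pd i φ)) = pd i φ := by ext x; simp
      rw [map_neg, hrr] at h
      rw [h]; ring
  have he : euler (reflect u) = reflect (euler u) := by
    simp only [euler, map_sum, map_mul, pd_reflect, h2]
    exact Finset.sum_congr rfl fun i _ => by ring
  simp only [degOp, drift, hl, hg, he, map_sub, map_mul, h3, h4]

/-- Approximate solutions with a bounded weight, within even functions. -/
theorem exists_even_degOp_approx {ρ : ℝ} (hρ : 0 < ρ) {φ f : SmoothFn n} (hφ : reflect φ = φ)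
    (hfe : reflect f = f) (hf : wInt ρ 0 (by norm_num) φ (bump ρ ^ 2 * f) = 0) {δ : ℝ}
    (hδ : 0 < δ) :
    ∃ u, reflect u = u ∧
      wInt ρ 0 (by norm_num) φ ((degOp ρ 2 φ u - bump ρ * f) ^ 2) ≤ δ := by
  have ha : (-1 : ℝ) < 0 := by norm_num
  have ha1 : (-1 : ℝ) < 0 + 1 := by norm_num
  obtain ⟨M, hM, hMb⟩ := exists_bound_sqBall (n := n) ρ (SmoothFn.exp (-φ)).continuous
  obtain ⟨u, hu⟩ := exists_degOp_approx (n := n) hρ ha1 (s := 2) (by norm_num) ha (K₀ := 1)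
    zero_le_one (fun g => by
      rw [one_mul, ← ballInt_bump_mul ha]
      refine le_of_eq ?_
      congr 1; ring) φ (f := bump ρ * f) (by
      rw [← wInt_bump_mul ha, ← mul_assoc, ← pow_two]; exact hf) (δ := δ / M) (by positivity)
  refine ⟨(2⁻¹ : ℝ) • (u + reflect u), ?_, ?_⟩
  · ext x
    simp [add_comm]
  · have h3 : reflect (bump (n := n) ρ) = bump ρ := by ext x; simp [bump_apply]
    have hD : degOp ρ 2 φ ((2⁻¹ : ℝ) • (u + reflect u)) - bump ρ * f =
        (2⁻¹ : ℝ) • ((degOp ρ 2 φ u - bump ρ * f) + reflect (degOp ρ 2 φ u - bump ρ * f)) := by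
      have := (degOpLin ρ 2 φ).map_smul (2⁻¹ : ℝ) (u + reflect u)
      rw [map_add] at this
      change degOp ρ 2 φ _ = (2⁻¹ : ℝ) • (degOp ρ 2 φ u + degOp ρ 2 φ (reflect u)) at this
      rw [this, degOp_reflect ρ 2 hφ, map_sub, map_mul, h3, hfe]
      ext x
      simp
      ring
    set g := degOp ρ 2 φ u - bump ρ * f with hg
    have h4 := ballInt_reflect (ρ := ρ) ha (g ^ 2)
    rw [hD, wInt_apply]
    calc _ ≤ ballInt ρ 0 ha (C M * (C 2⁻¹ * (g ^ 2 + reflect (g ^ 2)))) :=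
          ballInt_mono ha fun x hx => by
            have h5 := (abs_le.1 (hMb x hx)).2
            simp only [mul_apply, pow_apply, SmoothFn.smul_apply, SmoothFn.add_apply, C_apply,
              reflect_apply]
            have h6 : (2⁻¹ * (g x + g (-x))) ^ 2 ≤ 2⁻¹ * (g x ^ 2 + g (-x) ^ 2) := by
              nlinarith [sq_nonneg (g x - g (-x))]
            rw [mul_comm]
            exact mul_le_mul h5 h6 (sq_nonneg _) hM.le
      _ = M * ballInt ρ 0 ha (g ^ 2) := by
          rw [ballInt_C_mul, ballInt_C_mul, map_add, h4]; ring
      _ ≤ M * (δ / M) := mul_le_mul_of_nonneg_left hu hM.le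
      _ = δ := by field_simp

theorem wInt_bump_sq_pos {ρ : ℝ} (hρ : 0 < ρ) (φ : SmoothFn n) :
    0 < wInt ρ 0 (by norm_num) φ (bump ρ ^ 2) := by
  have ha : (-1 : ℝ) < 0 := by norm_num
  obtain ⟨M, hM, hMb⟩ := exists_bound_sqBall (n := n) ρ (SmoothFn.exp φ).continuous
  have h1 : ballInt ρ 0 ha (C M⁻¹ * bump (n := n) ρ ^ 2) ≤ wInt ρ 0 ha φ (bump ρ ^ 2) :=
    ballInt_mono ha fun x hx => by
      have h2 := (abs_le.1 (hMb x hx)).2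
      rw [LinearMap.mulRight_apply]
      simp only [mul_apply, pow_apply, C_apply] at h2 ⊢
      have h4 : SmoothFn.exp (-φ) x = (Real.exp (φ x))⁻¹ := Real.exp_neg _
      rw [mul_comm, h4]
      exact mul_le_mul_of_nonneg_left (inv_anti₀ (Real.exp_pos _) h2) (sq_nonneg _)
  refine lt_of_lt_of_le ?_ h1
  have h3 : bump (n := n) ρ ^ 2 = bump ρ * (bump ρ * 1) := by ring
  rw [ballInt_C_mul, h3, ballInt_bump_mul, ballInt_bump_mul]
  exact mul_pos (inv_pos.2 hM) (ballInt_one_pos hρ _)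

section

variable {J : Type*} [Fintype J] {e : J → SmoothFn n} {a : J → Fin n → ℝ} (c : J → ℝ)

theorem pd_expSum (hpd : ∀ j i, pd i (e j) = C (a j i) * e j) (i : Fin n) :
    pd i (∑ j, C (c j) * e j) = ∑ j, C (c j) * (C (a j i) * e j) := by
  rw [map_sum]
  exact Finset.sum_congr rfl fun j _ => by rw [pd_mul, pd_C, hpd]; ring

theorem gdot_expSum (hpd : ∀ j i, pd i (e j) = C (a j i) * e j) (u : SmoothFn n) :
    gdot (∑ j, C (c j) * e j) u = ∑ j, C (c j) * e j * ∑ i, C (a j i) * pd i u := by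
  simp only [gdot, pd_expSum c hpd, Finset.sum_mul, Finset.mul_sum]
  rw [Finset.sum_comm]
  exact Finset.sum_congr rfl fun j _ => Finset.sum_congr rfl fun i _ => by ring

theorem hess_expSum (hpd : ∀ j i, pd i (e j) = C (a j i) * e j) (k i : Fin n) :
    pd k (pd i (∑ j, e j)) = ∑ j, e j * (C (a j i) * C (a j k)) := by
  simp only [map_sum, hpd, pd_mul, pd_C]
  exact Finset.sum_congr rfl fun j _ => by ring

theorem hessGrad_expSum (hpd : ∀ j i, pd i (e j) = C (a j i) * e j) (u : SmoothFn n) :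
    hessGrad (∑ j, e j) u = ∑ j, e j * (∑ i, C (a j i) * pd i u) ^ 2 := by
  simp only [hessGrad, hess_expSum hpd, Finset.sum_mul, pow_two, Finset.mul_sum]
  rw [Finset.sum_congr rfl fun k _ => Finset.sum_comm, Finset.sum_comm]
  exact Finset.sum_congr rfl fun j _ => Finset.sum_congr rfl fun i _ =>
    Finset.sum_congr rfl fun k _ => by ring

theorem hessNonneg_expSum (hpd : ∀ j i, pd i (e j) = C (a j i) * e j) (he : ∀ j x, 0 < e j x) :
    HessNonneg (∑ j, e j) := by
  intro x ξ
  have : ∑ k, ∑ i, pd k (pd i (∑ j, e j)) x * ξ i * ξ k =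
      ∑ j, e j x * (∑ i, a j i * ξ i) ^ 2 := by
    simp only [hess_expSum hpd, Finset.sum_mul, pow_two, Finset.mul_sum, SmoothFn.sum_apply,
      mul_apply, C_apply]
    rw [Finset.sum_congr rfl fun k _ => Finset.sum_comm, Finset.sum_comm]
    exact Finset.sum_congr rfl fun j _ => Finset.sum_congr rfl fun i _ =>
      Finset.sum_congr rfl fun k _ => by ring
  rw [this]
  exact Finset.sum_nonneg fun j _ => mul_nonneg (he j x).le (sq_nonneg _)

/-- The infinitesimal form of the inequality along a family of exponential sums. -/
theorem wInt_expSum_le {ρ ε : ℝ} (hρ : 0 < ρ) (hε : 0 < ε)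
    (hpd : ∀ j i, pd i (e j) = C (a j i) * e j) (he : ∀ j x, 0 < e j x)
    (hΦe : reflect (∑ j, e j) = ∑ j, e j)
    (hΦ1e : reflect (∑ j, C (c j) * e j) = ∑ j, C (c j) * e j)
    (hb : wInt ρ 0 (by norm_num) (R.V + ∑ j, e j) (bump ρ ^ 2 * ∑ j, e j) ≤
      ε * wInt ρ 0 (by norm_num) (R.V + ∑ j, e j) (bump ρ ^ 2)) :
    wInt ρ 0 (by norm_num) (R.V + ∑ j, e j) (bump ρ ^ 2) *
      (wInt ρ 0 (by norm_num) (R.V + ∑ j, e j) (bump ρ ^ 2 * (∑ j, C (c j) * e j) ^ 2) -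
        wInt ρ 0 (by norm_num) (R.V + ∑ j, e j) (bump ρ ^ 2 * ∑ j, C (c j ^ 2) * e j)) ≤
      (1 - 1 / (n + ε)) *
        wInt ρ 0 (by norm_num) (R.V + ∑ j, e j) (bump ρ ^ 2 * ∑ j, C (c j) * e j) ^ 2 := by
  have ha : (-1 : ℝ) < 0 := by norm_num
  set Φ := ∑ j, e j with hΦ
  set Φ₁ := ∑ j, C (c j) * e j with hΦ₁
  set Φ₂ := ∑ j, C (c j ^ 2) * e j with hΦ₂
  set W := wInt (n := n) ρ 0 ha (R.V + Φ) with hW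
  set v := bump (n := n) ρ with hv
  have hWC : ∀ (r : ℝ) (f : SmoothFn n), W (C r * f) = r * W f := wInt_C_mul ha _
  have hφe : reflect (R.V + Φ) = R.V + Φ := by rw [map_add, R.reflect_V, hΦe]
  have hN : 0 < W (v ^ 2) := wInt_bump_sq_pos hρ _
  set N := W (v ^ 2) with hNdef
  set A := W (v ^ 2 * Φ₁) / N with hA
  have hAN : W (v ^ 2 * Φ₁) = A * N := by rw [hA]; field_simp
  have hκ : (0 : ℝ) < n + ε := by positivity
  set f := Φ₁ - C A with hf
  have hfe : reflect f = f := by rw [hf, map_sub, hΦ1e]; congr 1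
  have hf0 : W (v ^ 2 * f) = 0 := by
    rw [hf, mul_sub, map_sub, mul_comm (v ^ 2) (C A), hWC, hAN]; ring
  have hf2 : W (v ^ 2 * f ^ 2) = W (v ^ 2 * Φ₁ ^ 2) - A ^ 2 * N := by
    have : v ^ 2 * f ^ 2 = v ^ 2 * Φ₁ ^ 2 - C A * (v ^ 2 * Φ₁) - C A * (v ^ 2 * f) := by
      rw [hf]; ring
    rw [this, map_sub, map_sub, hWC, hWC, hf0, hAN]; ring
  suffices h : W (v ^ 2 * Φ₁ ^ 2) - W (v ^ 2 * Φ₂) ≤ A ^ 2 * N * (1 - 1 / (n + ε)) by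
    calc _ ≤ N * (A ^ 2 * N * (1 - 1 / (n + ε))) := mul_le_mul_of_nonneg_left h hN.le
      _ = _ := by rw [hAN]; ring
  refine le_of_forall_pos_le_add fun δ hδ => ?_
  obtain ⟨u, hue, hu⟩ := exists_even_degOp_approx hρ hφe hfe hf0 hδ
  rw [← hW, ← hv] at hu
  set D := degOp ρ 2 (R.V + Φ) u with hD
  set r : ℝ := A / (n + ε) with hr
  have k1 := wInt_degOp_sq_ge R (ρ := ρ) (hessNonneg_expSum hpd he) hΦe hue (-r)
  rw [← hΦ, ← hW, ← hv, ← hD, ← hNdef] at k1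
  have k2 : W (v * f * D) = -W (v ^ 2 * gdot Φ₁ u) := by
    have h1 := wInt_mul_degOp (ρ := ρ) (s := 2) (a := 0 + 1) (by norm_num) (by norm_num)
      (R.V + Φ) f u
    rw [← wInt_bump_mul ha, ← wInt_bump_mul ha, ← hW, ← hv, ← hD] at h1
    have h2 : gdot f u = gdot Φ₁ u := by
      rw [hf, gdot_sub_left]
      simp [gdot]
    rw [mul_assoc, h1, h2]
    congr 2; ring
  have k3 : W ((D - v * f) ^ 2) = W (D ^ 2) - 2 * W (v * f * D) + W (v ^ 2 * f ^ 2) := by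
    have : (D - v * f) ^ 2 = D ^ 2 - C 2 * (v * f * D) + v ^ 2 * f ^ 2 := by
      have C2 : (C 2 : SmoothFn n) = 2 := rfl
      rw [C2]; ring
    rw [this, map_add, map_sub, hWC]
  have k4 : 0 ≤ W (v ^ 2 * Φ₂) + 2 * W (v ^ 2 * gdot Φ₁ u) + W (v ^ 2 * hessGrad Φ u)
      - 2 * r * (W (v ^ 2 * gdot Φ u) + W (v ^ 2 * Φ₁)) + r ^ 2 * W (v ^ 2 * Φ) := by
    have h1 : 0 ≤ W (v ^ 2 * ∑ j, e j * ((∑ i, C (a j i) * pd i u) + C (c j) - C r) ^ 2) :=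
      wInt_nonneg ha _ fun x _ => by
        simp only [mul_apply, pow_apply, SmoothFn.sum_apply]
        exact mul_nonneg (sq_nonneg _)
          (Finset.sum_nonneg fun j _ => mul_nonneg (he j x).le (sq_nonneg _))
    have hΦ' : Φ = ∑ j, C 1 * e j := by simp only [C_one, one_mul]; rfl
    have hg : gdot Φ u = ∑ j, C 1 * e j * ∑ i, C (a j i) * pd i u := by
      rw [hΦ', gdot_expSum (fun _ => 1) hpd]
    have h2 : v ^ 2 * ∑ j, e j * ((∑ i, C (a j i) * pd i u) + C (c j) - C r) ^ 2 =
        v ^ 2 * Φ₂ + C 2 * (v ^ 2 * gdot Φ₁ u) + v ^ 2 * hessGrad Φ u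
        - C (2 * r) * (v ^ 2 * gdot Φ u + v ^ 2 * Φ₁) + C (r ^ 2) * (v ^ 2 * Φ) := by
      rw [hg, hΦ₁, gdot_expSum c hpd, hΦ, hessGrad_expSum hpd, hΦ₂]
      simp only [Finset.mul_sum, ← Finset.sum_add_distrib, ← Finset.sum_sub_distrib]
      have a1 : (C (2 * r) : SmoothFn n) = C 2 * C r := map_mul (algebraMap ℝ _) _ _
      have a2 : ∀ t : ℝ, (C (t ^ 2) : SmoothFn n) = C t ^ 2 := fun t => map_pow (algebraMap ℝ _) _ _
      have C2 : (C 2 : SmoothFn n) = 2 := rfl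
      refine Finset.sum_congr rfl fun j _ => ?_
      rw [a1, a2, a2, C2, C_one]
      simp only [← Finset.mul_sum]
      ring
    rw [h2] at h1
    simpa only [map_add, map_sub, hWC] using h1
  have k5 : r ^ 2 * W (v ^ 2 * Φ) ≤ r ^ 2 * (ε * N) := mul_le_mul_of_nonneg_left hb (sq_nonneg r)
  have k6 : r ^ 2 * (n + ε) * N - 2 * r * (A * N) = - (A ^ 2 * N * (1 / (n + ε))) := by
    rw [hr]; field_simp; ring
  rw [hAN] at k4
  have : W (v ^ 2 * Φ₁ ^ 2) - A ^ 2 * N ≤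
      W (v ^ 2 * Φ₂) + (r ^ 2 * (n + ε) * N - 2 * r * (A * N)) + δ := by
    rw [← hf2]
    nlinarith
  rw [k6] at this
  linarith

end

end ExponentialSums

noncomputable section ConcavityAlongPath

open SmoothFn Filter Topology

variable {n : ℕ} (R : RadialWeight n)

theorem concaveOn_rpow_of_deriv {M M' M'' : ℝ → ℝ} {κ : ℝ} (hκ : 0 < κ)
    (h0 : ∀ t ∈ Icc (0 : ℝ) 1, 0 < M t) (h1 : ∀ t ∈ Icc (0 : ℝ) 1, HasDerivAt M (M' t) t)
    (h2 : ∀ t ∈ Icc (0 : ℝ) 1, HasDerivAt M' (M'' t) t)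
    (h : ∀ t ∈ Icc (0 : ℝ) 1, M t * M'' t ≤ (1 - 1 / κ) * M' t ^ 2) :
    ConcaveOn ℝ (Icc 0 1) fun t => M t ^ (1 / κ) := by
  have hint : interior (Icc (0 : ℝ) 1) ⊆ Icc 0 1 := interior_subset
  refine concaveOn_of_hasDerivWithinAt2_nonpos (convex_Icc 0 1)
    (f' := fun t => M' t * (1 / κ) * M t ^ (1 / κ - 1))
    (f'' := fun t => M'' t * (1 / κ) * M t ^ (1 / κ - 1) +
      M' t * (1 / κ) * (M' t * (1 / κ - 1) * M t ^ (1 / κ - 1 - 1)))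
    ?_ ?_ ?_ ?_
  · intro t ht
    exact ((h1 t ht).rpow_const (Or.inl (h0 t ht).ne')).continuousAt.continuousWithinAt
  · intro t ht
    exact ((h1 t (hint ht)).rpow_const (Or.inl (h0 t (hint ht)).ne')).hasDerivWithinAt
  · intro t ht
    exact (((h2 t (hint ht)).mul_const _).mul
      ((h1 t (hint ht)).rpow_const (Or.inl (h0 t (hint ht)).ne'))).hasDerivWithinAt
  · intro t ht
    have hM := h0 t (hint ht)
    have e : M t ^ (1 / κ - 1) = M t * M t ^ (1 / κ - 1 - 1) := by
      nth_rw 2 [← Real.rpow_one (M t)]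
      rw [← Real.rpow_add hM]; congr 1; ring
    rw [e]
    have h3 : 0 < M t ^ (1 / κ - 1 - 1) := Real.rpow_pos_of_pos hM _
    have h4 := h t (hint ht)
    have h5 : 0 ≤ (1 / κ) * M t ^ (1 / κ - 1 - 1) := by positivity
    nlinarith [mul_nonneg h5 (sub_nonneg.2 h4)]

theorem hasDerivAt_integral_sqBall {ρ : ℝ} {F F' : ℝ → EuclideanSpace ℝ (Fin n) → ℝ}
    (hF : Continuous (Function.uncurry F)) (hF' : Continuous (Function.uncurry F'))
    (h : ∀ t x, HasDerivAt (fun t => F t x) (F' t x) t) (t : ℝ) :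
    HasDerivAt (fun t => ∫ x in sqBall n ρ, F t x) (∫ x in sqBall n ρ, F' t x) t := by
  have hc : ∀ t, Continuous (F t) := fun t => hF.comp (Continuous.prodMk_right t)
  have hc' : ∀ t, Continuous (F' t) := fun t => hF'.comp (Continuous.prodMk_right t)
  obtain ⟨M, hM⟩ := ((isCompact_Icc (a := t - 1) (b := t + 1)).prod
    (isCompact_closedBall (0 : EuclideanSpace ℝ (Fin n)) √ρ)).exists_bound_of_continuousOn
    hF'.continuousOn
  refine (hasDerivAt_integral_of_dominated_loc_of_deriv_le (bound := fun _ => M)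
    (Icc_mem_nhds (by linarith : t - 1 < t) (by linarith : t < t + 1))
    (Eventually.of_forall fun s => (hc s).aestronglyMeasurable)
    (integrableOn_sqBall_of_continuous (hc t)) (hc' t).aestronglyMeasurable ?_
    (integrableOn_sqBall_of_continuous continuous_const) ?_).2
  · filter_upwards [ae_restrict_mem (measurableSet_sqBall ρ)] with x hx s hs
    refine hM (s, x) ⟨hs, ?_⟩
    rw [mem_closedBall_zero_iff]
    exact Real.le_sqrt_of_sq_le (mem_sqBall.1 hx).le
  · exact Eventually.of_forall fun x s _ => h s x

namespace SmoothFn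

/-- The function `x ↦ exp (⟨a, x⟩ + β)`. -/
def expFn (a : EuclideanSpace ℝ (Fin n)) (β : ℝ) : SmoothFn n :=
  SmoothFn.exp (∑ i, C (a i) * X i + C β)

theorem expFn_apply (a : EuclideanSpace ℝ (Fin n)) (β : ℝ) (x) :
    expFn a β x = Real.exp (inner ℝ a x + β) := by
  rw [expFn, exp_apply, SmoothFn.add_apply, SmoothFn.sum_apply, C_apply, PiLp.inner_apply]
  simp [mul_comm]

theorem pd_expFn (a : EuclideanSpace ℝ (Fin n)) (β : ℝ) (i : Fin n) :
    pd i (expFn a β) = C (a i) * expFn a β := by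
  have : pd i (∑ j, C (a j) * X j + C β) = C (a i) := by
    rw [map_add, map_sum, pd_C, add_zero]
    simp [pd_X]
  rw [expFn, pd_exp, this, mul_comm]

theorem reflect_expFn (a : EuclideanSpace ℝ (Fin n)) (β : ℝ) :
    reflect (expFn a β) = expFn (-a) β := by
  ext x; simp [expFn_apply]

end SmoothFn

section

variable {J : Type*} [Fintype J] (a : J → EuclideanSpace ℝ (Fin n)) (b c : J → ℝ)

/-- The weighted mass `∫ v² exp (-(V + ∑ exp (⟨a, x⟩ + b + c t)))`. -/
def pathMass (ρ t : ℝ) : ℝ :=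
  wInt ρ 0 (by norm_num) (R.V + ∑ j, expFn (a j) (b j + c j * t)) (bump ρ ^ 2)

theorem concaveOn_pathMass {ρ ε : ℝ} (hρ : 0 < ρ) (hε : 0 < ε) (σ : Equiv.Perm J)
    (ha : ∀ j, a (σ j) = - a j) (hb : ∀ j, b (σ j) = b j) (hc : ∀ j, c (σ j) = c j)
    (h : ∀ t ∈ Icc (0 : ℝ) 1,
      wInt ρ 0 (by norm_num) (R.V + ∑ j, expFn (a j) (b j + c j * t))
        (bump ρ ^ 2 * ∑ j, expFn (a j) (b j + c j * t)) ≤ ε * pathMass R a b c ρ t) :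
    ConcaveOn ℝ (Icc 0 1) fun t => pathMass R a b c ρ t ^ (1 / (n + ε)) := by
  let Φ : ℝ → SmoothFn n := fun t => ∑ j, expFn (a j) (b j + c j * t)
  let Φ₁ : ℝ → SmoothFn n := fun t => ∑ j, C (c j) * expFn (a j) (b j + c j * t)
  let Φ₂ : ℝ → SmoothFn n := fun t => ∑ j, C (c j ^ 2) * expFn (a j) (b j + c j * t)
  have dΦ : ∀ t x, HasDerivAt (fun t => Φ t x) (Φ₁ t x) t := fun t x => by
    simp only [Φ, Φ₁, SmoothFn.sum_apply, mul_apply, C_apply, expFn_apply]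
    refine HasDerivAt.fun_sum fun j _ => ?_
    have := ((((hasDerivAt_id t).const_mul (c j)).const_add (b j)).const_add (inner ℝ (a j) x)).exp
    simpa [mul_comm] using this
  have dΦ₁ : ∀ t x, HasDerivAt (fun t => Φ₁ t x) (Φ₂ t x) t := fun t x => by
    simp only [Φ₁, Φ₂, SmoothFn.sum_apply, mul_apply, C_apply, expFn_apply]
    refine HasDerivAt.fun_sum fun j _ => ?_
    have := ((((hasDerivAt_id t).const_mul (c j)).const_add (b j)).const_add
      (inner ℝ (a j) x)).exp.const_mul (c j)
    refine this.congr_deriv ?_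
    simp; ring
  have cΦ : Continuous fun p : ℝ × EuclideanSpace ℝ (Fin n) => Φ p.1 p.2 := by
    simp only [Φ, SmoothFn.sum_apply, expFn_apply]; fun_prop
  have cΦ₁ : Continuous fun p : ℝ × EuclideanSpace ℝ (Fin n) => Φ₁ p.1 p.2 := by
    simp only [Φ₁, SmoothFn.sum_apply, mul_apply, C_apply, expFn_apply]; fun_prop
  have cΦ₂ : Continuous fun p : ℝ × EuclideanSpace ℝ (Fin n) => Φ₂ p.1 p.2 := by
    simp only [Φ₂, SmoothFn.sum_apply, mul_apply, C_apply, expFn_apply]; fun_prop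
  have cv : Continuous fun x => bump (n := n) ρ x := (bump ρ).continuous
  have cV : Continuous fun x => R.V x := R.V.continuous
  have hM' : ∀ t, HasDerivAt (pathMass R a b c ρ)
      (- wInt ρ 0 (by norm_num) (R.V + Φ t) (bump ρ ^ 2 * Φ₁ t)) t := by
    intro t
    have := hasDerivAt_integral_sqBall (n := n) (ρ := ρ)
      (F := fun t x => bump ρ x ^ 2 * Real.exp (-(R.V x + Φ t x)))
      (F' := fun t x => -(bump ρ x ^ 2 * Φ₁ t x * Real.exp (-(R.V x + Φ t x))))
      (by simp only [Function.uncurry_def]; fun_prop)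
      (by simp only [Function.uncurry_def]; fun_prop)
      (fun t x => by
        refine ((((dΦ t x).const_add (R.V x)).neg.exp).const_mul (bump ρ x ^ 2)).congr_deriv ?_
        simp only [Pi.neg_apply]; ring) t
    rw [wInt_zero_eq_integral, ← integral_neg]
    refine this.congr_of_eventuallyEq (Eventually.of_forall fun s => ?_)
    rw [pathMass, wInt_zero_eq_integral]
    rfl
  have hM'' : ∀ t, HasDerivAt (fun t => - wInt ρ 0 (by norm_num) (R.V + Φ t) (bump ρ ^ 2 * Φ₁ t))
      (wInt ρ 0 (by norm_num) (R.V + Φ t) (bump ρ ^ 2 * Φ₁ t ^ 2) -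
        wInt ρ 0 (by norm_num) (R.V + Φ t) (bump ρ ^ 2 * Φ₂ t)) t := by
    intro t
    have := hasDerivAt_integral_sqBall (n := n) (ρ := ρ)
      (F := fun t x => -(bump ρ x ^ 2 * Φ₁ t x * Real.exp (-(R.V x + Φ t x))))
      (F' := fun t x => (bump ρ x ^ 2 * Φ₁ t x ^ 2 - bump ρ x ^ 2 * Φ₂ t x) *
        Real.exp (-(R.V x + Φ t x)))
      (by simp only [Function.uncurry_def]; fun_prop)
      (by simp only [Function.uncurry_def]; fun_prop)
      (fun t x => by
        refine ((((dΦ₁ t x).const_mul (bump ρ x ^ 2)).mul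
          ((dΦ t x).const_add (R.V x)).neg.exp).neg).congr_deriv ?_
        simp only [Pi.neg_apply]; ring) t
    rw [← map_sub, wInt_zero_eq_integral]
    refine this.congr_of_eventuallyEq (Eventually.of_forall fun s => ?_)
    beta_reduce
    rw [wInt_zero_eq_integral, ← integral_neg]
    rfl
  refine concaveOn_rpow_of_deriv (by positivity) (fun t _ => wInt_bump_sq_pos hρ _)
    (fun t _ => hM' t) (fun t _ => hM'' t) fun t ht => ?_
  have hre : ∀ d : J → ℝ, (∀ j, d (σ j) = d j) →
      reflect (∑ j, C (d j) * expFn (a j) (b j + c j * t)) =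
        ∑ j, C (d j) * expFn (a j) (b j + c j * t) := by
    intro d hd
    rw [map_sum, ← Equiv.sum_comp σ]
    refine Finset.sum_congr rfl fun j _ => ?_
    rw [map_mul, reflect_expFn, ha, hb, hc, hd, neg_neg]
    rfl
  have hre1 := hre (fun _ => 1) fun _ => rfl
  simp only [C_one, one_mul] at hre1
  rw [neg_sq]
  exact wInt_expSum_le R c hρ hε (fun j i => pd_expFn _ _ i)
    (fun j x => by rw [expFn_apply]; positivity) hre1 (hre c hc) (h t ht)

end

end ConcavityAlongPath

noncomputable section Slabs

open SmoothFn Filter Topology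

variable {n : ℕ} (R : RadialWeight n)

theorem exists_wInt_expFn_le (ρ : ℝ) {d : EuclideanSpace ℝ (Fin n)} (hd : d ≠ 0) :
    ∃ K, 0 ≤ K ∧ ∀ N, 0 < N → ∀ β,
      wInt ρ 0 (by norm_num) (R.V + expFn (N • d) β) (bump ρ ^ 2 * expFn (N • d) β) ≤ K / N := by
  have ha : (-1 : ℝ) < 0 := by norm_num
  let g : SmoothFn n := ∑ i, C (d i) * (bump ρ ^ 2 * pd i R.V + C 2 * (bump ρ * X i))
  obtain ⟨M, hM, hMb⟩ := exists_bound_sqBall (n := n) ρ g.continuous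
  have hV1 : 0 ≤ wInt ρ 0 ha R.V 1 := wInt_nonneg ha _ fun x _ => by simp
  have hd' : 0 < ‖d‖ ^ 2 := by have := norm_pos_iff.2 hd; positivity
  refine ⟨M * wInt ρ 0 ha R.V 1 / ‖d‖ ^ 2, by positivity, fun N hN β => ?_⟩
  set e := expFn (N • d) β with he
  set W := wInt (n := n) ρ 0 ha (R.V + e) with hW
  have hWC : ∀ (r : ℝ) (f : SmoothFn n), W (C r * f) = r * W f := wInt_C_mul ha _
  have h1 : ∀ i, W (bump ρ ^ 2 * pd i R.V + C 2 * (bump ρ * X i)) =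
      -(N * d i) * W (bump ρ ^ 2 * e) := by
    intro i
    have h := wInt_bump_mul_pd (ρ := ρ) (a := 0 + 1) (by norm_num) (R.V + e) 1 i
    have h0 : pd i (1 : SmoothFn n) = 0 := by rw [← C_one, pd_C]
    rw [h0, mul_zero, map_zero, mul_one, mul_one, ← wInt_bump_mul ha, ← wInt_bump_mul ha, ← hW,
      map_add (pd i), he, pd_expFn, ← he] at h
    have e1 : bump ρ * (bump ρ * (pd i R.V + C ((N • d) i) * e)) =
        bump ρ ^ 2 * pd i R.V + C (N * d i) * (bump ρ ^ 2 * e) := by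
      have : (N • d) i = N * d i := rfl
      rw [this]; ring
    rw [e1, map_add, hWC] at h
    rw [map_add, hWC]
    linarith
  have h2 : W g = -(N * ‖d‖ ^ 2) * W (bump ρ ^ 2 * e) := by
    simp only [g, map_sum, hWC, h1]
    rw [norm_sq_eq_sum, Finset.mul_sum, ← Finset.sum_neg_distrib, Finset.sum_mul]
    exact Finset.sum_congr rfl fun i _ => by ring
  have h3 : -W g ≤ M * wInt ρ 0 ha R.V 1 := by
    have h4 : -W g ≤ W (C M * 1) := by
      rw [← map_neg]
      exact wInt_mono ha _ fun x hx => by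
        have := (abs_le.1 (hMb x hx)).1
        simp only [neg_apply, mul_apply, C_apply, one_apply]
        linarith
    refine h4.trans ?_
    rw [hWC]
    refine mul_le_mul_of_nonneg_left ?_ hM.le
    rw [hW, wInt_apply, wInt_apply]
    exact ballInt_mono ha fun x _ => by
      have h5 : 0 < e x := by rw [he, expFn_apply]; positivity
      simp only [one_mul, exp_apply, neg_apply, SmoothFn.add_apply]
      exact Real.exp_le_exp.2 (by linarith)
  rw [div_div, le_div_iff₀ (by positivity)]
  linarith

section

variable {ι : Type*} [Fintype ι] (d : ι → EuclideanSpace ℝ (Fin n)) (p q : ι → ℝ)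

/-- The mass of the smoothed slab `{x | |⟨dᵢ, x⟩| ≤ (1 - t) pᵢ + t qᵢ}`. -/
def slabMass (ρ N t : ℝ) : ℝ :=
  pathMass R (fun j : ι × ℤˣ => N • (((j.2 : ℤ) : ℝ) • d j.1)) (fun j => -(N * p j.1))
    (fun j => -(N * (q j.1 - p j.1))) ρ t

theorem slabMass_eq (ρ N t : ℝ) : slabMass R d p q ρ N t =
    ∫ x in sqBall n ρ, bump ρ x ^ 2 * Real.exp (-R.V x) *
      Real.exp (-∑ j : ι × ℤˣ, Real.exp (N * (((j.2 : ℤ) : ℝ) * inner ℝ (d j.1) x -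
        ((1 - t) * p j.1 + t * q j.1)))) := by
  rw [slabMass, pathMass, wInt_zero_eq_integral]
  congr 1
  ext x
  rw [pow_apply, mul_assoc, ← Real.exp_add, SmoothFn.add_apply, SmoothFn.sum_apply]
  congr 2
  rw [neg_add]
  congr 2
  refine Finset.sum_congr rfl fun j _ => ?_
  rw [expFn_apply, inner_smul_left, inner_smul_left]
  congr 1
  simp
  ring

variable {d p q}

theorem exists_slabMass_lower {ρ r : ℝ} (hr : 0 < r) (hrρ : r ≤ ρ)
    (hp : ∀ i, ∀ x ∈ sqBall n r, |inner ℝ (d i) x| ≤ p i)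
    (hq : ∀ i, ∀ x ∈ sqBall n r, |inner ℝ (d i) x| ≤ q i) :
    ∃ m, 0 < m ∧ ∀ N, 0 < N → ∀ t ∈ Icc (0 : ℝ) 1, m ≤ slabMass R d p q ρ N t := by
  refine ⟨Real.exp (-(Fintype.card (ι × ℤˣ))) * wInt r 0 (by norm_num) R.V (bump r ^ 2),
    mul_pos (Real.exp_pos _) (wInt_bump_sq_pos hr _), fun N hN t ht => ?_⟩
  rw [slabMass_eq, wInt_zero_eq_integral, ← integral_const_mul]
  have hsub : sqBall n r ⊆ sqBall n ρ := fun x hx => mem_sqBall.2 ((mem_sqBall.1 hx).trans_le hrρ)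
  have cv : ∀ ρ, Continuous fun x => bump (n := n) ρ x := fun ρ => (bump ρ).continuous
  have cV : Continuous fun x => R.V x := R.V.continuous
  have hint : IntegrableOn (fun x => bump ρ x ^ 2 * Real.exp (-R.V x) *
      Real.exp (-∑ j : ι × ℤˣ, Real.exp (N * (((j.2 : ℤ) : ℝ) * inner ℝ (d j.1) x -
        ((1 - t) * p j.1 + t * q j.1))))) (sqBall n ρ) :=
    integrableOn_sqBall_of_continuous (by have := cv ρ; fun_prop)
  refine le_trans (setIntegral_mono_on ?_ (hint.mono_set hsub) (measurableSet_sqBall r) ?_)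
    (setIntegral_mono_set hint ?_ hsub.eventuallyLE)
  · exact integrableOn_sqBall_of_continuous (by
      have := cv r
      simp only [pow_apply]; fun_prop)
  · intro x hx
    have h1 : ∑ j : ι × ℤˣ, Real.exp (N * (((j.2 : ℤ) : ℝ) * inner ℝ (d j.1) x -
        ((1 - t) * p j.1 + t * q j.1))) ≤ Fintype.card (ι × ℤˣ) := by
      rw [← nsmul_one, ← Finset.card_univ, ← Finset.sum_const]
      refine Finset.sum_le_sum fun j _ => Real.exp_le_one_iff.2 ?_
      have h2 := abs_le.1 (hp j.1 x hx)
      have h3 := abs_le.1 (hq j.1 x hx)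
      have h4 : ((j.2 : ℤ) : ℝ) * inner ℝ (d j.1) x ≤ (1 - t) * p j.1 + t * q j.1 := by
        rcases Int.units_eq_one_or j.2 with h | h <;> rw [h] <;> simp <;>
          nlinarith [ht.1, ht.2]
      exact mul_nonpos_of_nonneg_of_nonpos hN.le (by linarith)
    have h5 : bump r x ^ 2 ≤ bump ρ x ^ 2 := by
      have h6 : 0 ≤ bump r x := (bump_pos_iff.2 hx).le
      have h7 : bump r x ≤ bump ρ x := by rw [bump_apply, bump_apply]; linarith
      exact pow_le_pow_left₀ h6 h7 2
    rw [pow_apply, mul_comm]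
    refine mul_le_mul (mul_le_mul_of_nonneg_right h5 (Real.exp_pos _).le) ?_
      (Real.exp_pos _).le (by positivity)
    exact Real.exp_le_exp.2 (by linarith)
  · exact Eventually.of_forall fun x => by positivity

theorem slabMass_concave {ρ r : ℝ} (hd : ∀ i, d i ≠ 0) (hr : 0 < r) (hrρ : r ≤ ρ)
    (hp : ∀ i, ∀ x ∈ sqBall n r, |inner ℝ (d i) x| ≤ p i)
    (hq : ∀ i, ∀ x ∈ sqBall n r, |inner ℝ (d i) x| ≤ q i) :
    ∃ K, 0 < K ∧ ∀ N, 0 < N →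
      ConcaveOn ℝ (Icc 0 1) fun t => slabMass R d p q ρ N t ^ (1 / (n + K / N)) := by
  have ha : (-1 : ℝ) < 0 := by norm_num
  obtain ⟨m, hm, hmb⟩ := exists_slabMass_lower R hr hrρ hp hq
  have hsd : ∀ j : ι × ℤˣ, ((j.2 : ℤ) : ℝ) • d j.1 ≠ 0 := fun j =>
    smul_ne_zero (by exact_mod_cast j.2.ne_zero) (hd j.1)
  choose k hk0 hk using fun j => exists_wInt_expFn_le R ρ (hsd j)
  have hks : 0 ≤ ∑ j, k j := Finset.sum_nonneg fun j _ => hk0 j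
  refine ⟨(∑ j, k j + 1) / m, by positivity, fun N hN => ?_⟩
  refine concaveOn_pathMass R _ _ _ (hr.trans_le hrρ) (by positivity)
    ((Equiv.refl ι).prodCongr (Equiv.neg ℤˣ)) (fun j => ?_) (fun j => rfl) (fun j => rfl) ?_
  · simp
  intro t ht
  have h1 := hmb N hN t ht
  rw [slabMass] at h1
  have h2 : (∑ j, k j) / N ≤ (∑ j, k j + 1) / m / N * m := by
    have : (∑ j, k j + 1) / m / N * m = (∑ j, k j + 1) / N := by field_simp
    rw [this]
    gcongr; linarith
  refine le_trans ?_ (h2.trans (mul_le_mul_of_nonneg_left h1 (by positivity)))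
  rw [Finset.mul_sum, map_sum, Finset.sum_div]
  refine Finset.sum_le_sum fun j _ => le_trans ?_
    (hk j N hN (-(N * p j.1) + -(N * (q j.1 - p j.1)) * t))
  rw [wInt_apply, wInt_apply]
  refine ballInt_mono ha fun x _ => ?_
  simp only [mul_apply, pow_apply, exp_apply, neg_apply, SmoothFn.add_apply, SmoothFn.sum_apply]
  have h3 : ∀ j (β : ℝ), 0 < expFn (n := n) j β x := fun j β => by rw [expFn_apply]; positivity
  refine mul_le_mul_of_nonneg_left (Real.exp_le_exp.2 ?_) (mul_nonneg (sq_nonneg _) (h3 _ _).le)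
  have := Finset.single_le_sum (f := fun j : ι × ℤˣ => expFn (N • (((j.2 : ℤ) : ℝ) • d j.1))
    (-(N * p j.1) + -(N * (q j.1 - p j.1)) * t) x) (fun j _ => (h3 _ _).le) (Finset.mem_univ j)
  linarith

end

end Slabs

noncomputable section SlabInequality

open SmoothFn Filter Topology

variable {n : ℕ} (R : RadialWeight n) {ι : Type*} [Fintype ι] (d : ι → EuclideanSpace ℝ (Fin n))

/-- A smooth approximation of the indicator function of a symmetric slab. -/
def slabWeight (h : ι → ℝ) (N : ℝ) (x : EuclideanSpace ℝ (Fin n)) : ℝ :=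
  Real.exp (-∑ j : ι × ℤˣ, Real.exp (N * (((j.2 : ℤ) : ℝ) * inner ℝ (d j.1) x - h j.1)))

theorem slabWeight_pos (h : ι → ℝ) (N : ℝ) (x) : 0 < slabWeight d h N x := Real.exp_pos _

theorem slabWeight_le_one (h : ι → ℝ) (N : ℝ) (x) : slabWeight d h N x ≤ 1 := by
  rw [slabWeight, Real.exp_le_one_iff, neg_nonpos]
  positivity

theorem continuous_slabWeight (h : ι → ℝ) (N : ℝ) : Continuous (slabWeight d h N) := by
  unfold slabWeight
  fun_prop

theorem tendsto_slabWeight_one {h : ι → ℝ} {x} (hx : ∀ i, |inner ℝ (d i) x| < h i) :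
    Tendsto (fun k : ℕ => slabWeight d h (k + 1) x) atTop (𝓝 1) := by
  have hk : Tendsto (fun k : ℕ => (k : ℝ) + 1) atTop atTop :=
    tendsto_atTop_add_const_right _ _ tendsto_natCast_atTop_atTop
  have : Tendsto (fun k : ℕ => ∑ j : ι × ℤˣ,
      Real.exp (((k : ℝ) + 1) * (((j.2 : ℤ) : ℝ) * inner ℝ (d j.1) x - h j.1))) atTop
      (𝓝 (∑ j : ι × ℤˣ, 0)) := by
    refine tendsto_finsetSum _ fun j _ => Real.tendsto_exp_atBot.comp ?_
    refine hk.atTop_mul_const_of_neg ?_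
    have h1 := abs_lt.1 (hx j.1)
    rcases Int.units_eq_one_or j.2 with h | h <;> rw [h] <;> simp <;> linarith
  have h2 := (Real.continuous_exp.tendsto _).comp this.neg
  simp only [Finset.sum_const_zero, neg_zero, Real.exp_zero] at h2
  exact h2

theorem tendsto_slabWeight_zero {h : ι → ℝ} {x} (hx : ¬ ∀ i, |inner ℝ (d i) x| ≤ h i) :
    Tendsto (fun k : ℕ => slabWeight d h (k + 1) x) atTop (𝓝 0) := by
  have hk : Tendsto (fun k : ℕ => (k : ℝ) + 1) atTop atTop :=
    tendsto_atTop_add_const_right _ _ tendsto_natCast_atTop_atTop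
  push Not at hx
  obtain ⟨i, hi⟩ := hx
  obtain ⟨s, hs⟩ : ∃ s : ℤˣ, 0 < ((s : ℤ) : ℝ) * inner ℝ (d i) x - h i := by
    rcases lt_abs.1 hi with h1 | h1
    · exact ⟨1, by simpa using h1⟩
    · exact ⟨-1, by simp; linarith⟩
  refine Real.tendsto_exp_atBot.comp (tendsto_neg_atTop_atBot.comp ?_)
  refine tendsto_atTop_mono (fun k => ?_) (Real.tendsto_exp_atTop.comp (hk.atTop_mul_const hs))
  exact Finset.single_le_sum (f := fun j : ι × ℤˣ =>
    Real.exp (((k : ℝ) + 1) * (((j.2 : ℤ) : ℝ) * inner ℝ (d j.1) x - h j.1)))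
    (fun j _ => (Real.exp_pos _).le) (Finset.mem_univ (i, s))

/-- The density `v ^ 2 * exp (-V)`. -/
def RadialWeight.dens (ρ : ℝ) (x : EuclideanSpace ℝ (Fin n)) : ℝ :=
  bump ρ x ^ 2 * Real.exp (-R.V x)

theorem RadialWeight.dens_nonneg (ρ : ℝ) (x) : 0 ≤ R.dens ρ x := by
  unfold RadialWeight.dens; positivity

theorem RadialWeight.continuous_dens (ρ : ℝ) : Continuous (R.dens ρ) := by
  have cv : Continuous fun x => bump (n := n) ρ x := (bump ρ).continuous
  have cV : Continuous fun x => R.V x := R.V.continuous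
  unfold RadialWeight.dens
  fun_prop

/-- The part of a ball inside an open symmetric slab. -/
def openSlab (ρ : ℝ) (h : ι → ℝ) : Set (EuclideanSpace ℝ (Fin n)) :=
  sqBall n ρ ∩ ⋂ i, (fun x => |inner ℝ (d i) x|) ⁻¹' Iio (h i)

/-- The part of a ball inside a closed symmetric slab. -/
def closedSlab (ρ : ℝ) (h : ι → ℝ) : Set (EuclideanSpace ℝ (Fin n)) :=
  sqBall n ρ ∩ ⋂ i, (fun x => |inner ℝ (d i) x|) ⁻¹' Iic (h i)

theorem measurableSet_openSlab (ρ : ℝ) (h : ι → ℝ) : MeasurableSet (openSlab d ρ h) :=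
  (measurableSet_sqBall ρ).inter (MeasurableSet.iInter fun i =>
    (isOpen_Iio.preimage (by fun_prop)).measurableSet)

theorem measurableSet_closedSlab (ρ : ℝ) (h : ι → ℝ) : MeasurableSet (closedSlab d ρ h) :=
  (measurableSet_sqBall ρ).inter (MeasurableSet.iInter fun i =>
    (isClosed_Iic.preimage (by fun_prop)).measurableSet)

theorem integrableOn_dens_mul_slabWeight (ρ : ℝ) (h : ι → ℝ) (N : ℝ) :
    IntegrableOn (fun x => R.dens ρ x * slabWeight d h N x) (sqBall n ρ) :=
  integrableOn_sqBall_of_continuous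
    ((R.continuous_dens ρ).mul (continuous_slabWeight d h N))

theorem tendsto_setIntegral_slabWeight {ρ : ℝ} {h : ι → ℝ} {S : Set (EuclideanSpace ℝ (Fin n))}
    (hS : MeasurableSet S) (hSρ : S ⊆ sqBall n ρ) {l : ℝ}
    (hl : ∀ x ∈ S, Tendsto (fun k : ℕ => slabWeight d h (k + 1) x) atTop (𝓝 l)) :
    Tendsto (fun k : ℕ => ∫ x in S, R.dens ρ x * slabWeight d h (k + 1) x) atTop
      (𝓝 (∫ x in S, R.dens ρ x * l)) := by
  refine tendsto_integral_of_dominated_convergence (R.dens ρ) (fun k => ?_) ?_ (fun k => ?_) ?_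
  · exact ((R.continuous_dens ρ).mul (continuous_slabWeight d h _)).aestronglyMeasurable
  · exact (integrableOn_sqBall_of_continuous (R.continuous_dens ρ)).mono_set hSρ
  · refine Eventually.of_forall fun x => ?_
    rw [Real.norm_eq_abs, abs_of_nonneg
      (mul_nonneg (R.dens_nonneg ρ x) (slabWeight_pos d h _ x).le)]
    exact mul_le_of_le_one_right (R.dens_nonneg ρ x) (slabWeight_le_one d h _ x)
  · filter_upwards [ae_restrict_mem hS] with x hx
    exact (hl x hx).const_mul _

variable {d} {p q : ι → ℝ}

/-- The dimensional inequality for symmetric slabs. -/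
theorem slab_inequality (hn : 1 ≤ n) {ρ r : ℝ} (hd : ∀ i, d i ≠ 0) (hr : 0 < r) (hrρ : r ≤ ρ)
    (hp : ∀ i, ∀ x ∈ sqBall n r, |inner ℝ (d i) x| ≤ p i)
    (hq : ∀ i, ∀ x ∈ sqBall n r, |inner ℝ (d i) x| ≤ q i) {lam : ℝ} (hlam : lam ∈ Icc (0 : ℝ) 1) :
    (1 - lam) * (∫ x in openSlab d ρ p, R.dens ρ x) ^ ((n : ℝ)⁻¹) +
      lam * (∫ x in openSlab d ρ q, R.dens ρ x) ^ ((n : ℝ)⁻¹) ≤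
    (∫ x in closedSlab d ρ (fun i => (1 - lam) * p i + lam * q i), R.dens ρ x) ^ ((n : ℝ)⁻¹) := by
  have hn0 : (0 : ℝ) < n := by exact_mod_cast hn
  obtain ⟨K, hK, hconc⟩ := slabMass_concave R hd hr hrρ hp hq
  set h := fun i => (1 - lam) * p i + lam * q i with hh
  have hmass : ∀ N t, slabMass R d p q ρ N t =
      ∫ x in sqBall n ρ, R.dens ρ x * slabWeight d (fun i => (1 - t) * p i + t * q i) N x :=
    fun N t => slabMass_eq R d p q ρ N t
  have hexp : Tendsto (fun k : ℕ => 1 / ((n : ℝ) + K / (k + 1))) atTop (𝓝 ((n : ℝ)⁻¹)) := by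
    have h1 : Tendsto (fun k : ℕ => K / ((k : ℝ) + 1)) atTop (𝓝 0) :=
      tendsto_const_nhds.div_atTop
        (tendsto_atTop_add_const_right _ _ tendsto_natCast_atTop_atTop)
    have h2 := (h1.const_add (n : ℝ)).inv₀ (by simpa using hn0.ne')
    simpa using h2
  have hlow : ∀ h : ι → ℝ, Tendsto (fun k : ℕ => (∫ x in openSlab d ρ h,
      R.dens ρ x * slabWeight d h (k + 1) x) ^ (1 / ((n : ℝ) + K / (k + 1)))) atTop
      (𝓝 ((∫ x in openSlab d ρ h, R.dens ρ x) ^ ((n : ℝ)⁻¹))) := by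
    intro h
    have h1 := tendsto_setIntegral_slabWeight R d (h := h) (l := 1) (measurableSet_openSlab d ρ h)
      inter_subset_left fun x hx => tendsto_slabWeight_one d fun i => mem_iInter.1 hx.2 i
    simp only [mul_one] at h1
    exact h1.rpow hexp (Or.inr (by positivity))
  have hupp : Tendsto (fun k : ℕ => ((∫ x in closedSlab d ρ h, R.dens ρ x) +
      ∫ x in sqBall n ρ \ closedSlab d ρ h, R.dens ρ x * slabWeight d h (k + 1) x) ^
        (1 / ((n : ℝ) + K / (k + 1)))) atTop
      (𝓝 ((∫ x in closedSlab d ρ h, R.dens ρ x) ^ ((n : ℝ)⁻¹))) := by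
    have h1 := tendsto_setIntegral_slabWeight R d (h := h) (l := 0)
      ((measurableSet_sqBall ρ).diff (measurableSet_closedSlab d ρ h)) sdiff_subset fun x hx =>
        tendsto_slabWeight_zero d fun hc => hx.2 ⟨hx.1, mem_iInter.2 hc⟩
    simp only [mul_zero, integral_zero] at h1
    have h2 := h1.const_add (∫ x in closedSlab d ρ h, R.dens ρ x)
    rw [add_zero] at h2
    exact h2.rpow hexp (Or.inr (by positivity))
  refine le_of_tendsto_of_tendsto' (((hlow p).const_mul (1 - lam)).add ((hlow q).const_mul lam))
    hupp fun k => ?_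
  have hk : (0 : ℝ) < k + 1 := by positivity
  have hc := (hconc (k + 1) hk).2 (x := 0) (y := 1) (by simp) (by simp)
    (sub_nonneg.2 hlam.2) hlam.1 (by ring)
  simp only [smul_eq_mul, mul_zero, mul_one, zero_add] at hc
  have hpos : (0 : ℝ) ≤ 1 / ((n : ℝ) + K / (k + 1)) := by positivity
  have hnn : ∀ (h : ι → ℝ) x, 0 ≤ R.dens ρ x * slabWeight d h (k + 1) x := fun h x =>
    mul_nonneg (R.dens_nonneg ρ x) (slabWeight_pos d h _ x).le
  have hmono : ∀ (h : ι → ℝ) t, (∀ i, (1 - t) * p i + t * q i = h i) →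
      (∫ x in openSlab d ρ h, R.dens ρ x * slabWeight d h (k + 1) x) ^
        (1 / ((n : ℝ) + K / (k + 1))) ≤
      slabMass R d p q ρ (k + 1) t ^ (1 / ((n : ℝ) + K / (k + 1))) := by
    intro h t ht
    rw [hmass, funext ht]
    refine Real.rpow_le_rpow (integral_nonneg fun x => hnn h x) ?_ hpos
    exact setIntegral_mono_set (integrableOn_dens_mul_slabWeight R d ρ h _)
      (Eventually.of_forall fun x => hnn h x) inter_subset_left.eventuallyLE
  refine le_trans (add_le_add
    (mul_le_mul_of_nonneg_left (hmono p 0 fun i => by ring) (sub_nonneg.2 hlam.2))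
    (mul_le_mul_of_nonneg_left (hmono q 1 fun i => by ring) hlam.1)) (hc.trans ?_)
  rw [hmass]
  refine Real.rpow_le_rpow (integral_nonneg fun x => hnn h x) ?_ hpos
  have hint := integrableOn_dens_mul_slabWeight R d ρ h (k + 1)
  have hsplit := setIntegral_union (μ := volume)
    (f := fun x => R.dens ρ x * slabWeight d h (k + 1) x)
    (disjoint_sdiff_self_right : Disjoint (closedSlab d ρ h) (sqBall n ρ \ closedSlab d ρ h))
    ((measurableSet_sqBall ρ).diff (measurableSet_closedSlab d ρ h))
    (hint.mono_set inter_subset_left) (hint.mono_set sdiff_subset)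
  rw [union_sdiff_cancel (show closedSlab d ρ h ⊆ sqBall n ρ from inter_subset_left)] at hsplit
  rw [hsplit]
  gcongr ?_ + _
  refine setIntegral_mono (hint.mono_set inter_subset_left)
    ((integrableOn_sqBall_of_continuous (R.continuous_dens ρ)).mono_set inter_subset_left)
    fun x => mul_le_of_le_one_right (R.dens_nonneg ρ x) (slabWeight_le_one d h _ x)

end SlabInequality

noncomputable section BodyInequality

open SmoothFn Filter Topology

variable {n : ℕ}

namespace IsSymmetricConvexBody

variable {K L : Set (EuclideanSpace ℝ (Fin n))}

theorem isCompact (hK : IsSymmetricConvexBody K) : IsCompact K := hK.1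

theorem convex (hK : IsSymmetricConvexBody K) : Convex ℝ K := hK.2.1

theorem neg_mem (hK : IsSymmetricConvexBody K) {x} (hx : x ∈ K) : -x ∈ K := by
  rw [hK.2.2.2]
  simpa using hx

theorem zero_mem_interior (hK : IsSymmetricConvexBody K) :
    (0 : EuclideanSpace ℝ (Fin n)) ∈ interior K := by
  obtain ⟨x, hx⟩ := hK.2.2.1
  have hx' : -x ∈ interior K := by
    have h1 : -x ∈ -interior K := by simpa using hx
    have h2 : -interior K ⊆ interior K := by
      refine interior_maximal (fun y hy => ?_) isOpen_interior.neg
      simpa using hK.neg_mem (interior_subset hy)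
    exact h2 h1
  have := hK.convex.interior hx hx' (a := 1 / 2) (b := 1 / 2) (by norm_num) (by norm_num)
    (by norm_num)
  simpa using this

theorem exists_isMax_inner (hK : IsSymmetricConvexBody K) (d : EuclideanSpace ℝ (Fin n)) :
    ∃ y ∈ K, ∀ x ∈ K, |inner ℝ d x| ≤ inner ℝ d y := by
  obtain ⟨y, hy, hmax⟩ := hK.isCompact.exists_isMaxOn
    ⟨0, interior_subset hK.zero_mem_interior⟩
    (f := fun x => (inner ℝ d x : ℝ)) (by fun_prop)
  refine ⟨y, hy, fun x hx => abs_le'.2 ⟨hmax hx, ?_⟩⟩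
  simpa using hmax (hK.neg_mem hx)

theorem exists_sqBall_subset (hK : IsSymmetricConvexBody K) : ∃ r, 0 < r ∧ sqBall n r ⊆ K := by
  obtain ⟨ε, hε, h⟩ := Metric.isOpen_iff.1 isOpen_interior _ hK.zero_mem_interior
  refine ⟨ε ^ 2, by positivity, fun x hx => interior_subset (h ?_)⟩
  rw [mem_sqBall] at hx
  simpa using lt_of_pow_lt_pow_left₀ 2 hε.le hx

end IsSymmetricConvexBody

theorem inner_lt_of_mem_interior {K : Set (EuclideanSpace ℝ (Fin n))}
    {d : EuclideanSpace ℝ (Fin n)} (hd : d ≠ 0) {c : ℝ} (h : ∀ x ∈ K, |inner ℝ d x| ≤ c)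
    {x} (hx : x ∈ interior K) : |inner ℝ d x| < c := by
  have key : ∀ e : EuclideanSpace ℝ (Fin n), e ≠ 0 → (∀ x ∈ K, inner ℝ e x ≤ c) →
      inner ℝ e x < c := by
    intro e he h
    have hcont : Tendsto (fun t : ℝ => x + t • e) (𝓝[>] 0) (𝓝 x) := by
      have : Tendsto (fun t : ℝ => x + t • e) (𝓝 0) (𝓝 (x + (0 : ℝ) • e)) :=
        Continuous.tendsto (by fun_prop) 0
      rw [zero_smul, add_zero] at this
      exact this.mono_left nhdsWithin_le_nhds
    obtain ⟨t, ht, ht0⟩ := ((hcont.eventually_mem (isOpen_interior.mem_nhds hx)).and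
      self_mem_nhdsWithin).exists
    have h1 := h _ (interior_subset ht)
    rw [inner_add_right, inner_smul_right, real_inner_self_eq_norm_sq] at h1
    have : 0 < t * ‖e‖ ^ 2 := mul_pos ht0 (by positivity)
    linarith
  refine abs_lt.2 ⟨?_, key d hd fun y hy => (le_abs_self _).trans (h y hy)⟩
  have := key (-d) (neg_ne_zero.2 hd) fun y hy => by
    rw [inner_neg_left]; exact (neg_le_abs _).trans (h y hy)
  rw [inner_neg_left] at this
  linarith

theorem exists_slab_separation {K L : Set (EuclideanSpace ℝ (Fin n))}
    (hK : IsSymmetricConvexBody K) (hL : IsSymmetricConvexBody L) {lam : ℝ}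
    {x : EuclideanSpace ℝ (Fin n)} (hx : x ∉ (1 - lam) • K + lam • L) :
    ∃ (d : EuclideanSpace ℝ (Fin n)) (p q : ℝ), d ≠ 0 ∧ (∀ y ∈ K, |inner ℝ d y| ≤ p) ∧
      (∀ y ∈ L, |inner ℝ d y| ≤ q) ∧ (1 - lam) * p + lam * q < inner ℝ d x := by
  have hconv : Convex ℝ ((1 - lam) • K + lam • L) := (hK.convex.smul _).add (hL.convex.smul _)
  have hcomp : IsCompact ((1 - lam) • K + lam • L) :=
    (hK.isCompact.smul _).add (hL.isCompact.smul _)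
  obtain ⟨f, u, hf, hu⟩ := geometric_hahn_banach_closed_point hconv hcomp.isClosed hx
  set d := (InnerProductSpace.toDual ℝ (EuclideanSpace ℝ (Fin n))).symm f with hd
  have hdf : ∀ y, inner ℝ d y = f y := fun y => InnerProductSpace.toDual_symm_apply
  obtain ⟨y, hy, hymax⟩ := hK.exists_isMax_inner d
  obtain ⟨z, hz, hzmax⟩ := hL.exists_isMax_inner d
  have h1 := hf _ (add_mem_add (smul_mem_smul_set (a := 1 - lam) hy)
    (smul_mem_smul_set (a := lam) hz))
  refine ⟨d, _, _, ?_, hymax, hzmax, ?_⟩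
  · intro h0
    have h2 := hdf x
    have h3 := hf _ (add_mem_add (smul_mem_smul_set (a := 1 - lam)
      (interior_subset hK.zero_mem_interior)) (smul_mem_smul_set (a := lam)
      (interior_subset hL.zero_mem_interior)))
    rw [h0, inner_zero_left] at h2
    simp at h3
    linarith
  · rw [map_add, map_smul, map_smul, ← hdf, ← hdf] at h1
    rw [hdf x]
    simp only [smul_eq_mul] at h1
    linarith

variable (R : RadialWeight n)

theorem thickening_inequality (hn : 1 ≤ n) {K L : Set (EuclideanSpace ℝ (Fin n))}
    (hK : IsSymmetricConvexBody K) (hL : IsSymmetricConvexBody L) {lam : ℝ} (hlam : lam ∈ Icc 0 1)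
    {ρ : ℝ} (hρ : 0 < ρ) {ε : ℝ} (hε : 0 < ε) :
    (1 - lam) * (∫ x in K ∩ sqBall n ρ, R.dens ρ x) ^ ((n : ℝ)⁻¹) +
      lam * (∫ x in L ∩ sqBall n ρ, R.dens ρ x) ^ ((n : ℝ)⁻¹) ≤
      (∫ x in Metric.thickening ε ((1 - lam) • K + lam • L) ∩ sqBall n ρ, R.dens ρ x) ^
        ((n : ℝ)⁻¹) := by
  set M := (1 - lam) • K + lam • L with hM
  have hcomp : IsCompact (Metric.closedBall (0 : EuclideanSpace ℝ (Fin n)) (Real.sqrt ρ) \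
      Metric.thickening ε M) :=
    (isCompact_closedBall _ _).diff Metric.isOpen_thickening
  have hsep : ∀ x : (Metric.closedBall (0 : EuclideanSpace ℝ (Fin n)) (Real.sqrt ρ) \
      Metric.thickening ε M : Set _), ∃ (d : EuclideanSpace ℝ (Fin n)) (p q : ℝ), d ≠ 0 ∧
      (∀ y ∈ K, |inner ℝ d y| ≤ p) ∧ (∀ y ∈ L, |inner ℝ d y| ≤ q) ∧
      (1 - lam) * p + lam * q < inner ℝ d x.1 := fun x =>
    exists_slab_separation hK hL fun hx => x.2.2 (Metric.self_subset_thickening hε _ hx)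
  choose d p q hd hp hq hx using hsep
  obtain ⟨t, ht⟩ := hcomp.elim_finite_subcover
    (fun x => {y | (1 - lam) * p x + lam * q x < inner ℝ (d x) y})
    (fun x => isOpen_lt (by fun_prop) (by fun_prop))
    fun x hxm => mem_iUnion.2 ⟨⟨x, hxm⟩, hx ⟨x, hxm⟩⟩
  obtain ⟨r₁, hr₁, hr₁K⟩ := hK.exists_sqBall_subset
  obtain ⟨r₂, hr₂, hr₂L⟩ := hL.exists_sqBall_subset
  have hball : ∀ {a b : ℝ}, a ≤ b → sqBall n a ⊆ sqBall n b := fun hab x hx =>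
    mem_sqBall.2 ((mem_sqBall.1 hx).trans_le hab)
  have key := slab_inequality R hn (ι := t) (d := fun i => d i.1) (p := fun i => p i.1)
    (q := fun i => q i.1) (r := min ρ (min r₁ r₂)) (ρ := ρ) (lam := lam) (fun i => hd i.1)
    (lt_min hρ (lt_min hr₁ hr₂)) (min_le_left _ _)
    (fun i x hx => hp _ _ (hr₁K (hball ((min_le_right _ _).trans (min_le_left _ _)) hx)))
    (fun i x hx => hq _ _ (hr₂L (hball ((min_le_right _ _).trans (min_le_right _ _)) hx))) hlam
  have hint : ∀ S : Set (EuclideanSpace ℝ (Fin n)), S ⊆ sqBall n ρ →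
      IntegrableOn (R.dens ρ) S := fun S hS =>
    (integrableOn_sqBall_of_continuous (R.continuous_dens ρ)).mono_set hS
  have hexp : (0 : ℝ) ≤ (n : ℝ)⁻¹ := by positivity
  have hlow : ∀ {A : Set (EuclideanSpace ℝ (Fin n))} {h : t → ℝ}, IsSymmetricConvexBody A →
      (∀ i : t, ∀ y ∈ A, |inner ℝ (d i.1) y| ≤ h i) →
      (∫ x in A ∩ sqBall n ρ, R.dens ρ x) ^ ((n : ℝ)⁻¹) ≤
      (∫ x in openSlab (fun i : t => d i.1) ρ h, R.dens ρ x) ^ ((n : ℝ)⁻¹) := by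
    intro A h hA hb
    have hae : (A ∩ sqBall n ρ : Set _) =ᵐ[volume] (interior A ∩ sqBall n ρ : Set _) :=
      (interior_ae_eq_of_null_frontier (hA.convex.addHaar_frontier volume)).symm.inter
        (ae_eq_refl _)
    rw [setIntegral_congr_set hae]
    refine Real.rpow_le_rpow (integral_nonneg fun x => R.dens_nonneg ρ x) ?_ hexp
    refine setIntegral_mono_set (hint _ inter_subset_left)
      (Eventually.of_forall fun x => R.dens_nonneg ρ x) (LE.le.eventuallyLE ?_)
    exact fun x hx => ⟨hx.2, mem_iInter.2 fun i => inner_lt_of_mem_interior (hd _) (hb i) hx.1⟩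
  refine le_trans (add_le_add
    (mul_le_mul_of_nonneg_left (hlow hK fun i => hp i.1) (sub_nonneg.2 hlam.2))
    (mul_le_mul_of_nonneg_left (hlow hL fun i => hq i.1) hlam.1)) (key.trans ?_)
  refine Real.rpow_le_rpow (integral_nonneg fun x => R.dens_nonneg ρ x) ?_ hexp
  refine setIntegral_mono_set (hint _ inter_subset_right)
    (Eventually.of_forall fun x => R.dens_nonneg ρ x) (LE.le.eventuallyLE ?_)
  refine fun x hx => ⟨by_contra fun hxM => ?_, hx.1⟩
  have hxb : x ∈ Metric.closedBall (0 : EuclideanSpace ℝ (Fin n)) (Real.sqrt ρ) := by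
    have := hx.1
    rw [mem_sqBall] at this
    simpa using Real.le_sqrt_of_sq_le this.le
  obtain ⟨i, hi, hxi⟩ := mem_iUnion₂.1 (ht ⟨hxb, hxM⟩)
  have h1 : |inner ℝ (d i) x| ≤ (1 - lam) * p i + lam * q i := mem_iInter.1 hx.2 ⟨i, hi⟩
  exact absurd ((le_abs_self _).trans h1) (not_le.2 hxi)

theorem sqBall_body_inequality (hn : 1 ≤ n) {K L : Set (EuclideanSpace ℝ (Fin n))}
    (hK : IsSymmetricConvexBody K) (hL : IsSymmetricConvexBody L) {lam : ℝ} (hlam : lam ∈ Icc 0 1)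
    {ρ : ℝ} (hρ : 0 < ρ) :
    (1 - lam) * (∫ x in K ∩ sqBall n ρ, R.dens ρ x) ^ ((n : ℝ)⁻¹) +
      lam * (∫ x in L ∩ sqBall n ρ, R.dens ρ x) ^ ((n : ℝ)⁻¹) ≤
      (∫ x in ((1 - lam) • K + lam • L) ∩ sqBall n ρ, R.dens ρ x) ^ ((n : ℝ)⁻¹) := by
  have hcomp : IsCompact ((1 - lam) • K + lam • L) :=
    (hK.isCompact.smul _).add (hL.isCompact.smul _)
  have hanti : Antitone fun k : ℕ =>
      Metric.thickening (1 / ((k : ℝ) + 1)) ((1 - lam) • K + lam • L) ∩ sqBall n ρ := by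
    intro j k hjk
    refine inter_subset_inter_left _ (Metric.thickening_mono ?_ _)
    exact one_div_le_one_div_of_le (by positivity) (by simpa using hjk)
  have hlim := tendsto_setIntegral_of_antitone (μ := volume) (f := R.dens ρ)
    (fun k => (Metric.isOpen_thickening.inter (isOpen_sqBall ρ)).measurableSet) hanti
    ⟨0, (integrableOn_sqBall_of_continuous (R.continuous_dens ρ)).mono_set inter_subset_right⟩
  have hInter : ⋂ k : ℕ, (Metric.thickening (1 / ((k : ℝ) + 1)) ((1 - lam) • K + lam • L) ∩
      sqBall n ρ) = ((1 - lam) • K + lam • L) ∩ sqBall n ρ := by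
    rw [← iInter_inter]
    congr 1
    refine Subset.antisymm (fun x hx => ?_) (subset_iInter fun k =>
      Metric.self_subset_thickening (by positivity) _)
    rw [← hcomp.isClosed.closure_eq, Metric.closure_eq_iInter_thickening]
    refine mem_iInter₂.2 fun δ hδ => ?_
    obtain ⟨k, hk⟩ := exists_nat_one_div_lt hδ
    exact Metric.thickening_mono hk.le _ (mem_iInter.1 hx k)
  rw [hInter] at hlim
  exact ge_of_tendsto' (hlim.rpow_const (Or.inr (by positivity))) fun k =>
    thickening_inequality R hn hK hL hlam hρ (by positivity)

theorem tendsto_setIntegral_dens {A : Set (EuclideanSpace ℝ (Fin n))} (hA : IsCompact A) :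
    Tendsto (fun ρ => (2 / ρ) ^ 2 * ∫ x in A ∩ sqBall n ρ, R.dens ρ x) atTop
      (𝓝 (∫ x in A, Real.exp (-R.V x))) := by
  have hVc : Continuous fun x => Real.exp (-R.V x) := Real.continuous_exp.comp R.V.continuous.neg
  have h1 : Tendsto (fun ρ => ∫ x in A, (1 - ‖x‖ ^ 2 / ρ) ^ 2 * Real.exp (-R.V x)) atTop
      (𝓝 (∫ x in A, Real.exp (-R.V x))) := by
    obtain ⟨B, hB⟩ := hA.isBounded.exists_norm_le
    refine tendsto_integral_filter_of_dominated_convergence (fun x => Real.exp (-R.V x)) ?_ ?_ ?_ ?_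
    · exact Eventually.of_forall fun ρ => Continuous.aestronglyMeasurable
        (((continuous_const.sub ((continuous_norm.pow 2).div_const ρ)).pow 2).mul hVc)
    · filter_upwards [eventually_gt_atTop (B ^ 2), eventually_gt_atTop 0] with ρ hρ hρ0
      refine (ae_restrict_iff' hA.measurableSet).2 (Eventually.of_forall fun x hx => ?_)
      rw [Real.norm_of_nonneg (by positivity)]
      have h2 : ‖x‖ ^ 2 / ρ ≤ 1 := (div_le_one hρ0).2
        ((pow_le_pow_left₀ (norm_nonneg _) (hB x hx) 2).trans hρ.le)
      have h3 : 0 ≤ ‖x‖ ^ 2 / ρ := by positivity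
      refine mul_le_of_le_one_left (Real.exp_pos _).le ?_
      exact pow_le_one₀ (by linarith) (by linarith)
    · exact hVc.continuousOn.integrableOn_compact hA
    · refine Eventually.of_forall fun x => ?_
      have h2 : Tendsto (fun ρ : ℝ => ‖x‖ ^ 2 / ρ) atTop (𝓝 0) := tendsto_id.const_div_atTop _
      have h3 := (((tendsto_const_nhds (x := (1 : ℝ))).sub h2).pow 2).mul_const (Real.exp (-R.V x))
      simpa using h3
  refine h1.congr' ?_
  obtain ⟨B, hB⟩ := hA.isBounded.exists_norm_le
  filter_upwards [eventually_gt_atTop (B ^ 2), eventually_gt_atTop 0] with ρ hρ hρ0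
  have hsub : A ⊆ sqBall n ρ := fun x hx => mem_sqBall.2
    ((pow_le_pow_left₀ (norm_nonneg _) (hB x hx) 2).trans_lt hρ)
  rw [inter_eq_left.2 hsub, ← integral_const_mul]
  congr 1 with x
  rw [RadialWeight.dens, bump_apply]
  field_simp

theorem RadialWeight.body_inequality (hn : 1 ≤ n) {K L : Set (EuclideanSpace ℝ (Fin n))}
    (hK : IsSymmetricConvexBody K) (hL : IsSymmetricConvexBody L) {lam : ℝ}
    (hlam : lam ∈ Icc 0 1) :
    (1 - lam) * (∫ x in K, Real.exp (-R.V x)) ^ ((n : ℝ)⁻¹) +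
      lam * (∫ x in L, Real.exp (-R.V x)) ^ ((n : ℝ)⁻¹) ≤
      (∫ x in (1 - lam) • K + lam • L, Real.exp (-R.V x)) ^ ((n : ℝ)⁻¹) := by
  have hcomp : IsCompact ((1 - lam) • K + lam • L) :=
    (hK.isCompact.smul _).add (hL.isCompact.smul _)
  have hlim : ∀ {A : Set (EuclideanSpace ℝ (Fin n))}, IsCompact A → Tendsto (fun ρ => ((2 / ρ) ^ 2 *
      ∫ x in A ∩ sqBall n ρ, R.dens ρ x) ^ ((n : ℝ)⁻¹)) atTop
      (𝓝 ((∫ x in A, Real.exp (-R.V x)) ^ ((n : ℝ)⁻¹))) := fun hA =>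
    (tendsto_setIntegral_dens R hA).rpow_const (Or.inr (by positivity))
  refine le_of_tendsto_of_tendsto (((hlim hK.isCompact).const_mul _).add
    ((hlim hL.isCompact).const_mul _)) (hlim hcomp) ?_
  filter_upwards [eventually_gt_atTop 0] with ρ hρ
  have hnn : ∀ A : Set (EuclideanSpace ℝ (Fin n)), 0 ≤ ∫ x in A ∩ sqBall n ρ, R.dens ρ x :=
    fun A => integral_nonneg fun x => R.dens_nonneg ρ x
  rw [Real.mul_rpow (by positivity) (hnn _), Real.mul_rpow (by positivity) (hnn _),
    Real.mul_rpow (by positivity) (hnn _)]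
  have := mul_le_mul_of_nonneg_left (sqBall_body_inequality R hn hK hL hlam hρ)
    (show (0 : ℝ) ≤ ((2 / ρ) ^ 2) ^ ((n : ℝ)⁻¹) by positivity)
  linarith

end BodyInequality

noncomputable section ConvexSmoothing

open SmoothFn Filter Topology
open scoped ContDiff Convolution

variable {n : ℕ}

theorem contDiff_shiftedLog {η : ℝ} (hη : 0 < η) {G : ℝ → ℝ} (hG : ContDiff ℝ ∞ G) :
    ContDiff ℝ ∞ fun x : EuclideanSpace ℝ (Fin n) => G (Real.log (‖x‖ ^ 2 + η) / 2) := by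
  refine hG.comp (ContDiff.div_const (ContDiff.log ?_ fun x => by positivity) 2)
  exact (contDiff_norm_sq ℝ).add contDiff_const

/-- The radial weight `x ↦ G (log (‖x‖ ^ 2 + η) / 2)` for a smooth increasing convex `G`. -/
def radialWeightOfConvex (n : ℕ) {G : ℝ → ℝ} (hG : ContDiff ℝ ∞ G) (hmono : Monotone G)
    (hconv : ConvexOn ℝ univ G) {η : ℝ} (hη : 0 < η) : RadialWeight n where
  prof y := G (Real.log (y + η) / 2)
  prof' y := deriv G (Real.log (y + η) / 2) / (2 * (y + η))
  prof'' y := deriv (deriv G) (Real.log (y + η) / 2) / (2 * (y + η)) ^ 2 -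
    2 * deriv G (Real.log (y + η) / 2) / (2 * (y + η)) ^ 2
  V := ⟨_, mem_smoothSubalgebra.2 (contDiff_shiftedLog hη hG)⟩
  V' := ⟨fun x => deriv G (Real.log (‖x‖ ^ 2 + η) / 2) / (2 * (‖x‖ ^ 2 + η)),
    mem_smoothSubalgebra.2 ((contDiff_shiftedLog hη (contDiff_infty_iff_deriv.1 hG).2).div
      (contDiff_const.mul ((contDiff_norm_sq ℝ).add contDiff_const)) fun x => by positivity)⟩
  V'' := ⟨fun x => deriv (deriv G) (Real.log (‖x‖ ^ 2 + η) / 2) / (2 * (‖x‖ ^ 2 + η)) ^ 2 -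
      2 * deriv G (Real.log (‖x‖ ^ 2 + η) / 2) / (2 * (‖x‖ ^ 2 + η)) ^ 2,
    mem_smoothSubalgebra.2 (((contDiff_shiftedLog hη
      (contDiff_infty_iff_deriv.1 (contDiff_infty_iff_deriv.1 hG).2).2).div
        ((contDiff_const.mul ((contDiff_norm_sq ℝ).add contDiff_const)).pow 2)
        fun x => by positivity).sub
      ((contDiff_const.mul (contDiff_shiftedLog hη (contDiff_infty_iff_deriv.1 hG).2)).div
        ((contDiff_const.mul ((contDiff_norm_sq ℝ).add contDiff_const)).pow 2)
        fun x => by positivity))⟩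
  V_apply _ := rfl
  V'_apply _ := rfl
  V''_apply _ := rfl
  hasDerivAt y hy := by
    have hy' : 0 < y + η := by linarith
    have h1 := (((hasDerivAt_id y).add_const η).log hy'.ne').div_const 2
    have h2 := ((hG.differentiable (by simp)) (Real.log (y + η) / 2)).hasDerivAt
    refine (h2.comp y h1).congr_deriv ?_
    simp only [id]
    field_simp
  hasDerivAt' y hy := by
    have hy' : 0 < y + η := by linarith
    have h1 := (((hasDerivAt_id y).add_const η).log hy'.ne').div_const 2
    have h2 := (((contDiff_infty_iff_deriv.1 hG).2.differentiable (by simp))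
      (Real.log (y + η) / 2)).hasDerivAt
    refine ((h2.comp y h1).div (((hasDerivAt_id y).add_const η).const_mul 2)
      (by simp only [id]; positivity)).congr_deriv ?_
    simp only [id, Function.comp]
    field_simp
  continuousOn'' := by
    have hlog : ContinuousOn (fun y => Real.log (y + η) / 2) (Ici 0) :=
      (ContinuousOn.log (by fun_prop) fun y hy => by
        have := mem_Ici.1 hy
        positivity).div_const 2
    have hne : ∀ y ∈ Ici (0 : ℝ), (2 * (y + η)) ^ 2 ≠ 0 := fun y hy => by
      have := mem_Ici.1 hy
      positivity
    have hc1 := (contDiff_infty_iff_deriv.1 hG).2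
    have hc2 := (contDiff_infty_iff_deriv.1 hc1).2
    exact ((hc2.continuous.comp_continuousOn hlog).div (by fun_prop) hne).sub
      ((continuousOn_const.mul (hc1.continuous.comp_continuousOn hlog)).div (by fun_prop) hne)
  nonneg' y hy := div_nonneg (hmono.deriv_nonneg) (by positivity)
  convex' y hy := by
    have hy' : 0 < y + η := by linarith
    have h1 : 0 ≤ deriv G (Real.log (y + η) / 2) := hmono.deriv_nonneg
    have hmono' : Monotone (deriv G) := monotoneOn_univ.1
      (hconv.monotoneOn_deriv fun x _ => (hG.differentiable (by simp)) x)
    have h2 : 0 ≤ deriv (deriv G) (Real.log (y + η) / 2) := hmono'.deriv_nonneg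
    have : deriv G (Real.log (y + η) / 2) / (2 * (y + η)) +
        y * (deriv (deriv G) (Real.log (y + η) / 2) / (2 * (y + η)) ^ 2 -
          2 * deriv G (Real.log (y + η) / 2) / (2 * (y + η)) ^ 2) =
        (2 * η * deriv G (Real.log (y + η) / 2) + y * deriv (deriv G) (Real.log (y + η) / 2)) /
          (2 * (y + η)) ^ 2 := by
      field_simp
      ring
    rw [this]
    positivity

theorem ContDiffBump.normed_convolution_apply (φ : ContDiffBump (0 : ℝ)) (g : ℝ → ℝ) (t : ℝ) :
    (φ.normed volume ⋆[ContinuousLinearMap.lsmul ℝ ℝ, volume] g) t =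
      ∫ s, φ.normed volume s * g (t - s) := rfl

theorem ContDiffBump.integrable_normed_mul (φ : ContDiffBump (0 : ℝ)) {g : ℝ → ℝ}
    (hg : Continuous g) (t : ℝ) : Integrable fun s => φ.normed volume s * g (t - s) :=
  (φ.continuous_normed.mul (by fun_prop)).integrable_of_hasCompactSupport
    φ.hasCompactSupport_normed.mul_right

theorem ContDiffBump.monotone_normed_convolution (φ : ContDiffBump (0 : ℝ)) {g : ℝ → ℝ}
    (hg : Continuous g) (hmono : Monotone g) :
    Monotone (φ.normed volume ⋆[ContinuousLinearMap.lsmul ℝ ℝ, volume] g) := fun s t hst => by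
  rw [φ.normed_convolution_apply, φ.normed_convolution_apply]
  exact integral_mono (φ.integrable_normed_mul hg s) (φ.integrable_normed_mul hg t) fun u =>
    mul_le_mul_of_nonneg_left (hmono (by linarith)) (φ.nonneg_normed u)

theorem ContDiffBump.convexOn_normed_convolution (φ : ContDiffBump (0 : ℝ)) {g : ℝ → ℝ}
    (hg : Continuous g) (hconv : ConvexOn ℝ univ g) :
    ConvexOn ℝ univ (φ.normed volume ⋆[ContinuousLinearMap.lsmul ℝ ℝ, volume] g) := by
  refine ⟨convex_univ, fun s _ t _ a b ha hb hab => ?_⟩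
  rw [φ.normed_convolution_apply, φ.normed_convolution_apply, φ.normed_convolution_apply,
    smul_eq_mul, smul_eq_mul, smul_eq_mul, smul_eq_mul, ← integral_const_mul,
    ← integral_const_mul, ← integral_add ((φ.integrable_normed_mul hg s).const_mul a)
      ((φ.integrable_normed_mul hg t).const_mul b)]
  refine integral_mono (φ.integrable_normed_mul hg _)
    (((φ.integrable_normed_mul hg s).const_mul a).add
      ((φ.integrable_normed_mul hg t).const_mul b)) fun u => ?_
  have h1 := hconv.2 (mem_univ (s - u)) (mem_univ (t - u)) ha hb hab
  have h2 : a • (s - u) + b • (t - u) = a * s + b * t - u := by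
    simp only [smul_eq_mul]
    linear_combination -u * hab
  rw [h2] at h1
  have h3 := mul_le_mul_of_nonneg_left h1 (φ.nonneg_normed (μ := volume) u)
  simp only [smul_eq_mul] at h3
  dsimp only
  linarith

theorem ContDiffBump.le_normed_convolution (φ : ContDiffBump (0 : ℝ)) {g : ℝ → ℝ}
    (hg : Continuous g) {c : ℝ} (hc : ∀ t, c ≤ g t) (t : ℝ) :
    c ≤ (φ.normed volume ⋆[ContinuousLinearMap.lsmul ℝ ℝ, volume] g) t := by
  rw [φ.normed_convolution_apply]
  calc c = ∫ s, φ.normed volume s * c := by rw [integral_mul_const, φ.integral_normed, one_mul]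
    _ ≤ _ := integral_mono (φ.integrable_normed.mul_const c) (φ.integrable_normed_mul hg t)
      fun s => mul_le_mul_of_nonneg_left (hc _) (φ.nonneg_normed s)

/-- The `1 / n`-concavity of `K ↦ ∫ x in K, f x` on symmetric convex bodies. -/
def DimBrunnMinkowski (f : EuclideanSpace ℝ (Fin n) → ℝ) : Prop :=
  ∀ ⦃K L : Set (EuclideanSpace ℝ (Fin n))⦄, IsSymmetricConvexBody K → IsSymmetricConvexBody L →
    ∀ ⦃lam : ℝ⦄, lam ∈ Icc 0 1 →
      (1 - lam) * (∫ x in K, f x) ^ ((n : ℝ)⁻¹) + lam * (∫ x in L, f x) ^ ((n : ℝ)⁻¹) ≤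
        (∫ x in (1 - lam) • K + lam • L, f x) ^ ((n : ℝ)⁻¹)

theorem DimBrunnMinkowski.of_tendsto {f : ℕ → EuclideanSpace ℝ (Fin n) → ℝ}
    {F : EuclideanSpace ℝ (Fin n) → ℝ} (hf : ∀ k, DimBrunnMinkowski (f k))
    (hm : ∀ k, AEStronglyMeasurable (f k)) {B : ℝ} (hB : ∀ k x, ‖f k x‖ ≤ B)
    (hlim : ∀ᵐ x, Tendsto (fun k => f k x) atTop (𝓝 (F x))) : DimBrunnMinkowski F := by
  intro K L hK hL lam hlam
  have key : ∀ {A : Set (EuclideanSpace ℝ (Fin n))}, IsCompact A →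
      Tendsto (fun k => (∫ x in A, f k x) ^ ((n : ℝ)⁻¹)) atTop
        (𝓝 ((∫ x in A, F x) ^ ((n : ℝ)⁻¹))) := fun hA =>
    (tendsto_integral_of_dominated_convergence (fun _ => B) (fun k => (hm k).restrict)
      (integrableOn_const hA.measure_lt_top.ne) (fun k => Eventually.of_forall (hB k))
      (ae_restrict_of_ae hlim)).rpow_const (Or.inr (by positivity))
  exact le_of_tendsto_of_tendsto' (((key hK.isCompact).const_mul _).add
    ((key hL.isCompact).const_mul _)) (key ((hK.isCompact.smul _).add (hL.isCompact.smul _)))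
    fun k => hf k hK hL hlam

theorem dimBrunnMinkowski_smooth (hn : 1 ≤ n) {G : ℝ → ℝ} (hG : ContDiff ℝ ∞ G)
    (hmono : Monotone G) (hconv : ConvexOn ℝ univ G) {η : ℝ} (hη : 0 < η) :
    DimBrunnMinkowski fun x : EuclideanSpace ℝ (Fin n) =>
      Real.exp (-G (Real.log (‖x‖ ^ 2 + η) / 2)) := fun _ _ hK hL _ hlam =>
  (radialWeightOfConvex n hG hmono hconv hη).body_inequality hn hK hL hlam

theorem norm_exp_neg_le {c y : ℝ} (h : c ≤ y) : ‖Real.exp (-y)‖ ≤ Real.exp (-c) := by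
  rw [Real.norm_of_nonneg (Real.exp_pos _).le]
  exact Real.exp_le_exp.2 (neg_le_neg h)

theorem dimBrunnMinkowski_shifted (hn : 1 ≤ n) {g : ℝ → ℝ} (hmono : Monotone g)
    (hconv : ConvexOn ℝ univ g) {c : ℝ} (hc : ∀ t, c ≤ g t) {η : ℝ} (hη : 0 < η) :
    DimBrunnMinkowski fun x : EuclideanSpace ℝ (Fin n) =>
      Real.exp (-g (Real.log (‖x‖ ^ 2 + η) / 2)) := by
  have hg : Continuous g := continuousOn_univ.1 (hconv.continuousOn isOpen_univ)
  let φ : ℕ → ContDiffBump (0 : ℝ) := fun k =>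
    ⟨1 / ((k : ℝ) + 1) / 2, 1 / ((k : ℝ) + 1), by positivity, half_lt_self (by positivity)⟩
  have hφ : Tendsto (fun k => (φ k).rOut) atTop (𝓝 0) := tendsto_one_div_add_atTop_nhds_zero_nat
  have hsmooth : ∀ k, ContDiff ℝ ∞
      ((φ k).normed volume ⋆[ContinuousLinearMap.lsmul ℝ ℝ, volume] g) := fun k =>
    (φ k).hasCompactSupport_normed.contDiff_convolution_left _ (φ k).contDiff_normed
      hg.locallyIntegrable
  refine DimBrunnMinkowski.of_tendsto (B := Real.exp (-c)) (fun k => dimBrunnMinkowski_smooth hn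
    (hsmooth k) ((φ k).monotone_normed_convolution hg hmono)
    ((φ k).convexOn_normed_convolution hg hconv) hη) (fun k => ?_) (fun k x => ?_) ?_
  · exact (Real.continuous_exp.comp
      (contDiff_shiftedLog hη (hsmooth k)).continuous.neg).aestronglyMeasurable
  · exact norm_exp_neg_le ((φ k).le_normed_convolution hg hc _)
  · refine Eventually.of_forall fun x => ?_
    exact (Real.continuous_exp.tendsto _).comp
      (ContDiffBump.convolution_tendsto_right_of_continuous hφ hg _).neg

theorem ae_ne_zero_euclidean (hn : 1 ≤ n) : ∀ᵐ x : EuclideanSpace ℝ (Fin n), x ≠ 0 := by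
  have : Nonempty (Fin n) := ⟨⟨0, hn⟩⟩
  have : Nontrivial (EuclideanSpace ℝ (Fin n)) := inferInstance
  exact Measure.ae_ne volume 0

theorem dimBrunnMinkowski_log_norm (hn : 1 ≤ n) {g : ℝ → ℝ} (hmono : Monotone g)
    (hconv : ConvexOn ℝ univ g) {c : ℝ} (hc : ∀ t, c ≤ g t) :
    DimBrunnMinkowski fun x : EuclideanSpace ℝ (Fin n) => Real.exp (-g (Real.log ‖x‖)) := by
  have hg : Continuous g := continuousOn_univ.1 (hconv.continuousOn isOpen_univ)
  refine DimBrunnMinkowski.of_tendsto (B := Real.exp (-c)) (fun k : ℕ =>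
    dimBrunnMinkowski_shifted hn hmono hconv hc (η := 1 / ((k : ℝ) + 1)) (by positivity))
    (fun k => ?_) (fun k x => norm_exp_neg_le (hc _)) ?_
  · refine Continuous.aestronglyMeasurable (Real.continuous_exp.comp (hg.comp
      (Continuous.div_const (Continuous.log ?_ fun x => by positivity) 2)).neg)
    exact (continuous_norm.pow 2).add continuous_const
  · filter_upwards [ae_ne_zero_euclidean hn] with x hx
    refine (Real.continuous_exp.tendsto _).comp (((hg.tendsto _).comp ?_).neg)
    have hx' : ‖x‖ ^ 2 ≠ 0 := by positivity
    have h1 : Tendsto (fun k : ℕ => ‖x‖ ^ 2 + 1 / ((k : ℝ) + 1)) atTop (𝓝 (‖x‖ ^ 2)) := by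
      simpa using (tendsto_one_div_add_atTop_nhds_zero_nat (𝕜 := ℝ)).const_add (‖x‖ ^ 2)
    have h2 := (h1.log hx').div_const 2
    rwa [Real.log_pow, Nat.cast_ofNat, mul_div_cancel_left₀ _ two_ne_zero] at h2

end ConvexSmoothing

noncomputable section LipschitzRegularization

open Filter Topology

variable {n : ℕ} {D : Set ℝ} {g : ℝ → ℝ} {c : ℝ}

/-- The infimal convolution on `D` of `g` with the one-sided slope `k * max · 0`. -/
def lipReg (D : Set ℝ) (g : ℝ → ℝ) (k t : ℝ) : ℝ := ⨅ s : D, (g s + k * max (t - s) 0)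

theorem bddBelow_lipReg (hc : ∀ s ∈ D, c ≤ g s) {k : ℝ} (hk : 0 ≤ k) (t : ℝ) :
    BddBelow (range fun s : D => g s + k * max (t - s) 0) := by
  refine ⟨c, ?_⟩
  rintro _ ⟨s, rfl⟩
  have := hc s s.2
  have : 0 ≤ k * max (t - (s : ℝ)) 0 := by positivity
  dsimp only
  linarith

theorem lipReg_le (hc : ∀ s ∈ D, c ≤ g s) {k : ℝ} (hk : 0 ≤ k) (t : ℝ) {s : ℝ} (hs : s ∈ D) :
    lipReg D g k t ≤ g s + k * max (t - s) 0 :=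
  ciInf_le (bddBelow_lipReg hc hk t) (⟨s, hs⟩ : D)

theorem le_lipReg (hD : D.Nonempty) {k t b : ℝ} (h : ∀ s ∈ D, b ≤ g s + k * max (t - s) 0) :
    b ≤ lipReg D g k t := by
  have := hD.to_subtype
  exact le_ciInf fun s : D => h s s.2

theorem le_lipReg_const (hD : D.Nonempty) (hc : ∀ s ∈ D, c ≤ g s) {k : ℝ} (hk : 0 ≤ k) (t : ℝ) :
    c ≤ lipReg D g k t := le_lipReg hD fun s hs => by
  have := hc s hs
  have : 0 ≤ k * max (t - s) 0 := by positivity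
  linarith

theorem monotone_lipReg (hD : D.Nonempty) (hc : ∀ s ∈ D, c ≤ g s) {k : ℝ} (hk : 0 ≤ k) :
    Monotone (lipReg D g k) := fun t u htu => le_lipReg hD fun s hs =>
  (lipReg_le hc hk t hs).trans <| by gcongr

theorem convexOn_lipReg (hD : D.Nonempty) (hg : ConvexOn ℝ D g) (hc : ∀ s ∈ D, c ≤ g s) {k : ℝ}
    (hk : 0 ≤ k) : ConvexOn ℝ univ (lipReg D g k) := by
  refine ⟨convex_univ, fun t _ u _ a b ha hb hab => ?_⟩
  have := hD.to_subtype
  simp only [smul_eq_mul]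
  have key : ∀ s r : D, lipReg D g k (a * t + b * u) ≤
      a * (g s + k * max (t - s) 0) + b * (g r + k * max (u - r) 0) := by
    intro s r
    have h1 := lipReg_le hc hk (a * t + b * u) (hg.1 s.2 r.2 ha hb hab)
    have h2 := hg.2 s.2 r.2 ha hb hab
    simp only [smul_eq_mul] at h1 h2
    have h3 : max (a * t + b * u - (a * s + b * r)) 0 ≤
        a * max (t - (s : ℝ)) 0 + b * max (u - (r : ℝ)) 0 := by
      refine max_le ?_ (by positivity)
      have h4 := mul_le_mul_of_nonneg_left (le_max_left (t - (s : ℝ)) 0) ha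
      have h5 := mul_le_mul_of_nonneg_left (le_max_left (u - (r : ℝ)) 0) hb
      linarith
    have h6 := mul_le_mul_of_nonneg_left h3 hk
    linarith
  have h1 : ∀ r : D, lipReg D g k (a * t + b * u) - b * (g r + k * max (u - r) 0) ≤
      a * lipReg D g k t := fun r => by
    rw [lipReg, lipReg, Real.mul_iInf_of_nonneg ha]
    exact le_ciInf fun s => by
      have := key s r
      rw [lipReg] at this
      linarith
  have h2 : lipReg D g k (a * t + b * u) - a * lipReg D g k t ≤ b * lipReg D g k u := by
    conv_rhs => rw [lipReg, Real.mul_iInf_of_nonneg hb]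
    exact le_ciInf fun r => by linarith [h1 r]
  linarith

theorem lipReg_eventually_eq (hg : ConvexOn ℝ D g) (hmono : MonotoneOn g D)
    (hc : ∀ s ∈ D, c ≤ g s) {t : ℝ} (ht : t ∈ interior D) :
    ∀ᶠ k : ℝ in atTop, lipReg D g k t = g t := by
  have htD := interior_subset ht
  have hev : ∀ᶠ u in 𝓝[>] t, u ∈ D := nhdsWithin_le_nhds (mem_interior_iff_mem_nhds.1 ht)
  obtain ⟨u, huD, htu⟩ := (hev.and self_mem_nhdsWithin).exists
  have htu' : t < u := htu
  filter_upwards [eventually_ge_atTop ((g u - g t) / (u - t)), eventually_ge_atTop 0] with k hk hk0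
  refine le_antisymm ?_ (le_lipReg ⟨t, htD⟩ fun s hs => ?_)
  · simpa using lipReg_le hc hk0 t htD
  · rcases lt_or_ge s t with hst | hst
    · have h1 := hg.slope_mono_adjacent hs huD hst htu'
      have h2 := (div_le_iff₀ (sub_pos.2 hst)).1 (h1.trans hk)
      rw [max_eq_left (sub_pos.2 hst).le]
      linarith
    · have := hmono htD hs hst
      rw [max_eq_right (by linarith)]
      linarith

theorem tendsto_lipReg_atTop (hD : D.Nonempty) (hlow : ∀ s t, s ≤ t → t ∈ D → s ∈ D)
    (hc : ∀ s ∈ D, c ≤ g s) {t : ℝ} (ht : t ∉ closure D) :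
    Tendsto (fun k => lipReg D g k t) atTop atTop := by
  obtain ⟨δ, hδ, hball⟩ := Metric.isOpen_iff.1 isClosed_closure.isOpen_compl t ht
  have hle : ∀ s ∈ D, δ / 2 ≤ t - s := fun s hs => by
    by_contra! hlt
    have hmem : t - δ / 2 ∈ D := hlow _ _ (by linarith) hs
    have hb : t - δ / 2 ∈ Metric.ball t δ := by
      rw [Metric.mem_ball, Real.dist_eq, abs_lt]
      constructor <;> linarith
    exact hball hb (subset_closure hmem)
  have hlim : Tendsto (fun k : ℝ => c + k * (δ / 2)) atTop atTop :=
    tendsto_atTop_add_const_left _ _ (tendsto_id.atTop_mul_const (by positivity))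
  refine tendsto_atTop_mono' _ ?_ hlim
  filter_upwards [eventually_ge_atTop 0] with k hk
  refine le_lipReg hD fun s hs => ?_
  have h1 := hc s hs
  have h2 := mul_le_mul_of_nonneg_left ((hle s hs).trans (le_max_left _ 0)) hk
  linarith

theorem subsingleton_frontier_of_lower (hlow : ∀ s t, s ≤ t → t ∈ D → s ∈ D) :
    (frontier D).Subsingleton := by
  have key : ∀ t ∈ frontier D, ∀ u ∈ frontier D, u ≤ t := fun t ht u hu => by
    by_contra! htu
    obtain ⟨s, hs, hsD⟩ := mem_closure_iff.1 hu.1 (Ioi t) isOpen_Ioi htu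
    exact ht.2 (interior_maximal (fun r hr => hlow r s (le_of_lt hr) hsD) isOpen_Iio hs)
  exact fun t ht u hu => le_antisymm (key u hu t ht) (key t ht u hu)

theorem ae_log_norm_notMem_frontier (hn : 1 ≤ n) (hlow : ∀ s t, s ≤ t → t ∈ D → s ∈ D) :
    ∀ᵐ x : EuclideanSpace ℝ (Fin n), Real.log ‖x‖ ∉ frontier D := by
  rcases (subsingleton_frontier_of_lower hlow).eq_empty_or_singleton with h | ⟨T, h⟩
  · simp [h]
  · rw [h]
    have h1 : ∀ᵐ x : EuclideanSpace ℝ (Fin n), x ∉ Metric.sphere 0 (Real.exp T) :=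
      measure_eq_zero_iff_ae_notMem.1
        (Measure.addHaar_sphere_of_ne_zero volume 0 (Real.exp_pos T).ne')
    filter_upwards [h1, ae_ne_zero_euclidean hn] with x hx hx0 hxT
    rw [mem_singleton_iff] at hxT
    apply hx
    rw [mem_sphere_zero_iff_norm, ← hxT, Real.exp_log (norm_pos_iff.2 hx0)]

open Classical in
theorem ae_tendsto_exp_neg_lipReg (hn : 1 ≤ n) (hD : D.Nonempty)
    (hlow : ∀ s t, s ≤ t → t ∈ D → s ∈ D) (hg : ConvexOn ℝ D g) (hmono : MonotoneOn g D)
    (hc : ∀ s ∈ D, c ≤ g s) :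
    ∀ᵐ x : EuclideanSpace ℝ (Fin n),
      Tendsto (fun k : ℕ => Real.exp (-lipReg D g k (Real.log ‖x‖))) atTop
        (𝓝 (if Real.log ‖x‖ ∈ D then Real.exp (-g (Real.log ‖x‖)) else 0)) := by
  filter_upwards [ae_log_norm_notMem_frontier hn hlow] with x hx
  by_cases hxD : Real.log ‖x‖ ∈ D
  · have hint : Real.log ‖x‖ ∈ interior D := by
      by_contra h
      exact hx ⟨subset_closure hxD, h⟩
    rw [if_pos hxD]
    refine tendsto_const_nhds.congr' ?_
    filter_upwards [tendsto_natCast_atTop_atTop.eventually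
      (lipReg_eventually_eq hg hmono hc hint)] with k hk
    rw [hk]
  · have hcl : Real.log ‖x‖ ∉ closure D := fun h =>
      hx ⟨h, fun hi => hxD (interior_subset hi)⟩
    rw [if_neg hxD]
    exact Real.tendsto_exp_atBot.comp (tendsto_neg_atTop_atBot.comp
      ((tendsto_lipReg_atTop hD hlow hc hcl).comp tendsto_natCast_atTop_atTop))

theorem aestronglyMeasurable_exp_neg_log_norm {h : ℝ → ℝ} (hh : Continuous h) :
    AEStronglyMeasurable fun x : EuclideanSpace ℝ (Fin n) => Real.exp (-h (Real.log ‖x‖)) := by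
  have : Measurable fun x : EuclideanSpace ℝ (Fin n) => Real.exp (-h (Real.log ‖x‖)) :=
    Real.measurable_exp.comp (hh.measurable.comp (Real.measurable_log.comp measurable_norm)).neg
  exact this.aestronglyMeasurable

end LipschitzRegularization

noncomputable section ExtendedWeights

open Filter Topology

variable {n : ℕ}

/-- The real density `x ↦ exp (-w ‖x‖)`. -/
def erealDens (w : ℝ → EReal) (x : EuclideanSpace ℝ (Fin n)) : ℝ :=
  (EReal.exp (-(w ‖x‖))).toReal

theorem erealDens_properties (hn : 1 ≤ n) {w : ℝ → EReal} (hw_bot : ∀ s : ℝ, 0 ≤ s → w s ≠ ⊥)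
    (hw_mono : MonotoneOn w (Ici (0 : ℝ)))
    (hw_conv : ∀ s t a b : ℝ, 0 ≤ a → 0 ≤ b → a + b = 1 →
      w (Real.exp (a * s + b * t)) ≤ (a : EReal) * w (Real.exp s) + (b : EReal) * w (Real.exp t))
    (hfin : ∃ t, w (Real.exp t) ≠ ⊤) :
    DimBrunnMinkowski (erealDens (n := n) w) ∧
      AEStronglyMeasurable (erealDens (n := n) w) := by
  classical
  set D : Set ℝ := {t | w (Real.exp t) ≠ ⊤} with hDdef
  set g : ℝ → ℝ := fun t => (w (Real.exp t)).toReal with hgdef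
  have hDmem : ∀ {t}, t ∈ D ↔ w (Real.exp t) ≠ ⊤ := fun {t} => by rw [hDdef, mem_ofPred_eq]
  have hwg : ∀ {t}, t ∈ D → w (Real.exp t) = (g t : EReal) := fun ht =>
    (EReal.coe_toReal (hDmem.1 ht) (hw_bot _ (Real.exp_pos _).le)).symm
  have hD : D.Nonempty := hfin.imp fun t ht => hDmem.2 ht
  have hwm : ∀ {s t}, s ≤ t → w (Real.exp s) ≤ w (Real.exp t) := fun hst =>
    hw_mono (mem_Ici.2 (Real.exp_pos _).le) (mem_Ici.2 (Real.exp_pos _).le) (Real.exp_le_exp.2 hst)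
  have hlow : ∀ s t, s ≤ t → t ∈ D → s ∈ D := fun s t hst ht =>
    hDmem.2 ((hwm hst).trans_lt (lt_top_iff_ne_top.2 (hDmem.1 ht))).ne
  have hmono : MonotoneOn g D := fun s hs t ht hst => by
    have := hwm hst
    rw [hwg hs, hwg ht] at this
    exact_mod_cast this
  have hconv0 : ∀ {s t a b : ℝ}, s ∈ D → t ∈ D → 0 ≤ a → 0 ≤ b → a + b = 1 →
      w (Real.exp (a * s + b * t)) ≤ ((a * g s + b * g t : ℝ) : EReal) := by
    intro s t a b hs ht ha hb hab
    have := hw_conv s t a b ha hb hab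
    rw [hwg hs, hwg ht] at this
    exact_mod_cast this
  have hmemc : ∀ {s t a b : ℝ}, s ∈ D → t ∈ D → 0 ≤ a → 0 ≤ b → a + b = 1 →
      a * s + b * t ∈ D := fun hs ht ha hb hab =>
    hDmem.2 ((hconv0 hs ht ha hb hab).trans_lt (EReal.coe_lt_top _)).ne
  have hg : ConvexOn ℝ D g := by
    refine ⟨fun s hs t ht a b ha hb hab => hmemc hs ht ha hb hab,
      fun s hs t ht a b ha hb hab => ?_⟩
    have := hconv0 hs ht ha hb hab
    rw [hwg (hmemc hs ht ha hb hab)] at this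
    exact_mod_cast this
  obtain ⟨t₀, ht₀⟩ := hD
  have hw0 : w 0 ≠ ⊤ := ((hw_mono (mem_Ici.2 le_rfl) (mem_Ici.2 (Real.exp_pos t₀).le)
    (Real.exp_pos t₀).le).trans_lt (lt_top_iff_ne_top.2 (hDmem.1 ht₀))).ne
  have hc : ∀ s ∈ D, (w 0).toReal ≤ g s := fun s hs => by
    have := hw_mono (mem_Ici.2 le_rfl) (mem_Ici.2 (Real.exp_pos s).le) (Real.exp_pos s).le
    rw [hwg hs, ← EReal.coe_toReal hw0 (hw_bot 0 le_rfl)] at this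
    exact_mod_cast this
  have hDn : D.Nonempty := ⟨t₀, ht₀⟩
  have hcont : ∀ k : ℕ, Continuous (lipReg D g k) := fun k =>
    continuousOn_univ.1 ((convexOn_lipReg hDn hg hc k.cast_nonneg).continuousOn isOpen_univ)
  have hlim : ∀ᵐ x : EuclideanSpace ℝ (Fin n),
      Tendsto (fun k : ℕ => Real.exp (-lipReg D g k (Real.log ‖x‖))) atTop
        (𝓝 (erealDens w x)) := by
    filter_upwards [ae_tendsto_exp_neg_lipReg hn hDn hlow hg hmono hc,
      ae_ne_zero_euclidean hn] with x hx hx0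
    convert hx using 2
    have hexp : Real.exp (Real.log ‖x‖) = ‖x‖ := Real.exp_log (norm_pos_iff.2 hx0)
    split_ifs with hxD
    · have h1 := hwg hxD
      rw [hexp] at h1
      rw [erealDens, h1, ← EReal.coe_neg, EReal.exp_coe, ENNReal.toReal_ofReal (Real.exp_pos _).le]
    · have h1 : w ‖x‖ = ⊤ := by
        by_contra h
        exact hxD (hDmem.2 (by rwa [hexp]))
      rw [erealDens, h1]
      simp
  have hm := fun k : ℕ => aestronglyMeasurable_exp_neg_log_norm (n := n) (hcont k)
  exact ⟨DimBrunnMinkowski.of_tendsto (B := Real.exp (-(w 0).toReal))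
    (fun k => dimBrunnMinkowski_log_norm hn (monotone_lipReg hDn hc k.cast_nonneg)
      (convexOn_lipReg hDn hg hc k.cast_nonneg) (le_lipReg_const hDn hc k.cast_nonneg)) hm
    (fun k x => norm_exp_neg_le (le_lipReg_const hDn hc k.cast_nonneg _)) hlim,
    aestronglyMeasurable_of_tendsto_ae atTop hm hlim⟩

end ExtendedWeights

theorem statement11 (n : ℕ) (hn : 1 ≤ n) (w : ℝ → EReal)
    (hw_bot : ∀ s : ℝ, 0 ≤ s → w s ≠ ⊥)
    (hw_mono : MonotoneOn w (Set.Ici (0 : ℝ)))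
    (hw_conv : ∀ s t a b : ℝ, 0 ≤ a → 0 ≤ b → a + b = 1 →
      w (Real.exp (a * s + b * t)) ≤ (a : EReal) * w (Real.exp s) + (b : EReal) * w (Real.exp t))
    (μ : Measure (EuclideanSpace ℝ (Fin n)))
    (hμ : μ = volume.withDensity (fun x => EReal.exp (-(w ‖x‖))))
    (K L : Set (EuclideanSpace ℝ (Fin n)))
    (hK : IsSymmetricConvexBody K) (hL : IsSymmetricConvexBody L)
    (lam : ℝ) (h0 : 0 ≤ lam) (h1 : lam ≤ 1) :
    ENNReal.ofReal (1 - lam) * μ K ^ ((n : ℝ)⁻¹) + ENNReal.ofReal lam * μ L ^ ((n : ℝ)⁻¹) ≤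
      μ ((1 - lam) • K + lam • L) ^ ((n : ℝ)⁻¹) := by
  have hn0 : (0 : ℝ) < (n : ℝ)⁻¹ := by positivity
  by_cases hfin : ∃ t, w (Real.exp t) ≠ ⊤
  · obtain ⟨hBM, hmeas⟩ := erealDens_properties hn hw_bot hw_mono hw_conv hfin
    have hbound : ∀ x : EuclideanSpace ℝ (Fin n),
        EReal.exp (-(w ‖x‖)) ≤ EReal.exp (-(w 0)) := fun x =>
      EReal.exp_monotone (EReal.neg_le_neg_iff.2
        (hw_mono (mem_Ici.2 le_rfl) (mem_Ici.2 (norm_nonneg x)) (norm_nonneg x)))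
    have htop : EReal.exp (-(w 0)) ≠ ⊤ := by
      rw [Ne, EReal.exp_eq_top_iff, EReal.neg_eq_top_iff]
      exact hw_bot 0 le_rfl
    have hnn : ∀ x : EuclideanSpace ℝ (Fin n), 0 ≤ erealDens w x := fun x => ENNReal.toReal_nonneg
    have hval : ∀ {A : Set (EuclideanSpace ℝ (Fin n))}, IsCompact A →
        μ A = ENNReal.ofReal (∫ x in A, erealDens w x) := by
      intro A hA
      have hint : IntegrableOn (erealDens w) A := by
        refine Measure.integrableOn_of_bounded hA.measure_lt_top.ne hmeas
          (M := (EReal.exp (-(w 0))).toReal) (Filter.Eventually.of_forall fun x => ?_)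
        rw [Real.norm_of_nonneg (hnn x)]
        exact ENNReal.toReal_mono htop (hbound x)
      rw [hμ, withDensity_apply _ hA.measurableSet,
        ofReal_integral_eq_lintegral_ofReal hint (Filter.Eventually.of_forall hnn)]
      refine lintegral_congr fun x => ?_
      rw [erealDens, ENNReal.ofReal_toReal ((hbound x).trans_lt (lt_top_iff_ne_top.2 htop)).ne]
    have hI : ∀ A : Set (EuclideanSpace ℝ (Fin n)), 0 ≤ ∫ x in A, erealDens w x :=
      fun A => integral_nonneg hnn
    rw [hval hK.isCompact, hval hL.isCompact,
      hval ((hK.isCompact.smul _).add (hL.isCompact.smul _)),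
      ENNReal.ofReal_rpow_of_nonneg (hI _) hn0.le, ENNReal.ofReal_rpow_of_nonneg (hI _) hn0.le,
      ENNReal.ofReal_rpow_of_nonneg (hI _) hn0.le, ← ENNReal.ofReal_mul (sub_nonneg.2 h1),
      ← ENNReal.ofReal_mul h0, ← ENNReal.ofReal_add
        (mul_nonneg (sub_nonneg.2 h1) (Real.rpow_nonneg (hI _) _))
        (mul_nonneg h0 (Real.rpow_nonneg (hI _) _))]
    exact ENNReal.ofReal_le_ofReal (hBM hK hL ⟨h0, h1⟩)
  · push Not at hfin
    have hμ0 : μ = 0 := by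
      rw [hμ, ← withDensity_zero (μ := volume)]
      refine withDensity_congr_ae ?_
      filter_upwards [ae_ne_zero_euclidean hn] with x hx
      have := hfin (Real.log ‖x‖)
      rw [Real.exp_log (norm_pos_iff.2 hx)] at this
      simp [this]
    simp [hμ0, ENNReal.zero_rpow_of_pos hn0]
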